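/- Let n ≥ 1, 0 ≤ δ < ρ ≤ 1 with δ < 1, let 1 < p < ∞ and set m_p = n(1−ρ)|1/p − 1/2|. Let a : 𝕋ⁿ × ℤⁿ → ℂ be a symbol, smooth in x, such that for all multi-indices α, β ∈ ℕⁿ there are constants C_{α,β} > 0 with |∂_x^β Δ_ξ^α a(x,ξ)| ≤ C_{α,β} ⟨ξ⟩^{−m_p − ρ|α| + δ|β|} for all (x,ξ) ∈ 𝕋ⁿ × ℤⁿ. Then the periodic pseudo-differential operator a(x,D) is bounded on L^p(𝕋ⁿ). -/

import Mathlib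

open MeasureTheory Real ENNReal

noncomputable section

/-- Partial derivative of a complex-valued function on `ℝⁿ` in the `j`-th coordinate
direction. -/
def pd {n : ℕ} (j : Fin n) (f : (Fin n → ℝ) → ℂ) : (Fin n → ℝ) → ℂ :=
  fun x => fderiv ℝ f x (Pi.single j 1)

/-- The canonical list of directions associated to a multi-index `β ∈ ℕⁿ`. -/
def mIdxList {n : ℕ} (β : Fin n → ℕ) : List (Fin n) :=
  (List.finRange n).flatMap fun j => List.replicate (β j) j

/-- Iterated partial derivative `∂^β` associated to a multi-index `β`. -/
def pdM {n : ℕ} (β : Fin n → ℕ) (f : (Fin n → ℝ) → ℂ) : (Fin n → ℝ) → ℂ :=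
  (mIdxList β).foldr pd f

/-- Forward difference operator in the `j`-th direction on functions of `ξ ∈ ℤⁿ`. -/
def dd {n : ℕ} (j : Fin n) (g : (Fin n → ℤ) → ℂ) : (Fin n → ℤ) → ℂ :=
  fun ξ => g (ξ + Pi.single j 1) - g ξ

/-- Iterated difference operator `Δ_ξ^α` associated to a multi-index `α`. -/
def ddM {n : ℕ} (α : Fin n → ℕ) (g : (Fin n → ℤ) → ℂ) : (Fin n → ℤ) → ℂ :=
  (mIdxList α).foldr dd g

/-- Japanese bracket `⟨ξ⟩ = (1+|ξ|²)^{1/2}` of a lattice point `ξ ∈ ℤⁿ`. -/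
def jb {n : ℕ} (ξ : Fin n → ℤ) : ℝ := Real.sqrt (1 + ∑ j, ((ξ j : ℝ)) ^ 2)

/-- Japanese bracket `⟨ξ⟩ = (1+|ξ|²)^{1/2}` of a vector `ξ ∈ ℝⁿ`. -/
def jbR {n : ℕ} (ξ : Fin n → ℝ) : ℝ := Real.sqrt (1 + ∑ j, (ξ j) ^ 2)

/-- The canonical embedding `ℤⁿ → ℝⁿ`. -/
def castZ {n : ℕ} (ξ : Fin n → ℤ) : Fin n → ℝ := fun j => (ξ j : ℝ)

/-- The fundamental domain `[0,1)ⁿ` of the torus `𝕋ⁿ = ℝⁿ/ℤⁿ`. -/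
def cube (n : ℕ) : Set (Fin n → ℝ) := Set.univ.pi fun _ => Set.Ico (0 : ℝ) 1

/-- The normalized Lebesgue measure of the torus `𝕋ⁿ`, realized as the Lebesgue measure
on `ℝⁿ` restricted to the fundamental domain `[0,1)ⁿ`. -/
def μT (n : ℕ) : Measure (Fin n → ℝ) := volume.restrict (cube n)

/-- `1`-periodicity of a function on `ℝⁿ` (i.e. the function descends to `𝕋ⁿ`). -/
def Per {n : ℕ} (f : (Fin n → ℝ) → ℂ) : Prop :=
  ∀ (x : Fin n → ℝ) (v : Fin n → ℤ), f (x + fun j => (v j : ℝ)) = f x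

/-- The character `e^{2πi⟨x,ξ⟩}`. -/
def eChar {n : ℕ} (x : Fin n → ℝ) (ξ : Fin n → ℤ) : ℂ :=
  Complex.exp (2 * (π : ℂ) * Complex.I * ∑ j, (x j : ℂ) * (ξ j : ℂ))

/-- Fourier coefficient `f̂(ξ) = ∫_{𝕋ⁿ} e^{-2πi⟨x,ξ⟩} f(x) dx` of a function on `𝕋ⁿ`. -/
def fc {n : ℕ} (f : (Fin n → ℝ) → ℂ) (ξ : Fin n → ℤ) : ℂ :=
  ∫ x, Complex.exp (-(2 * (π : ℂ) * Complex.I) * ∑ j, (x j : ℂ) * (ξ j : ℂ)) * f x ∂(μT n)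

/-- Periodic pseudo-differential operator
    `σ(x,D)f(x) = Σ_{ξ ∈ ℤⁿ} e^{2πi⟨x,ξ⟩} σ(x,ξ) f̂(ξ)`
with symbol `σ` on `𝕋ⁿ × ℤⁿ`. -/
def Op {n : ℕ} (σ : (Fin n → ℝ) → (Fin n → ℤ) → ℂ) (f : (Fin n → ℝ) → ℂ) :
    (Fin n → ℝ) → ℂ :=
  fun x => ∑' ξ : Fin n → ℤ, eChar x ξ * σ x ξ * fc f ξ

/-- The `L^p(𝕋ⁿ)` norm, for a real exponent `p`. -/
def lpT (n : ℕ) (p : ℝ) (g : (Fin n → ℝ) → ℂ) : ℝ :=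
  (∫ x, ‖g x‖ ^ p ∂(μT n)) ^ (1 / p)

/-- `∂_x^β Δ_ξ^α σ(x,ξ)` for a symbol `σ` on `𝕋ⁿ × ℤⁿ` (difference operator applied first,
then the derivatives in `x`). -/
def symbDxD {n : ℕ} (β α : Fin n → ℕ) (σ : (Fin n → ℝ) → (Fin n → ℤ) → ℂ)
    (x : Fin n → ℝ) (ξ : Fin n → ℤ) : ℂ :=
  pdM β (fun x' => ddM α (σ x') ξ) x

/-- `Δ_ξ^α ∂_x^β σ(x,ξ)` for a symbol `σ` on `𝕋ⁿ × ℤⁿ` (derivatives in `x` applied first,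
then the difference operator in `ξ`). -/
def symbDDx {n : ℕ} (α β : Fin n → ℕ) (σ : (Fin n → ℝ) → (Fin n → ℤ) → ℂ)
    (x : Fin n → ℝ) (ξ : Fin n → ℤ) : ℂ :=
  ddM α (fun ξ' => pdM β (fun x' => σ x' ξ') x) ξ

/-- `∂_ξ^α ∂_x^β σ(x,ξ)` for a symbol `σ` on `𝕋ⁿ × ℝⁿ` (derivatives in `x` applied first,
then the derivatives in `ξ`). -/
def symbDξDx {n : ℕ} (α β : Fin n → ℕ) (σ : (Fin n → ℝ) → (Fin n → ℝ) → ℂ)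
    (x ξ : Fin n → ℝ) : ℂ :=
  pdM α (fun ξ' => pdM β (fun x' => σ x' ξ') x) ξ

/-- `∂_x^β ∂_ξ^α σ(x,ξ)` for a symbol `σ` on `𝕋ⁿ × ℝⁿ` (derivatives in `ξ` applied first,
then the derivatives in `x`). -/
def symbDxDξ {n : ℕ} (β α : Fin n → ℕ) (σ : (Fin n → ℝ) → (Fin n → ℝ) → ℂ)
    (x ξ : Fin n → ℝ) : ℂ :=
  pdM β (fun x' => pdM α (σ x') ξ) x

/-- The Euclidean Fourier transform `û(ξ) = ∫_{ℝⁿ} e^{-2πi⟨x,ξ⟩} u(x) dx`. -/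
def FT {n : ℕ} (u : (Fin n → ℝ) → ℂ) (ξ : Fin n → ℝ) : ℂ :=
  ∫ x, Complex.exp (-(2 * (π : ℂ) * Complex.I) * ∑ j, (x j : ℂ) * (ξ j : ℂ)) * u x

/-- Pseudo-differential operator on `ℝⁿ`:
`T_σ u(x) = ∫_{ℝⁿ} e^{2πi⟨x,ξ⟩} σ(x,ξ) û(ξ) dξ`. -/
def OpR {n : ℕ} (σ : (Fin n → ℝ) → (Fin n → ℝ) → ℂ) (u : (Fin n → ℝ) → ℂ) :
    (Fin n → ℝ) → ℂ :=
  fun x => ∫ ξ, Complex.exp (2 * (π : ℂ) * Complex.I * ∑ j, (x j : ℂ) * (ξ j : ℂ)) * σ x ξ * FT u ξ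

/-- Periodic amplitude operator
`a(x,y,D)u(x) = ∫_{𝕋ⁿ} ∫_{ℝⁿ} e^{2πi⟨x-y,ξ⟩} a(x,y,ξ) u(y) dξ dy`. -/
def OpAmp {n : ℕ} (a : (Fin n → ℝ) → (Fin n → ℝ) → (Fin n → ℝ) → ℂ)
    (u : (Fin n → ℝ) → ℂ) : (Fin n → ℝ) → ℂ :=
  fun x => ∫ y,
    (∫ ξ, Complex.exp (2 * (π : ℂ) * Complex.I * ∑ j, ((x j : ℂ) - (y j : ℂ)) * (ξ j : ℂ)) *
        a x y ξ) * u y ∂(μT n)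

/-- The `L^p(ℝⁿ)` norm, for a real exponent `p`. -/
def lpR (n : ℕ) (p : ℝ) (g : (Fin n → ℝ) → ℂ) : ℝ :=
  (∫ x, ‖g x‖ ^ p) ^ (1 / p)

/-- Bounded measurable functions. -/
def BddMeas {X : Type*} [MeasurableSpace X] (f : X → ℂ) : Prop :=
  Measurable f ∧ ∃ M : ℝ, ∀ x, ‖f x‖ ≤ M

theorem lintegral_Ioi_indicator_rpow {q : ℝ} (hq : 0 < q) {a : ℝ} (ha : 0 ≤ a) :
    ∫⁻ t in Set.Ioi (0:ℝ), (Set.Iio a).indicator (fun t => ENNReal.ofReal (t ^ (q - 1))) t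
      = ENNReal.ofReal (a ^ q / q) := by
  rw [lintegral_indicator measurableSet_Iio, Measure.restrict_restrict measurableSet_Iio,
    Set.inter_comm, Set.Ioi_inter_Iio]
  have h1 : (∫ t in (0:ℝ)..a, t ^ (q - 1)) = a ^ q / q := by
    rw [integral_rpow (Or.inl (by linarith))]
    simp [Real.zero_rpow hq.ne']
  rw [← h1, intervalIntegral.integral_of_le ha, integral_Ioc_eq_integral_Ioo,
    ofReal_integral_eq_lintegral_ofReal]
  · have := (intervalIntegral.intervalIntegrable_rpow' (a := 0) (b := a)
      (r := q - 1) (by linarith)).1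
    exact this.mono_set Set.Ioo_subset_Ioc_self
  · filter_upwards [self_mem_ae_restrict measurableSet_Ioo] with t ht
    exact Real.rpow_nonneg ht.1.le _

/-- Marcinkiewicz interpolation between a weak type `(2,2)` bound and an `L^∞` bound, for a
weighted finite family of sublinear operators. -/
theorem marcinkiewicz_two_top {X ι : Type*} [MeasurableSpace X] (μ : Measure X) [SFinite μ]
    {p : ℝ} (hp : 2 < p) {A : ℝ} (hA : 0 < A) (B : ℝ≥0∞) (s : Finset ι) (w : ι → ℝ≥0∞)
    (G : ι → (X → ℂ) → X → ℝ≥0∞)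
    (hm : ∀ j ∈ s, ∀ f, BddMeas f → Measurable (G j f))
    (hadd : ∀ j ∈ s, ∀ f g, BddMeas f → BddMeas g → ∀ x, G j (f + g) x ≤ G j f x + G j g x)
    (htop : ∀ j ∈ s, ∀ f, Measurable f → ∀ M : ℝ, 0 ≤ M → (∀ x, ‖f x‖ ≤ M) →
      ∀ x, G j f x ≤ ENNReal.ofReal (A * M))
    (hweak : ∀ f, BddMeas f → ∀ t : ℝ, 0 < t →
      ∑ j ∈ s, w j * μ {x | ENNReal.ofReal t < G j f x} ≤
        B * ENNReal.ofReal (t ^ (-2 : ℝ)) * ∫⁻ x, ‖f x‖ₑ ^ (2:ℝ) ∂μ)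
    (f : X → ℂ) (hf : BddMeas f) :
    ∑ j ∈ s, w j * ∫⁻ x, G j f x ^ p ∂μ ≤
      ENNReal.ofReal (4 * p * (2 * A) ^ (p - 2) / (p - 2)) * B * ∫⁻ x, ‖f x‖ₑ ^ p ∂μ := by
  obtain ⟨hfm, M, hM⟩ := id hf
  have hM0 : 0 ≤ |M| := abs_nonneg M
  have hfin : ∀ j ∈ s, ∀ x, G j f x ≠ ∞ := fun j hj x =>
    ((htop j hj f hfm |M| hM0 (fun x => (hM x).trans (le_abs_self M)) x).trans_lt
      ENNReal.ofReal_lt_top).ne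
  have hlc : ∀ j ∈ s, ∫⁻ x, G j f x ^ p ∂μ = ENNReal.ofReal p *
      ∫⁻ t in Set.Ioi (0:ℝ), μ {x | ENNReal.ofReal t < G j f x} * ENNReal.ofReal (t ^ (p - 1)) := by
    intro j hj
    have h := lintegral_rpow_eq_lintegral_meas_lt_mul μ (f := fun x => (G j f x).toReal)
      (Filter.Eventually.of_forall fun x => ENNReal.toReal_nonneg)
      ((hm j hj f hf).ennreal_toReal.aemeasurable) (show 0 < p by linarith)
    have e1 : ∀ x, ENNReal.ofReal ((G j f x).toReal ^ p) = G j f x ^ p := by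
      intro x
      rw [← ENNReal.ofReal_rpow_of_nonneg ENNReal.toReal_nonneg (by linarith),
        ENNReal.ofReal_toReal (hfin j hj x)]
    simp only [e1] at h
    rw [h]
    congr 1
    refine setLIntegral_congr_fun measurableSet_Ioi fun t ht => ?_
    congr 2
    ext x
    simp only [Set.mem_ofPred_eq]
    rw [ENNReal.ofReal_lt_iff_lt_toReal (le_of_lt ht) (hfin j hj x)]
  have hcut : ∀ t : ℝ, 0 < t → ∑ j ∈ s, w j * μ {x | ENNReal.ofReal t < G j f x} ≤
      B * ENNReal.ofReal ((t / 2) ^ (-2 : ℝ)) *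
        ∫⁻ x, {x | t < 2 * A * ‖f x‖}.indicator (fun x => ‖f x‖ₑ ^ (2:ℝ)) x ∂μ := by
    intro t ht
    set S : Set X := {x | t < 2 * A * ‖f x‖}
    have hS : MeasurableSet S := measurableSet_lt measurable_const (by fun_prop)
    have hb2 : BddMeas (S.indicator f) := ⟨hfm.indicator hS, |M|, fun x =>
      (norm_indicator_le_norm_self f x).trans ((hM x).trans (le_abs_self M))⟩
    have hb1 : BddMeas (Sᶜ.indicator f) := ⟨hfm.indicator hS.compl, |M|, fun x =>
      (norm_indicator_le_norm_self f x).trans ((hM x).trans (le_abs_self M))⟩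
    have hsum : Sᶜ.indicator f + S.indicator f = f := by
      rw [add_comm]; exact Set.indicator_self_add_compl S f
    have h1 : ∀ x, ‖Sᶜ.indicator f x‖ ≤ t / (2 * A) := by
      intro x
      by_cases hx : x ∈ S
      · simp [hx]; positivity
      · rw [Set.indicator_of_mem (by simpa using hx)]
        have : ¬ (t < 2 * A * ‖f x‖) := hx
        rw [le_div_iff₀ (by positivity)]; linarith
    refine le_trans (Finset.sum_le_sum fun j hj => ?_)
      ((hweak _ hb2 (t / 2) (by positivity)).trans (le_of_eq ?_))
    · refine mul_le_mul_right (measure_mono fun x hx => ?_) _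
      simp only [Set.mem_ofPred_eq] at hx ⊢
      by_contra hcon
      push Not at hcon
      have h3 := hadd j hj _ _ hb1 hb2 x
      rw [hsum] at h3
      have h4 := htop j hj _ hb1.1 _ (by positivity) h1 x
      have h5 : A * (t / (2 * A)) = t / 2 := by field_simp
      rw [h5] at h4
      have h6 := h3.trans (add_le_add h4 hcon)
      rw [← ENNReal.ofReal_add (by positivity) (by positivity), add_halves] at h6
      exact absurd hx (not_lt.2 h6)
    · congr 1
      refine lintegral_congr fun x => ?_
      by_cases hx : x ∈ S <;> simp [hx]
  calc ∑ j ∈ s, w j * ∫⁻ x, G j f x ^ p ∂μ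
      = ENNReal.ofReal p * ∫⁻ t in Set.Ioi (0:ℝ),
          (∑ j ∈ s, w j * μ {x | ENNReal.ofReal t < G j f x}) * ENNReal.ofReal (t ^ (p - 1)) := by
        simp_rw [Finset.sum_mul]
        rw [lintegral_finsetSum' , Finset.mul_sum]
        · refine Finset.sum_congr rfl fun j hj => ?_
          rw [hlc j hj]
          simp_rw [mul_assoc (w j)]
          rw [lintegral_const_mul'']
          · ring
          · refine (Measurable.mul ?_ (by fun_prop)).aemeasurable
            refine Antitone.measurable fun a b hab => measure_mono fun x hx => ?_
            exact (ENNReal.ofReal_le_ofReal hab).trans_lt hx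
        · intro j hj
          refine (Measurable.mul (Measurable.const_mul ?_ _) (by fun_prop)).aemeasurable
          refine Antitone.measurable fun a b hab => measure_mono fun x hx => ?_
          exact (ENNReal.ofReal_le_ofReal hab).trans_lt hx
    _ ≤ ENNReal.ofReal p * ∫⁻ t in Set.Ioi (0:ℝ),
          4 * B * ∫⁻ x, (‖f x‖ₑ ^ (2:ℝ)) *
            (Set.Iio (2 * A * ‖f x‖)).indicator (fun t => ENNReal.ofReal (t ^ (p - 2 - 1))) t ∂μ := by
        refine mul_le_mul_right (setLIntegral_mono' measurableSet_Ioi fun t ht => ?_) _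
        have ht' : 0 < t := ht
        refine (mul_le_mul_left (hcut t ht) _).trans (le_of_eq ?_)
        have e2 : ENNReal.ofReal ((t / 2) ^ (-2:ℝ)) * ENNReal.ofReal (t ^ (p - 1)) =
            4 * ENNReal.ofReal (t ^ (p - 2 - 1)) := by
          rw [← ENNReal.ofReal_mul (by positivity),
            show (4:ℝ≥0∞) = ENNReal.ofReal 4 by simp, ← ENNReal.ofReal_mul (by norm_num)]
          congr 1
          rw [Real.div_rpow ht'.le (by norm_num), show p - 2 - 1 = -2 + (p - 1) by ring,
            Real.rpow_add ht']
          have : (2:ℝ) ^ (-2:ℝ) = 1 / 4 := by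
            rw [Real.rpow_neg (by norm_num)]; norm_num
          rw [this]; ring
        calc B * ENNReal.ofReal ((t / 2) ^ (-2:ℝ)) * (∫⁻ x, _ ∂μ) * ENNReal.ofReal (t ^ (p - 1))
            = B * (∫⁻ x, {x | t < 2 * A * ‖f x‖}.indicator (fun x => ‖f x‖ₑ ^ (2:ℝ)) x ∂μ) *
              (ENNReal.ofReal ((t / 2) ^ (-2:ℝ)) * ENNReal.ofReal (t ^ (p - 1))) := by ring
          _ = 4 * B * ((∫⁻ x, {x | t < 2 * A * ‖f x‖}.indicator (fun x => ‖f x‖ₑ ^ (2:ℝ)) x ∂μ) *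
              ENNReal.ofReal (t ^ (p - 2 - 1))) := by rw [e2]; ring
          _ = _ := by
            congr 1
            rw [← lintegral_mul_const'' _ (Measurable.aemeasurable ?_)]
            · refine lintegral_congr fun x => ?_
              by_cases hx : t < 2 * A * ‖f x‖ <;> simp [Set.indicator, hx]
            · exact (by fun_prop : Measurable fun x => ‖f x‖ₑ ^ (2:ℝ)).indicator
                (measurableSet_lt measurable_const (by fun_prop))
    _ = ENNReal.ofReal p * (4 * B * ∫⁻ x, (‖f x‖ₑ ^ (2:ℝ)) *
          ENNReal.ofReal ((2 * A * ‖f x‖) ^ (p - 2) / (p - 2)) ∂μ) := by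
        have hmeas : Measurable (fun z : ℝ × X => (‖f z.2‖ₑ ^ (2:ℝ)) *
            (Set.Iio (2 * A * ‖f z.2‖)).indicator
              (fun t => ENNReal.ofReal (t ^ (p - 2 - 1))) z.1) := by
          refine Measurable.mul (by fun_prop) ?_
          have : (fun z : ℝ × X => (Set.Iio (2 * A * ‖f z.2‖)).indicator
              (fun t => ENNReal.ofReal (t ^ (p - 2 - 1))) z.1) =
              {z : ℝ × X | z.1 < 2 * A * ‖f z.2‖}.indicator
                (fun z => ENNReal.ofReal (z.1 ^ (p - 2 - 1))) := by
            ext z; simp [Set.indicator]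
          rw [this]
          exact Measurable.indicator (by fun_prop) (measurableSet_lt (by fun_prop) (by fun_prop))
        congr 1
        rw [lintegral_const_mul'' _ (Measurable.aemeasurable hmeas.lintegral_prod_right')]
        congr 1
        rw [lintegral_lintegral_swap hmeas.aemeasurable]
        refine lintegral_congr fun x => ?_
        change ∫⁻ t in Set.Ioi 0, (‖f x‖ₑ ^ (2:ℝ)) *
          (Set.Iio (2 * A * ‖f x‖)).indicator (fun t => ENNReal.ofReal (t ^ (p - 2 - 1))) t = _
        rw [lintegral_const_mul'' , lintegral_Ioi_indicator_rpow (by linarith) (by positivity)]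
        exact (Measurable.indicator (by fun_prop) measurableSet_Iio).aemeasurable
    _ = _ := by
        have : ∀ x, (‖f x‖ₑ ^ (2:ℝ)) * ENNReal.ofReal ((2 * A * ‖f x‖) ^ (p - 2) / (p - 2)) =
            ENNReal.ofReal ((2 * A) ^ (p - 2) / (p - 2)) * ‖f x‖ₑ ^ p := by
          intro x
          rw [← ofReal_norm, ENNReal.ofReal_rpow_of_nonneg (norm_nonneg _) (by norm_num),
            ENNReal.ofReal_rpow_of_nonneg (norm_nonneg _) (by linarith),
            ← ENNReal.ofReal_mul (by positivity), ← ENNReal.ofReal_mul (by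
              have : 0 < p - 2 := by linarith
              positivity)]
          congr 1
          rw [Real.mul_rpow (by positivity) (norm_nonneg _)]
          rcases (norm_nonneg (f x)).eq_or_lt with h0 | h0
          · simp [← h0, Real.zero_rpow (show p ≠ 0 by linarith)]
          · rw [show ‖f x‖ ^ p = ‖f x‖ ^ (2:ℝ) * ‖f x‖ ^ (p - 2) by
              rw [← Real.rpow_add h0]; congr 1; ring]
            ring
        simp_rw [this]
        rw [lintegral_const_mul _ (by fun_prop)]
        have h2 : ENNReal.ofReal (4 * p * (2 * A) ^ (p - 2) / (p - 2)) =
            ENNReal.ofReal p * 4 * ENNReal.ofReal ((2 * A) ^ (p - 2) / (p - 2)) := by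
          rw [show (4:ℝ≥0∞) = ENNReal.ofReal 4 by simp, ← ENNReal.ofReal_mul (by linarith),
            ← ENNReal.ofReal_mul (by linarith)]
          congr 1; ring
        rw [h2]; ring

/-- A distributional inequality of good-`λ` type between `X` and `Y` controls the `L^p` norm of
`X` by that of `Y`. -/
theorem lintegral_rpow_le_of_dist_le {Ω : Type*} [MeasurableSpace Ω] (μ : Measure Ω)
    [IsFiniteMeasure μ] {p : ℝ} (hp : 1 < p) (K : ℝ≥0∞) (X Y : Ω → ℝ≥0∞) (hX : Measurable X)
    (hY : Measurable Y) (M : ℝ) (hM : ∀ x, X x ≤ ENNReal.ofReal M)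
    (h : ∀ t : ℝ, 0 < t → ENNReal.ofReal t * μ {x | ENNReal.ofReal (2 * t) < X x} ≤
      K * ∫⁻ x in {x | ENNReal.ofReal t < X x}, Y x ∂μ) :
    ∫⁻ x, X x ^ p ∂μ ≤ (ENNReal.ofReal (2 ^ p * p / (p - 1)) * K) ^ p * ∫⁻ x, Y x ^ p ∂μ := by
  have hp1 : 0 < p - 1 := by linarith
  have hfin : ∀ x, X x ≠ ∞ := fun x => ((hM x).trans_lt ENNReal.ofReal_lt_top).ne
  have hIfin : ∫⁻ x, X x ^ p ∂μ ≠ ∞ := by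
    refine ne_of_lt (lt_of_le_of_lt (lintegral_mono fun x =>
      ENNReal.rpow_le_rpow (hM x) (by linarith)) ?_)
    rw [lintegral_const]
    exact ENNReal.mul_lt_top (ENNReal.rpow_lt_top_of_nonneg (by linarith) ENNReal.ofReal_ne_top)
      (measure_lt_top _ _)
  have key : ∫⁻ x, X x ^ p ∂μ ≤ ENNReal.ofReal (2 ^ p * p / (p - 1)) * K *
      ∫⁻ x, Y x * X x ^ (p - 1) ∂μ := by
    have h0 := lintegral_rpow_eq_lintegral_meas_lt_mul μ (f := fun x => (X x).toReal / 2)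
      (Filter.Eventually.of_forall fun x => by positivity)
      (hX.ennreal_toReal.div_const 2).aemeasurable (show 0 < p by linarith)
    have e1 : ∀ x, ENNReal.ofReal (((X x).toReal / 2) ^ p) =
        ENNReal.ofReal ((2:ℝ) ^ (-p)) * X x ^ p := by
      intro x
      rw [Real.div_rpow ENNReal.toReal_nonneg (by norm_num), div_eq_inv_mul,
        ENNReal.ofReal_mul (by positivity), ← Real.rpow_neg (by norm_num),
        ← ENNReal.ofReal_rpow_of_nonneg ENNReal.toReal_nonneg (by linarith),
        ENNReal.ofReal_toReal (hfin x)]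
    simp only [e1] at h0
    rw [lintegral_const_mul _ (hX.pow_const _)] at h0
    have h1 : ∫⁻ t in Set.Ioi (0:ℝ), μ {x | t < (X x).toReal / 2} * ENNReal.ofReal (t ^ (p - 1)) ≤
        ∫⁻ t in Set.Ioi (0:ℝ), K * ∫⁻ x, Y x *
          (Set.Iio ((X x).toReal)).indicator (fun t => ENNReal.ofReal (t ^ (p - 1 - 1))) t ∂μ := by
      refine setLIntegral_mono' measurableSet_Ioi fun t ht => ?_
      have ht' : 0 < t := ht
      have e2 : {x | t < (X x).toReal / 2} = {x | ENNReal.ofReal (2 * t) < X x} := by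
        ext x
        simp only [Set.mem_ofPred_eq]
        rw [ENNReal.ofReal_lt_iff_lt_toReal (by positivity) (hfin x), lt_div_iff₀ (by norm_num),
          mul_comm]
      rw [e2, show p - 1 = 1 + (p - 1 - 1) by ring, Real.rpow_add ht', Real.rpow_one,
        ENNReal.ofReal_mul ht'.le, ← mul_assoc, mul_comm (μ _)]
      refine (mul_le_mul_left (h t ht') _).trans (le_of_eq ?_)
      rw [mul_assoc, ← lintegral_mul_const _ hY,
        ← lintegral_indicator (measurableSet_lt measurable_const hX)]
      congr 1
      refine lintegral_congr fun x => ?_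
      have : ENNReal.ofReal t < X x ↔ t < (X x).toReal :=
        ENNReal.ofReal_lt_iff_lt_toReal ht'.le (hfin x)
      by_cases hx : t < (X x).toReal
      · simp [Set.indicator, this.2 hx, hx]
      · simp [Set.indicator, this, hx]
    have h2 : ∫⁻ t in Set.Ioi (0:ℝ), K * ∫⁻ x, Y x *
          (Set.Iio ((X x).toReal)).indicator (fun t => ENNReal.ofReal (t ^ (p - 1 - 1))) t ∂μ =
        K * ∫⁻ x, Y x * (ENNReal.ofReal (1 / (p - 1)) * X x ^ (p - 1)) ∂μ := by
      have hmeas : Measurable (fun z : ℝ × Ω => Y z.2 *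
          (Set.Iio ((X z.2).toReal)).indicator
            (fun t => ENNReal.ofReal (t ^ (p - 1 - 1))) z.1) := by
        refine Measurable.mul (by fun_prop) ?_
        have : (fun z : ℝ × Ω => (Set.Iio ((X z.2).toReal)).indicator
            (fun t => ENNReal.ofReal (t ^ (p - 1 - 1))) z.1) =
            {z : ℝ × Ω | z.1 < (X z.2).toReal}.indicator
              (fun z => ENNReal.ofReal (z.1 ^ (p - 1 - 1))) := by
          ext z; simp [Set.indicator]
        rw [this]
        exact Measurable.indicator (by fun_prop) (measurableSet_lt (by fun_prop) (by fun_prop))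
      rw [lintegral_const_mul'' _ (Measurable.aemeasurable hmeas.lintegral_prod_right'),
        lintegral_lintegral_swap hmeas.aemeasurable]
      congr 1
      refine lintegral_congr fun x => ?_
      change ∫⁻ t in Set.Ioi 0, Y x *
          (Set.Iio ((X x).toReal)).indicator (fun t => ENNReal.ofReal (t ^ (p - 1 - 1))) t = _
      rw [lintegral_const_mul'' , lintegral_Ioi_indicator_rpow hp1 ENNReal.toReal_nonneg]
      · rw [div_eq_inv_mul, ENNReal.ofReal_mul (by positivity), one_div,
          ← ENNReal.ofReal_rpow_of_nonneg ENNReal.toReal_nonneg hp1.le,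
          ENNReal.ofReal_toReal (hfin x)]
      · exact (Measurable.indicator (by fun_prop) measurableSet_Iio).aemeasurable
    have h3 : ENNReal.ofReal ((2:ℝ) ^ (-p)) * ∫⁻ x, X x ^ p ∂μ ≤ ENNReal.ofReal p *
        (K * ∫⁻ x, Y x * (ENNReal.ofReal (1 / (p - 1)) * X x ^ (p - 1)) ∂μ) := by
      rw [h0, ← h2]
      exact mul_le_mul_right h1 _
    have h4 : ∫⁻ x, X x ^ p ∂μ = ENNReal.ofReal ((2:ℝ) ^ p) *
        (ENNReal.ofReal ((2:ℝ) ^ (-p)) * ∫⁻ x, X x ^ p ∂μ) := by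
      rw [← mul_assoc, ← ENNReal.ofReal_mul (by positivity), ← Real.rpow_add (by norm_num)]
      simp
    rw [h4]
    refine (mul_le_mul_right h3 _).trans (le_of_eq ?_)
    have : ∀ x, Y x * (ENNReal.ofReal (1 / (p - 1)) * X x ^ (p - 1)) =
        ENNReal.ofReal (1 / (p - 1)) * (Y x * X x ^ (p - 1)) := fun x => by ring
    simp_rw [this]
    rw [lintegral_const_mul _ (by fun_prop)]
    rw [show (2:ℝ) ^ p * p / (p - 1) = 2 ^ p * (p * (1 / (p - 1))) by ring,
      ENNReal.ofReal_mul (by positivity), ENNReal.ofReal_mul (by positivity)]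
    ring
  have hq : p.HolderConjugate (p / (p - 1)) := Real.HolderConjugate.conjExponent hp
  have hold := ENNReal.lintegral_mul_le_Lp_mul_Lq μ hq (f := Y) (g := fun x => X x ^ (p - 1))
    hY.aemeasurable (hX.pow_const _).aemeasurable
  have e3 : ∀ x, (X x ^ (p - 1)) ^ (p / (p - 1)) = X x ^ p := fun x => by
    rw [← ENNReal.rpow_mul]; congr 1; field_simp
  simp only [e3, Pi.mul_apply] at hold
  set I := ∫⁻ x, X x ^ p ∂μ
  set Jy := ∫⁻ x, Y x ^ p ∂μ
  set C := ENNReal.ofReal (2 ^ p * p / (p - 1)) * K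
  rcases eq_or_ne I 0 with h0 | h0
  · rw [h0]; exact zero_le
  have h5 : I ≤ C * Jy ^ (1 / p) * I ^ (1 / (p / (p - 1))) := by
    rw [mul_assoc]; exact key.trans (mul_le_mul_right hold _)
  have h6 : I ^ (1 / p) ≤ C * Jy ^ (1 / p) := by
    have e4 : I = I ^ (1 / p) * I ^ (1 / (p / (p - 1))) := by
      rw [← ENNReal.rpow_add _ _ h0 hIfin]
      have : 1 / p + 1 / (p / (p - 1)) = 1 := by field_simp; ring
      rw [this, ENNReal.rpow_one]
    have hne : I ^ (1 / (p / (p - 1))) ≠ 0 := by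
      simp [h0, hIfin]
    have hnt : I ^ (1 / (p / (p - 1))) ≠ ∞ :=
      ENNReal.rpow_ne_top_of_nonneg (by positivity) hIfin
    rw [e4] at h5
    nth_rewrite 2 [← e4] at h5
    exact (ENNReal.mul_le_mul_iff_left hne hnt).1 h5
  have h7 := ENNReal.rpow_le_rpow h6 (show 0 ≤ p by linarith)
  rwa [ENNReal.mul_rpow_of_nonneg _ _ (by linarith), ← ENNReal.rpow_mul, ← ENNReal.rpow_mul,
    one_div_mul_cancel (by linarith), ENNReal.rpow_one, ENNReal.rpow_one] at h7

section

/-- Index of the dyadic cube of generation `i` containing `x`. -/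
def dyIdx {n : ℕ} (i : ℕ) (x : Fin n → ℝ) : Fin n → ℤ := fun k => ⌊(2:ℝ) ^ i * x k⌋

/-- The dyadic cube of generation `i` containing `x`. -/
def dyCell {n : ℕ} (i : ℕ) (x : Fin n → ℝ) : Set (Fin n → ℝ) := {y | dyIdx i y = dyIdx i x}

/-- Dyadic average of a nonnegative function. -/
def dyAvg {n : ℕ} (i : ℕ) (φ : (Fin n → ℝ) → ℝ≥0∞) (x : Fin n → ℝ) : ℝ≥0∞ :=
  2 ^ (i * n) * ∫⁻ y in dyCell i x, φ y ∂μT n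

/-- Dyadic average of a complex function. -/
def dyAvgC {n : ℕ} (i : ℕ) (g : (Fin n → ℝ) → ℂ) (x : Fin n → ℝ) : ℂ :=
  2 ^ (i * n) * ∫ y in dyCell i x, g y ∂μT n

/-- Mean oscillation over the dyadic cube of generation `i`. -/
def dyOsc {n : ℕ} (i : ℕ) (g : (Fin n → ℝ) → ℂ) (x : Fin n → ℝ) : ℝ≥0∞ :=
  dyAvg i (fun y => ‖g y - dyAvgC i g x‖ₑ) x

/-- A set that is a union of dyadic cubes of generation `i`. -/
def DySat {n : ℕ} (i : ℕ) (A : Set (Fin n → ℝ)) : Prop :=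
  ∀ x y, dyIdx i x = dyIdx i y → (x ∈ A ↔ y ∈ A)

variable {n : ℕ}

theorem volume_cube : volume (cube n) = 1 := by
  rw [cube, Real.volume_pi_Ico]; simp

instance : IsProbabilityMeasure (μT n) := ⟨by
  rw [μT, Measure.restrict_apply_univ, volume_cube]⟩

theorem measurableSet_cube : MeasurableSet (cube n) :=
  MeasurableSet.univ_pi fun _ => measurableSet_Ico

theorem ae_mem_cube : ∀ᵐ x ∂μT n, x ∈ cube n := ae_restrict_mem measurableSet_cube

theorem measurable_dyIdx (i : ℕ) : Measurable (dyIdx (n := n) i) :=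
  measurable_pi_lambda _ fun k => ((measurable_pi_apply k).const_mul _).floor

theorem measurableSet_dyCell (i : ℕ) (x : Fin n → ℝ) : MeasurableSet (dyCell i x) :=
  measurable_dyIdx i (measurableSet_singleton (dyIdx i x))

theorem DySat.measurableSet {i : ℕ} {A : Set (Fin n → ℝ)} (h : DySat i A) : MeasurableSet A := by
  have : A = Set.preimage (dyIdx i) (Set.image (dyIdx i) A) := by
    ext x
    refine ⟨fun hx => ⟨x, hx, rfl⟩, ?_⟩
    rintro ⟨y, hy, e⟩
    exact (h _ _ e).1 hy
  rw [this]
  exact measurable_dyIdx i (Set.to_countable _).measurableSet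

theorem dyIdx_eq_of_le {i k : ℕ} (h : i ≤ k) {x y : Fin n → ℝ} (e : dyIdx k x = dyIdx k y) :
    dyIdx i x = dyIdx i y := by
  have key : ∀ z : Fin n → ℝ, ∀ a, dyIdx i z a = dyIdx k z a / ((2 ^ (k - i) : ℕ) : ℤ) := by
    intro z a
    rw [dyIdx, dyIdx, ← Int.floor_div_natCast]
    congr 1
    obtain ⟨l, rfl⟩ := Nat.exists_eq_add_of_le h
    rw [pow_add]; simp; field_simp
  funext a
  rw [key x, key y, e]

theorem dyCell_congr {i : ℕ} {x y : Fin n → ℝ} (e : dyIdx i x = dyIdx i y) :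
    dyCell i x = dyCell i y := by simp [dyCell, e]

theorem DySat.mono {i k : ℕ} (hik : i ≤ k) {A : Set (Fin n → ℝ)} (h : DySat i A) : DySat k A :=
  fun x y e => h x y (dyIdx_eq_of_le hik e)

theorem dyCell_subset {i k : ℕ} (h : i ≤ k) (x : Fin n → ℝ) : dyCell k x ⊆ dyCell i x :=
  fun _ hy => dyIdx_eq_of_le h hy

theorem dyCell_eq_pi (i : ℕ) (x : Fin n → ℝ) : dyCell i x = Set.univ.pi fun k =>
    Set.Ico ((⌊(2:ℝ) ^ i * x k⌋ : ℝ) / 2 ^ i) (((⌊(2:ℝ) ^ i * x k⌋ : ℝ) + 1) / 2 ^ i) := by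
  ext y
  simp only [dyCell, dyIdx, Set.mem_ofPred_eq, Set.mem_univ_pi, Set.mem_Ico, funext_iff]
  refine forall_congr' fun k => ?_
  rw [Int.floor_eq_iff, div_le_iff₀ (by positivity), lt_div_iff₀ (by positivity),
    mul_comm (y k)]

theorem dyCell_subset_cube (i : ℕ) {x : Fin n → ℝ} (hx : x ∈ cube n) : dyCell i x ⊆ cube n := by
  have h0 : dyCell 0 x = cube n := by
    rw [dyCell_eq_pi, cube]
    congr 1; funext k
    have : ⌊(2:ℝ) ^ 0 * x k⌋ = 0 := by
      rw [Int.floor_eq_iff]; have := hx k trivial; simpa using this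
    rw [this]; simp
  rw [← h0]; exact dyCell_subset (Nat.zero_le i) x

theorem dyCell_zero {x : Fin n → ℝ} (hx : x ∈ cube n) : cube n ⊆ dyCell 0 x := by
  intro y hy
  funext k
  have h1 : ∀ z ∈ cube n, ⌊(2:ℝ) ^ 0 * z k⌋ = 0 := fun z hz => by
    rw [Int.floor_eq_iff]; have := hz k trivial; simpa using this
  simp only [dyIdx]
  rw [h1 y hy, h1 x hx]

theorem mul_measure_dyCell (i : ℕ) {x : Fin n → ℝ} (hx : x ∈ cube n) :
    2 ^ (i * n) * μT n (dyCell i x) = 1 := by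
  rw [μT, Measure.restrict_apply (measurableSet_dyCell i x),
    Set.inter_eq_left.2 (dyCell_subset_cube i hx), dyCell_eq_pi, Real.volume_pi_Ico]
  have : ∀ k : Fin n, ENNReal.ofReal (((⌊(2:ℝ) ^ i * x k⌋ : ℝ) + 1) / 2 ^ i -
      (⌊(2:ℝ) ^ i * x k⌋ : ℝ) / 2 ^ i) = ((2:ℝ≥0∞) ^ i)⁻¹ := by
    intro k
    rw [← sub_div, add_sub_cancel_left, one_div, ENNReal.ofReal_inv_of_pos (by positivity),
      ENNReal.ofReal_pow (by norm_num)]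
    simp
  simp_rw [this]
  rw [Finset.prod_const, Finset.card_univ, Fintype.card_fin, ENNReal.inv_pow.symm, ← pow_mul,
    ENNReal.mul_inv_cancel (by positivity) (by finiteness)]

theorem measurable_dyAvg (i : ℕ) (φ : (Fin n → ℝ) → ℝ≥0∞) : Measurable (dyAvg i φ) := by
  have : dyAvg i φ = (fun q : Fin n → ℤ => 2 ^ (i * n) * ∫⁻ y in {y | dyIdx i y = q}, φ y ∂μT n) ∘
      dyIdx i := rfl
  rw [this]
  exact (measurable_of_countable _).comp (measurable_dyIdx i)

theorem measurable_dyAvgC (i : ℕ) (g : (Fin n → ℝ) → ℂ) : Measurable (dyAvgC i g) := by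
  have : dyAvgC i g = (fun q : Fin n → ℤ => 2 ^ (i * n) * ∫ y in {y | dyIdx i y = q}, g y ∂μT n) ∘
      dyIdx i := rfl
  rw [this]
  exact (measurable_of_countable _).comp (measurable_dyIdx i)

theorem measurable_dyOsc (i : ℕ) (g : (Fin n → ℝ) → ℂ) : Measurable (dyOsc i g) := by
  have : dyOsc i g = (fun q : Fin n → ℤ => 2 ^ (i * n) * ∫⁻ y in {y | dyIdx i y = q},
      ‖g y - 2 ^ (i * n) * ∫ y in {y | dyIdx i y = q}, g y ∂μT n‖ₑ ∂μT n) ∘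
      dyIdx i := rfl
  rw [this]
  exact (measurable_of_countable _).comp (measurable_dyIdx i)

theorem setLIntegral_dyAvg (i : ℕ) {A : Set (Fin n → ℝ)} (hA : DySat i A)
    {φ : (Fin n → ℝ) → ℝ≥0∞} (hφ : Measurable φ) :
    ∫⁻ x in A, dyAvg i φ x ∂μT n = ∫⁻ x in A, φ x ∂μT n := by
  classical
  set D : Set ((Fin n → ℝ) × (Fin n → ℝ)) := {z | dyIdx i z.2 = dyIdx i z.1}
  have hD : MeasurableSet D := measurableSet_eq_fun ((measurable_dyIdx i).comp measurable_snd)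
    ((measurable_dyIdx i).comp measurable_fst)
  have hAm := hA.measurableSet
  have hm : Measurable (fun z : (Fin n → ℝ) × (Fin n → ℝ) =>
      (D ∩ Prod.fst ⁻¹' A).indicator (fun z => 2 ^ (i * n) * φ z.2) z) :=
    Measurable.indicator (by fun_prop) (hD.inter (measurable_fst hAm))
  calc ∫⁻ x in A, dyAvg i φ x ∂μT n
      = ∫⁻ x, ∫⁻ y, (D ∩ Prod.fst ⁻¹' A).indicator (fun z => 2 ^ (i * n) * φ z.2) (x, y)
          ∂μT n ∂μT n := by
        rw [← lintegral_indicator hAm]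
        refine lintegral_congr fun x => ?_
        by_cases hx : x ∈ A
        · rw [Set.indicator_of_mem hx, dyAvg, ← lintegral_const_mul _ hφ,
            ← lintegral_indicator (measurableSet_dyCell i x)]
          refine lintegral_congr fun y => ?_
          by_cases hy : dyIdx i y = dyIdx i x <;> simp [Set.indicator, D, dyCell, hx, hy]
        · simp [Set.indicator, hx]
    _ = ∫⁻ y, ∫⁻ x, (D ∩ Prod.fst ⁻¹' A).indicator (fun z => 2 ^ (i * n) * φ z.2) (x, y)
          ∂μT n ∂μT n := lintegral_lintegral_swap hm.aemeasurable
    _ = ∫⁻ y, A.indicator φ y ∂μT n := by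
        refine lintegral_congr_ae ?_
        filter_upwards [ae_mem_cube] with y hy
        by_cases hyA : y ∈ A
        · rw [Set.indicator_of_mem hyA]
          calc ∫⁻ x, (D ∩ Prod.fst ⁻¹' A).indicator (fun z => 2 ^ (i * n) * φ z.2) (x, y) ∂μT n
              = ∫⁻ x in dyCell i y, 2 ^ (i * n) * φ y ∂μT n := by
                rw [← lintegral_indicator (measurableSet_dyCell i y)]
                refine lintegral_congr fun x => ?_
                by_cases hx : dyIdx i x = dyIdx i y
                · have := (hA _ _ hx).2 hyA
                  simp [Set.indicator, D, dyCell, hx, this]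
                · simp [Set.indicator, D, dyCell, hx, Ne.symm hx]
            _ = φ y * (2 ^ (i * n) * μT n (dyCell i y)) := by
                rw [setLIntegral_const]; ring
            _ = φ y := by rw [mul_measure_dyCell i hy, mul_one]
        · rw [Set.indicator_of_notMem hyA]
          rw [← lintegral_zero (μ := μT n) (α := Fin n → ℝ)]
          refine lintegral_congr fun x => ?_
          simp only [Set.indicator]
          rw [if_neg]
          rintro ⟨h1, h2⟩
          exact hyA ((hA _ _ h1).2 h2)
    _ = _ := lintegral_indicator hAm _

theorem dyAvg_congr {i : ℕ} (φ : (Fin n → ℝ) → ℝ≥0∞) {x y : Fin n → ℝ}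
    (e : dyIdx i x = dyIdx i y) : dyAvg i φ x = dyAvg i φ y := by
  rw [dyAvg, dyAvg, dyCell_congr e]

theorem dyAvgC_congr {i : ℕ} (g : (Fin n → ℝ) → ℂ) {x y : Fin n → ℝ}
    (e : dyIdx i x = dyIdx i y) : dyAvgC i g x = dyAvgC i g y := by
  rw [dyAvgC, dyAvgC, dyCell_congr e]

theorem dyAvg_succ_le (i : ℕ) (φ : (Fin n → ℝ) → ℝ≥0∞) (x : Fin n → ℝ) :
    dyAvg (i + 1) φ x ≤ 2 ^ n * dyAvg i φ x := by
  rw [dyAvg, dyAvg, ← mul_assoc, ← pow_add]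
  rw [show (i + 1) * n = n + i * n by ring]
  exact mul_le_mul_right (lintegral_mono_set (dyCell_subset (Nat.le_succ i) x)) _

/-- The dyadic maximal theorem, localised to a union of dyadic cubes. -/
theorem dyadic_maximal_weak (i N : ℕ) {φ : (Fin n → ℝ) → ℝ≥0∞} (hφ : Measurable φ)
    {S : Set (Fin n → ℝ)} (hS : DySat i S) (t : ℝ≥0∞) :
    t * μT n {x | x ∈ S ∧ ∃ k, i ≤ k ∧ k ≤ N ∧ t < dyAvg k φ x} ≤ ∫⁻ x in S, φ x ∂μT n := by
  set A : ℕ → Set (Fin n → ℝ) := fun k =>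
    {x | x ∈ S ∧ t < dyAvg k φ x ∧ ∀ l, i ≤ l → l < k → dyAvg l φ x ≤ t}
  have hA : ∀ k, i ≤ k → DySat k (A k) := by
    intro k hk x y e
    have h2 : ∀ l, l < k → dyAvg l φ x = dyAvg l φ y := fun l hl =>
      dyAvg_congr φ (dyIdx_eq_of_le hl.le e)
    simp only [A, Set.mem_ofPred_eq]
    rw [hS.mono hk x y e, dyAvg_congr φ e]
    refine and_congr_right fun _ => and_congr_right fun _ => forall_congr' fun l =>
      imp_congr_right fun _ => ⟨fun h hl => ?_, fun h hl => ?_⟩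
    · rw [← h2 l hl]; exact h hl
    · rw [h2 l hl]; exact h hl
  have hdisj : Set.PairwiseDisjoint (↑(Finset.Icc i N)) A := by
    have key : ∀ k l, i ≤ k → k < l → Disjoint (A k) (A l) := by
      intro k l hk hkl
      rw [Set.disjoint_left]
      rintro x ⟨-, h1, -⟩ ⟨-, -, h2⟩
      exact absurd h1 (not_lt.2 (h2 k hk hkl))
    intro k hk l hl hne
    simp only [Finset.coe_Icc, Set.mem_Icc] at hk hl
    rcases lt_or_gt_of_ne hne with h | h
    · exact key k l hk.1 h
    · exact (key l k hl.1 h).symm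
  have hcov : {x | x ∈ S ∧ ∃ k, i ≤ k ∧ k ≤ N ∧ t < dyAvg k φ x} ⊆
      ⋃ k ∈ Finset.Icc i N, A k := by
    classical
    rintro x ⟨hx, h⟩
    have hsp := Nat.find_spec h
    simp only [Set.mem_iUnion, Finset.mem_Icc]
    refine ⟨Nat.find h, ⟨hsp.1, hsp.2.1⟩, hx, hsp.2.2, fun l hl hlt => ?_⟩
    have := Nat.find_min h hlt
    push Not at this
    exact this hl (hlt.le.trans hsp.2.1)
  calc t * μT n {x | x ∈ S ∧ ∃ k, i ≤ k ∧ k ≤ N ∧ t < dyAvg k φ x}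
      ≤ t * ∑ k ∈ Finset.Icc i N, μT n (A k) :=
        mul_le_mul_right ((measure_mono hcov).trans (measure_biUnion_finset_le _ _)) _
    _ = ∑ k ∈ Finset.Icc i N, ∫⁻ x in A k, t ∂μT n := by
        rw [Finset.mul_sum]; simp
    _ ≤ ∑ k ∈ Finset.Icc i N, ∫⁻ x in A k, dyAvg k φ x ∂μT n := by
        refine Finset.sum_le_sum fun k hk => ?_
        exact setLIntegral_mono' (hA k (Finset.mem_Icc.1 hk).1).measurableSet fun x hx => hx.2.1.le
    _ = ∑ k ∈ Finset.Icc i N, ∫⁻ x in A k, φ x ∂μT n :=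
        Finset.sum_congr rfl fun k hk => setLIntegral_dyAvg k (hA k (Finset.mem_Icc.1 hk).1) hφ
    _ = ∫⁻ x in ⋃ k ∈ Finset.Icc i N, A k, φ x ∂μT n :=
        (lintegral_biUnion_finset hdisj
          (fun k hk => (hA k (Finset.mem_Icc.1 hk).1).measurableSet) φ).symm
    _ ≤ ∫⁻ x in S, φ x ∂μT n := lintegral_mono_set (by
        intro x hx
        simp only [Set.mem_iUnion] at hx
        obtain ⟨k, _, h, _⟩ := hx
        exact h)

theorem BddMeas.integrable {X : Type*} [MeasurableSpace X] {μ : Measure X} [IsFiniteMeasure μ]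
    {f : X → ℂ} (h : BddMeas f) : Integrable f μ := by
  obtain ⟨hm, M, hM⟩ := h
  exact Integrable.of_bound hm.aestronglyMeasurable M (Filter.Eventually.of_forall hM)

theorem dyAvgC_sub_const (i : ℕ) {g : (Fin n → ℝ) → ℂ} (hg : BddMeas g) (c : ℂ)
    {x : Fin n → ℝ} (hx : x ∈ cube n) :
    dyAvgC i (fun y => g y - c) x = dyAvgC i g x - c := by
  rw [dyAvgC, dyAvgC, integral_sub hg.integrable (integrable_const c), mul_sub, setIntegral_const]
  congr 1
  have h := congrArg ENNReal.toReal (mul_measure_dyCell i hx)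
  rw [ENNReal.toReal_mul] at h
  simp only [ENNReal.toReal_pow, ENNReal.toReal_ofNat, ENNReal.toReal_one] at h
  rw [Measure.real, Complex.real_smul, ← mul_assoc]
  have h' := congrArg (fun r : ℝ => (r : ℂ)) h
  push_cast at h'
  rw [h', one_mul]

theorem enorm_dyAvgC_le (i : ℕ) (g : (Fin n → ℝ) → ℂ) (x : Fin n → ℝ) :
    ‖dyAvgC i g x‖ₑ ≤ dyAvg i (fun y => ‖g y‖ₑ) x := by
  rw [dyAvgC, dyAvg, enorm_mul]
  refine mul_le_mul' (le_of_eq ?_) (enorm_integral_le_lintegral_enorm _)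
  rw [enorm_pow]
  congr 1
  simp [enorm_eq_nnnorm]

/-- Truncated dyadic maximal function. -/
def dyMax (N : ℕ) (g : (Fin n → ℝ) → ℂ) (x : Fin n → ℝ) : ℝ≥0∞ :=
  (Finset.range (N + 1)).sup fun i => ‖dyAvgC i g x‖ₑ

/-- Truncated dyadic sharp maximal function. -/
def dySharp (N : ℕ) (g : (Fin n → ℝ) → ℂ) (x : Fin n → ℝ) : ℝ≥0∞ :=
  (Finset.range (N + 1)).sup fun i => dyOsc i g x

theorem measurable_finset_sup {α ι : Type*} [MeasurableSpace α] (s : Finset ι)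
    {f : ι → α → ℝ≥0∞} (hf : ∀ i, Measurable (f i)) : Measurable fun x => s.sup fun i => f i x := by
  simp_rw [Finset.sup_eq_iSup]
  exact Measurable.biSup _ s.countable_toSet fun i _ => hf i

theorem measurable_dyMax (N : ℕ) (g : (Fin n → ℝ) → ℂ) : Measurable (dyMax N g) :=
  measurable_finset_sup _ fun i => (measurable_dyAvgC i g).enorm

theorem measurable_dySharp (N : ℕ) (g : (Fin n → ℝ) → ℂ) : Measurable (dySharp N g) :=
  measurable_finset_sup _ fun i => measurable_dyOsc i g

theorem BddMeas.sub_dyAvgC {g : (Fin n → ℝ) → ℂ} (hg : BddMeas g) (c : ℂ) :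
    BddMeas (fun y => g y - c) := by
  obtain ⟨h, M, hM⟩ := hg
  exact ⟨h.sub_const c, M + ‖c‖, fun x => (norm_sub_le _ _).trans (by gcongr; exact hM x)⟩

theorem dyAvgC_zero (g : (Fin n → ℝ) → ℂ) {x : Fin n → ℝ} (hx : x ∈ cube n) :
    dyAvgC 0 g x = ∫ y, g y ∂μT n := by
  rw [dyAvgC]
  have : dyCell 0 x =ᵐ[μT n] Set.univ := by
    filter_upwards [ae_mem_cube] with y hy
    exact propext ⟨fun _ => trivial, fun _ => dyCell_zero hx hy⟩
  rw [setIntegral_congr_set this]; simp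

theorem dyMax_dist (N : ℕ) {g : (Fin n → ℝ) → ℂ} (hg : BddMeas g)
    (h0 : ∫ y, g y ∂μT n = 0) (t : ℝ) (ht : 0 < t) :
    ENNReal.ofReal t * μT n {x | ENNReal.ofReal (2 * t) < dyMax N g x} ≤
      2 ^ n * ∫⁻ x in {x | ENNReal.ofReal t < dyMax N g x}, dySharp N g x ∂μT n := by
  classical
  set s := ENNReal.ofReal t
  have hs2 : ENNReal.ofReal (2 * t) = s + s := by
    rw [two_mul, ENNReal.ofReal_add ht.le ht.le]
  set T : ℕ → Set (Fin n → ℝ) := fun i =>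
    {x | s < ‖dyAvgC i g x‖ₑ ∧ ∀ l, l < i → ‖dyAvgC l g x‖ₑ ≤ s}
  have hT : ∀ i, DySat i (T i) := by
    intro i x y e
    have h2 : ∀ l, l < i → dyAvgC l g x = dyAvgC l g y := fun l hl =>
      dyAvgC_congr g (dyIdx_eq_of_le hl.le e)
    simp only [T, Set.mem_ofPred_eq]
    rw [dyAvgC_congr g e]
    refine and_congr_right fun _ => forall_congr' fun l => ⟨fun h hl => ?_, fun h hl => ?_⟩
    · rw [← h2 l hl]; exact h hl
    · rw [h2 l hl]; exact h hl
  have hdisj : Set.PairwiseDisjoint (↑(Finset.Icc 1 N)) T := by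
    have key : ∀ k l, k < l → Disjoint (T k) (T l) := by
      intro k l hkl
      rw [Set.disjoint_left]
      rintro x ⟨h1, -⟩ ⟨-, h2⟩
      exact absurd h1 (not_lt.2 (h2 k hkl))
    intro k _ l _ hne
    rcases lt_or_gt_of_ne hne with h | h
    · exact key k l h
    · exact (key l k h).symm
  set φ : ℕ → (Fin n → ℝ) → ℝ≥0∞ := fun i y => ‖g y - dyAvgC (i - 1) g y‖ₑ
  have hφ : ∀ i, Measurable (φ i) := fun i => (hg.1.sub (measurable_dyAvgC _ _)).enorm
  have hφosc : ∀ i x, dyAvg (i - 1) (φ i) x = dyOsc (i - 1) g x := by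
    intro i x
    rw [dyOsc, dyAvg, dyAvg]
    congr 1
    refine setLIntegral_congr_fun (measurableSet_dyCell _ _) fun y hy => ?_
    simp only [φ]
    rw [dyAvgC_congr g (show dyIdx (i - 1) y = dyIdx (i - 1) x from hy)]
  have hcov : {x | ENNReal.ofReal (2 * t) < dyMax N g x} ∩ cube n ⊆ ⋃ i ∈ Finset.Icc 1 N,
      {x | x ∈ T i ∧ ∃ k, i ≤ k ∧ k ≤ N ∧ s < dyAvg k (φ i) x} := by
    rintro x ⟨hx, hxc⟩
    rw [Set.mem_ofPred_eq, dyMax, Finset.lt_sup_iff] at hx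
    obtain ⟨k, hk, hkx⟩ := hx
    have hk' : k ≤ N := Nat.lt_succ_iff.1 (Finset.mem_range.1 hk)
    have hsk : s < ‖dyAvgC k g x‖ₑ := lt_of_le_of_lt (by rw [hs2]; exact le_self_add) hkx
    have hex : ∃ k, s < ‖dyAvgC k g x‖ₑ := ⟨k, hsk⟩
    set i := Nat.find hex
    have hi : s < ‖dyAvgC i g x‖ₑ := Nat.find_spec hex
    have hik : i ≤ k := Nat.find_min' hex hsk
    have hmin : ∀ l, l < i → ‖dyAvgC l g x‖ₑ ≤ s := fun l hl => not_lt.1 (Nat.find_min hex hl)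
    have hi1 : 1 ≤ i := by
      by_contra hcon
      have : i = 0 := by omega
      rw [this, dyAvgC_zero g hxc, h0] at hi
      simp at hi
    simp only [Set.mem_iUnion, Finset.mem_Icc]
    refine ⟨i, ⟨hi1, hik.trans hk'⟩, ⟨hi, hmin⟩, k, hik, hk', ?_⟩
    have h1 : ‖dyAvgC k g x - dyAvgC (i - 1) g x‖ₑ ≤ dyAvg k (φ i) x := by
      rw [← dyAvgC_sub_const k hg _ hxc]
      refine (enorm_dyAvgC_le _ _ _).trans (le_of_eq ?_)
      rw [dyAvg, dyAvg]
      congr 1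
      refine setLIntegral_congr_fun (measurableSet_dyCell _ _) fun y hy => ?_
      simp only [φ]
      rw [dyAvgC_congr g (dyIdx_eq_of_le (show i - 1 ≤ k by omega)
        (show dyIdx k y = dyIdx k x from hy))]
    refine lt_of_lt_of_le ?_ h1
    have h2 := hmin (i - 1) (by omega)
    have h3 : ‖dyAvgC k g x‖ₑ ≤ ‖dyAvgC k g x - dyAvgC (i - 1) g x‖ₑ + ‖dyAvgC (i - 1) g x‖ₑ := by
      refine le_trans (le_of_eq ?_) (enorm_add_le _ _)
      rw [sub_add_cancel]
    by_contra hcon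
    push Not at hcon
    rw [hs2] at hkx
    exact absurd hkx (not_lt.2 (h3.trans (add_le_add hcon h2)))
  calc s * μT n {x | ENNReal.ofReal (2 * t) < dyMax N g x}
      = s * μT n ({x | ENNReal.ofReal (2 * t) < dyMax N g x} ∩ cube n) := by
        congr 1
        refine measure_congr ?_
        filter_upwards [ae_mem_cube] with x hx
        exact propext ⟨fun h => ⟨h, hx⟩, fun h => h.1⟩
    _ ≤ s * ∑ i ∈ Finset.Icc 1 N,
          μT n {x | x ∈ T i ∧ ∃ k, i ≤ k ∧ k ≤ N ∧ s < dyAvg k (φ i) x} :=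
        mul_le_mul_right ((measure_mono hcov).trans (measure_biUnion_finset_le _ _)) _
    _ ≤ ∑ i ∈ Finset.Icc 1 N, ∫⁻ x in T i, φ i x ∂μT n := by
        rw [Finset.mul_sum]
        exact Finset.sum_le_sum fun i _ => dyadic_maximal_weak i N (hφ i) (hT i) s
    _ = ∑ i ∈ Finset.Icc 1 N, ∫⁻ x in T i, dyAvg i (φ i) x ∂μT n :=
        Finset.sum_congr rfl fun i _ => (setLIntegral_dyAvg i (hT i) (hφ i)).symm
    _ ≤ ∑ i ∈ Finset.Icc 1 N, ∫⁻ x in T i, 2 ^ n * dySharp N g x ∂μT n := by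
        refine Finset.sum_le_sum fun i hi => lintegral_mono fun x => ?_
        obtain ⟨hi1, hiN⟩ := Finset.mem_Icc.1 hi
        have h1 := dyAvg_succ_le (i - 1) (φ i) x
        rw [Nat.sub_add_cancel hi1, hφosc] at h1
        refine h1.trans (mul_le_mul_right ?_ _)
        exact Finset.le_sup (f := fun i => dyOsc i g x) (Finset.mem_range.2 (by omega))
    _ = ∫⁻ x in ⋃ i ∈ Finset.Icc 1 N, T i, 2 ^ n * dySharp N g x ∂μT n :=
        (lintegral_biUnion_finset hdisj (fun i _ => (hT i).measurableSet) _).symm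
    _ ≤ ∫⁻ x in {x | s < dyMax N g x}, 2 ^ n * dySharp N g x ∂μT n := by
        refine lintegral_mono_set fun x hx => ?_
        simp only [Set.mem_iUnion, Finset.mem_Icc] at hx
        obtain ⟨i, ⟨_, hi⟩, h, _⟩ := hx
        exact h.trans_le (Finset.le_sup (f := fun i => ‖dyAvgC i g x‖ₑ)
          (Finset.mem_range.2 (by omega)))
    _ = _ := lintegral_const_mul _ (measurable_dySharp N g)

theorem dyAvg_le_of_le (i : ℕ) {φ : (Fin n → ℝ) → ℝ≥0∞} {M : ℝ≥0∞} (h : ∀ y, φ y ≤ M)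
    {x : Fin n → ℝ} (hx : x ∈ cube n) : dyAvg i φ x ≤ M := by
  rw [dyAvg]
  calc 2 ^ (i * n) * ∫⁻ y in dyCell i x, φ y ∂μT n
      ≤ 2 ^ (i * n) * ∫⁻ y in dyCell i x, M ∂μT n := mul_le_mul_right (lintegral_mono h) _
    _ = M * (2 ^ (i * n) * μT n (dyCell i x)) := by rw [setLIntegral_const]; ring
    _ = M := by rw [mul_measure_dyCell i hx, mul_one]

/-- Dyadic Fefferman–Stein inequality for the truncated maximal function of a mean zero
function. -/
theorem fefferman_stein_trunc {p : ℝ} (hp : 1 < p) (N : ℕ) {g : (Fin n → ℝ) → ℂ} (hg : BddMeas g)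
    (h0 : ∫ y, g y ∂μT n = 0) :
    ∫⁻ x, dyMax N g x ^ p ∂μT n ≤ (ENNReal.ofReal (2 ^ p * p / (p - 1)) * 2 ^ n) ^ p *
      ∫⁻ x, dySharp N g x ^ p ∂μT n := by
  obtain ⟨hgm, M, hM⟩ := id hg
  set X : (Fin n → ℝ) → ℝ≥0∞ := (cube n).indicator (dyMax N g)
  have hXe : ∀ᵐ x ∂μT n, dyMax N g x = X x := by
    filter_upwards [ae_mem_cube] with x hx
    simp [X, hx]
  have hset : ∀ u : ℝ≥0∞, {x | u < X x} =ᵐ[μT n] {x | u < dyMax N g x} := by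
    intro u
    filter_upwards [ae_mem_cube] with x hx
    change (u < X x) = (u < dyMax N g x)
    simp [X, hx]
  rw [lintegral_congr_ae (hXe.mono fun x hx => by simp only [hx] : (fun x => dyMax N g x ^ p)
    =ᵐ[μT n] fun x => X x ^ p)]
  refine lintegral_rpow_le_of_dist_le (μT n) hp (2 ^ n) X (dySharp N g)
    ((measurable_dyMax N g).indicator measurableSet_cube) (measurable_dySharp N g) M ?_ ?_
  · intro x
    by_cases hx : x ∈ cube n
    · simp only [X, Set.indicator_of_mem hx]
      refine Finset.sup_le fun i _ => (enorm_dyAvgC_le _ _ _).trans (dyAvg_le_of_le i ?_ hx)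
      intro y
      rw [← ofReal_norm]
      exact ENNReal.ofReal_le_ofReal (hM y)
    · simp [X, hx]
  · intro t ht
    rw [measure_congr (hset _), Measure.restrict_congr_set (hset _)]
    exact dyMax_dist N hg h0 t ht

theorem dyOsc_sub_const (i : ℕ) {g : (Fin n → ℝ) → ℂ} (hg : BddMeas g) (c : ℂ)
    {x : Fin n → ℝ} (hx : x ∈ cube n) : dyOsc i (fun y => g y - c) x = dyOsc i g x := by
  rw [dyOsc, dyOsc, dyAvgC_sub_const i hg c hx]
  simp

theorem tendsto_dyAvgC {g : (Fin n → ℝ) → ℂ} (hg : BddMeas g) (hc : Continuous g)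
    {x : Fin n → ℝ} (hx : x ∈ cube n) :
    Filter.Tendsto (fun i => dyAvgC i g x) Filter.atTop (nhds (g x)) := by
  rw [Metric.tendsto_atTop]
  intro ε hε
  obtain ⟨r, hr, hr'⟩ := Metric.continuous_iff.1 hc x (ε / 2) (by positivity)
  obtain ⟨N, hN⟩ := exists_pow_lt_of_lt_one hr (show (1 / 2 : ℝ) < 1 by norm_num)
  refine ⟨N, fun i hi => ?_⟩
  have hd : ∀ y ∈ dyCell i x, ‖g y - g x‖ₑ ≤ ENNReal.ofReal (ε / 2) := by
    intro y hy
    rw [← ofReal_norm, ← dist_eq_norm]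
    refine ENNReal.ofReal_le_ofReal (hr' y ?_).le
    have : (1 / 2 : ℝ) ^ i ≤ (1 / 2) ^ N := pow_le_pow_of_le_one (by norm_num) (by norm_num) hi
    refine lt_of_le_of_lt ((dist_pi_le_iff (by positivity)).2 fun k => ?_) (this.trans_lt hN)
    have hk : ⌊(2:ℝ) ^ i * y k⌋ = ⌊(2:ℝ) ^ i * x k⌋ := congrFun hy k
    have h1 := Int.abs_sub_lt_one_of_floor_eq_floor hk
    rw [← mul_sub, abs_mul, abs_of_pos (by positivity)] at h1
    rw [Real.dist_eq, div_pow, one_pow, le_div_iff₀ (by positivity), mul_comm]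
    exact h1.le
  have h1 : ‖dyAvgC i g x - g x‖ₑ ≤ ENNReal.ofReal (ε / 2) := by
    rw [← dyAvgC_sub_const i hg _ hx]
    refine (enorm_dyAvgC_le _ _ _).trans ?_
    rw [dyAvg]
    calc 2 ^ (i * n) * ∫⁻ y in dyCell i x, ‖g y - g x‖ₑ ∂μT n
        ≤ 2 ^ (i * n) * ∫⁻ y in dyCell i x, ENNReal.ofReal (ε / 2) ∂μT n :=
          mul_le_mul_right (setLIntegral_mono' (measurableSet_dyCell i x) hd) _
      _ = ENNReal.ofReal (ε / 2) * (2 ^ (i * n) * μT n (dyCell i x)) := by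
          rw [setLIntegral_const]; ring
      _ = _ := by rw [mul_measure_dyCell i hx, mul_one]
  rw [dist_eq_norm]
  rw [← ofReal_norm, ENNReal.ofReal_le_ofReal_iff (by positivity)] at h1
  linarith

/-- Dyadic Fefferman–Stein inequality. -/
theorem fefferman_stein {p : ℝ} (hp : 1 < p) {g : (Fin n → ℝ) → ℂ} (hg : BddMeas g)
    (hc : Continuous g) {D : ℝ≥0∞} (hD : ∀ N, ∫⁻ x, dySharp N g x ^ p ∂μT n ≤ D) :
    ∫⁻ x, ‖g x‖ₑ ^ p ∂μT n ≤ 2 ^ (p - 1) *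
      ((ENNReal.ofReal (2 ^ p * p / (p - 1)) * 2 ^ n) ^ p * D +
        (∫⁻ x, ‖g x‖ₑ ∂μT n) ^ p) := by
  set c := ∫ y, g y ∂μT n
  set h : (Fin n → ℝ) → ℂ := fun y => g y - c
  have hh : BddMeas h := hg.sub_dyAvgC c
  have hh0 : ∫ y, h y ∂μT n = 0 := by
    simp only [h]
    rw [integral_sub hg.integrable (integrable_const c)]
    simp [c]
  have hsh : ∀ N, ∫⁻ x, dySharp N h x ^ p ∂μT n ≤ D := by
    intro N
    refine le_trans (le_of_eq (lintegral_congr_ae ?_)) (hD N)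
    filter_upwards [ae_mem_cube] with x hx
    simp only [dySharp]
    congr 2
    funext i
    exact dyOsc_sub_const i hg c hx
  have h1 : ∫⁻ x, ‖h x‖ₑ ^ p ∂μT n ≤
      (ENNReal.ofReal (2 ^ p * p / (p - 1)) * 2 ^ n) ^ p * D := by
    calc ∫⁻ x, ‖h x‖ₑ ^ p ∂μT n
        = ∫⁻ x, Filter.liminf (fun N => ‖dyAvgC N h x‖ₑ ^ p) Filter.atTop ∂μT n := by
          refine lintegral_congr_ae ?_
          filter_upwards [ae_mem_cube] with x hx
          refine (Filter.Tendsto.liminf_eq ?_).symm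
          exact ((tendsto_dyAvgC hh (hc.sub continuous_const) hx).enorm).ennrpow_const p
      _ ≤ Filter.liminf (fun N => ∫⁻ x, ‖dyAvgC N h x‖ₑ ^ p ∂μT n) Filter.atTop :=
          lintegral_liminf_le fun N => (measurable_dyAvgC N h).enorm.pow_const p
      _ ≤ _ := by
          refine Filter.liminf_le_of_le (by isBoundedDefault) fun b hb => ?_
          obtain ⟨N, hN⟩ := hb.exists
          refine hN.trans (le_trans (lintegral_mono fun x => ?_)
            ((fefferman_stein_trunc hp N hh hh0).trans (mul_le_mul_right (hsh N) _)))
          exact ENNReal.rpow_le_rpow (Finset.le_sup (f := fun i => ‖dyAvgC i h x‖ₑ)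
            (Finset.self_mem_range_succ N)) (by linarith)
  have h2 : ‖c‖ₑ ≤ ∫⁻ x, ‖g x‖ₑ ∂μT n := enorm_integral_le_lintegral_enorm _
  calc ∫⁻ x, ‖g x‖ₑ ^ p ∂μT n
      ≤ ∫⁻ x, 2 ^ (p - 1) * (‖h x‖ₑ ^ p + ‖c‖ₑ ^ p) ∂μT n := by
        refine lintegral_mono fun x => ?_
        refine le_trans (ENNReal.rpow_le_rpow ?_ (by linarith))
          (ENNReal.rpow_add_le_mul_rpow_add_rpow _ _ hp.le)
        refine le_trans (le_of_eq ?_) (enorm_add_le _ _)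
        simp [h]
    _ = 2 ^ (p - 1) * (∫⁻ x, ‖h x‖ₑ ^ p ∂μT n + ‖c‖ₑ ^ p) := by
        rw [lintegral_const_mul _ (by have := hh.1; fun_prop), lintegral_add_right _ (by fun_prop)]
        simp
    _ ≤ _ := by gcongr

/-- The chordal distance `|e^{2πit} - 1|`. -/
def chD (t : ℝ) : ℝ := ‖Complex.exp (2 * (π : ℂ) * Complex.I * t) - 1‖

theorem chD_nonneg (t : ℝ) : 0 ≤ chD t := norm_nonneg _

theorem chD_eq (t : ℝ) : chD t = 2 * |Real.sin (π * t)| := by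
  have := Complex.norm_exp_I_mul_ofReal_sub_one (2 * π * t)
  rw [chD]
  rw [show 2 * (π : ℂ) * Complex.I * t = Complex.I * ((2 * π * t : ℝ) : ℂ) by push_cast; ring, this]
  rw [Real.norm_eq_abs, abs_mul, abs_two]
  congr 3; ring

theorem continuous_chD : Continuous chD := by
  unfold chD; fun_prop

theorem chD_neg (t : ℝ) : chD (-t) = chD t := by
  rw [chD_eq, chD_eq, mul_neg, Real.sin_neg, abs_neg]

theorem chD_le_two (t : ℝ) : chD t ≤ 2 := by
  rw [chD_eq]; nlinarith [Real.abs_sin_le_one (π * t)]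

theorem chD_add_int (t : ℝ) (k : ℤ) : chD (t + k) = chD t := by
  rw [chD_eq, chD_eq, mul_add, mul_comm π (k : ℝ), Real.sin_add_int_mul_pi, abs_mul]
  have : |((-1:ℝ)) ^ k| = 1 := by rw [abs_zpow]; simp
  rw [this, one_mul]

theorem four_mul_abs_le_chD {t : ℝ} (ht : |t| ≤ 1 / 2) : 4 * |t| ≤ chD t := by
  have key : ∀ t : ℝ, 0 ≤ t → t ≤ 1 / 2 → 4 * t ≤ chD t := by
    intro t h0 h1
    have h2 := Real.mul_le_sin (x := π * t) (by positivity) (by nlinarith [Real.pi_pos])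
    rw [chD_eq]
    have h3 : 2 / π * (π * t) = 2 * t := by field_simp
    rw [h3] at h2
    have := le_abs_self (Real.sin (π * t))
    linarith
  rcases abs_cases t with ⟨h, h0⟩ | ⟨h, h0⟩
  · rw [h]; exact key t h0 (h ▸ ht)
  · rw [h, ← chD_neg]; exact key (-t) (by linarith) (h ▸ ht)

theorem μT_eq_pi : μT n = Measure.pi fun _ : Fin n => volume.restrict (Set.Ico (0:ℝ) 1) := by
  rw [μT, cube, volume_pi, Measure.restrict_pi_pi]

theorem integral_weight_one {L : ℝ} (hL : 0 < L) (x : ℝ) :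
    ∫ t in Set.Ico (0:ℝ) 1, (1 + L ^ 2 * chD (x - t) ^ 2)⁻¹ ≤ 1 / L := by
  have hc : Continuous fun t : ℝ => (1 + L ^ 2 * chD (x - t) ^ 2)⁻¹ := by
    have := continuous_chD
    refine Continuous.inv₀ (by fun_prop) fun t => by positivity
  have hper : Function.Periodic (fun t : ℝ => (1 + L ^ 2 * chD (x - t) ^ 2)⁻¹) 1 := by
    intro t
    have := chD_add_int (x - (t + 1)) 1
    simp only
    rw [← this]; congr 5; push_cast; ring
  rw [integral_Ico_eq_integral_Ioc, ← intervalIntegral.integral_of_le zero_le_one]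
  have h1 := hper.intervalIntegral_add_eq 0 (x - 1 / 2)
  rw [zero_add] at h1
  rw [h1]
  have h2 : ∫ t in (x - 1 / 2)..(x - 1 / 2 + 1), (1 + L ^ 2 * chD (x - t) ^ 2)⁻¹ ≤
      ∫ t in (x - 1 / 2)..(x - 1 / 2 + 1), (1 + (4 * L * t - 4 * L * x) ^ 2)⁻¹ := by
    refine intervalIntegral.integral_mono_on (by linarith) (hc.intervalIntegrable _ _) ?_ ?_
    · refine Continuous.intervalIntegrable ?_ _ _
      exact Continuous.inv₀ (by fun_prop) fun t => by positivity
    · intro t ht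
      have h3 : |x - t| ≤ 1 / 2 := by rw [abs_le]; constructor <;> linarith [ht.1, ht.2]
      have h4 := four_mul_abs_le_chD h3
      refine inv_anti₀ (by positivity) ?_
      have h5 : (4 * |x - t|) ^ 2 ≤ chD (x - t) ^ 2 := pow_le_pow_left₀ (by positivity) h4 2
      rw [mul_pow, sq_abs] at h5
      nlinarith [sq_nonneg L]
  refine h2.trans ?_
  rw [intervalIntegral.integral_comp_mul_sub (fun u => (1 + u ^ 2)⁻¹) (by positivity)]
  rw [integral_inv_one_add_sq, smul_eq_mul]
  have h6 : arctan (4 * L * (x - 1 / 2 + 1) - 4 * L * x) - arctan (4 * L * (x - 1 / 2) - 4 * L * x)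
      ≤ 4 := by
    have := arctan_lt_pi_div_two (4 * L * (x - 1 / 2 + 1) - 4 * L * x)
    have := neg_pi_div_two_lt_arctan (4 * L * (x - 1 / 2) - 4 * L * x)
    linarith [Real.pi_lt_four]
  calc _ ≤ (4 * L)⁻¹ * 4 := mul_le_mul_of_nonneg_left h6 (by positivity)
    _ = 1 / L := by field_simp

/-- The product weight adapted to the scale `1/L` around `x`. -/
def chW (L : ℝ) (x y : Fin n → ℝ) : ℝ := ∏ i, (1 + L ^ 2 * chD (x i - y i) ^ 2)⁻¹

theorem continuous_chW (L : ℝ) (x : Fin n → ℝ) : Continuous (chW L x) := by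
  have := continuous_chD
  unfold chW
  refine continuous_finsetProd _ fun i _ => Continuous.inv₀ (by fun_prop) fun t => by positivity

theorem chW_nonneg (L : ℝ) (x y : Fin n → ℝ) : 0 ≤ chW L x y :=
  Finset.prod_nonneg fun i _ => by positivity

theorem chW_le_one (L : ℝ) (x y : Fin n → ℝ) : chW L x y ≤ 1 :=
  Finset.prod_le_one (fun i _ => by positivity) fun i _ => inv_le_one_of_one_le₀ (by
    have : 0 ≤ L ^ 2 * chD (x i - y i) ^ 2 := by positivity
    linarith)

theorem integrable_chW (L : ℝ) (x : Fin n → ℝ) : Integrable (chW L x) (μT n) :=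
  Integrable.of_bound (continuous_chW L x).aestronglyMeasurable 1
    (Filter.Eventually.of_forall fun y => by
      rw [Real.norm_eq_abs, abs_of_nonneg (chW_nonneg L x y)]; exact chW_le_one L x y)

theorem integral_chW {L : ℝ} (hL : 0 < L) (x : Fin n → ℝ) :
    ∫ y, chW L x y ∂μT n ≤ (1 / L) ^ n := by
  rw [μT_eq_pi]
  have := integral_fintype_prod_eq_prod (𝕜 := ℝ) (ι := Fin n) (E := fun _ => ℝ)
    (fun i t => (1 + L ^ 2 * chD (x i - t) ^ 2)⁻¹) (μ := fun _ => volume.restrict (Set.Ico (0:ℝ) 1))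
  simp only [chW]
  rw [this]
  calc _ ≤ ∏ i : Fin n, (1 / L) := Finset.prod_le_prod
        (fun i _ => integral_nonneg fun t => by positivity) fun i _ => integral_weight_one hL (x i)
    _ = _ := by simp

theorem measure_chD_ball {s : ℝ} (hs : 0 < s) (x : Fin n → ℝ) :
    μT n {y | ∀ k, chD (x k - y k) ≤ s} ≤ ENNReal.ofReal ((2 * s) ^ n) := by
  have h1 : μT n {y | ∀ k, chD (x k - y k) ≤ s} ≤
      ∫⁻ y, ENNReal.ofReal (2 ^ n * chW (1 / s) x y) ∂μT n := by
    have hm : MeasurableSet {y : Fin n → ℝ | ∀ k, chD (x k - y k) ≤ s} := by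
      have := continuous_chD
      simp only [Set.ofPred_forall]
      exact MeasurableSet.iInter fun k => measurableSet_le (by fun_prop) measurable_const
    rw [← lintegral_indicator_one hm]
    refine lintegral_mono fun y => ?_
    by_cases hy : y ∈ {y : Fin n → ℝ | ∀ k, chD (x k - y k) ≤ s}
    · rw [Set.indicator_of_mem hy]
      have : (1:ℝ) ≤ 2 ^ n * chW (1 / s) x y := by
        rw [chW, ← Fin.prod_const n (2:ℝ), ← Finset.prod_mul_distrib]
        refine le_trans (le_of_eq Finset.prod_const_one.symm)
          (Finset.prod_le_prod (s := Finset.univ) (fun _ _ => zero_le_one) fun i _ => ?_)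
        have hk : chD (x i - y i) ≤ s := hy i
        have : (1 / s) ^ 2 * chD (x i - y i) ^ 2 ≤ 1 := by
          rw [← mul_pow]
          refine pow_le_one₀ (mul_nonneg (by positivity) (chD_nonneg _)) ?_
          rw [one_div_mul_eq_div, div_le_one hs]; exact hk
        rw [← div_eq_mul_inv, le_div_iff₀ (by positivity)]
        linarith
      simpa using ENNReal.ofReal_le_ofReal this
    · rw [Set.indicator_of_notMem hy]; exact zero_le
  refine h1.trans ?_
  rw [← ofReal_integral_eq_lintegral_ofReal ((integrable_chW _ x).const_mul _)
    (Filter.Eventually.of_forall fun y => mul_nonneg (by positivity) (chW_nonneg _ _ _)),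
    integral_const_mul]
  refine ENNReal.ofReal_le_ofReal ?_
  calc _ ≤ (2:ℝ) ^ n * (1 / (1 / s)) ^ n :=
        mul_le_mul_of_nonneg_left (integral_chW (by positivity) x) (by positivity)
    _ = _ := by rw [one_div_one_div, mul_pow]

theorem sq_mul_prod_le (u : Fin n → ℝ) (hu : ∀ i, 0 ≤ u i) :
    (1 + ∑ i, u i) ^ 2 * ∏ i, (1 + u i ^ 2) ≤
      (1 + n) ^ 2 * 2 ^ n * (1 + ∑ i, u i ^ (2 * (n + 1))) := by
  set S := 1 + ∑ i, u i ^ (2 * (n + 1))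
  have hS : 1 ≤ S := le_add_of_nonneg_right (Finset.sum_nonneg fun i _ => pow_nonneg (hu i) _)
  set M := S ^ (1 / ((2 * (n + 1) : ℕ) : ℝ))
  have hM1 : 1 ≤ M := Real.one_le_rpow hS (by positivity)
  have hMS : M ^ (2 * (n + 1)) = S := by
    rw [← Real.rpow_natCast, ← Real.rpow_mul (by linarith), one_div_mul_cancel (by positivity),
      Real.rpow_one]
  have huM : ∀ i, u i ≤ M := by
    intro i
    refine le_of_pow_le_pow_left₀ (n := 2 * (n + 1)) (by positivity) (by linarith) ?_
    rw [hMS]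
    have := Finset.single_le_sum (f := fun i => u i ^ (2 * (n + 1)))
      (fun i _ => pow_nonneg (hu i) _) (Finset.mem_univ i)
    simp only [S]; linarith
  have h1 : 1 + ∑ i, u i ≤ (1 + n) * M := by
    have : ∑ i, u i ≤ n * M := by
      calc _ ≤ ∑ i : Fin n, M := Finset.sum_le_sum fun i _ => huM i
        _ = _ := by simp
    nlinarith
  have h2 : ∏ i, (1 + u i ^ 2) ≤ (2 * M ^ 2) ^ n := by
    calc _ ≤ ∏ i : Fin n, (2 * M ^ 2) := Finset.prod_le_prod (fun i _ => by positivity) fun i _ => by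
          have := pow_le_pow_left₀ (hu i) (huM i) 2
          nlinarith
      _ = _ := by simp
  calc _ ≤ ((1 + n) * M) ^ 2 * (2 * M ^ 2) ^ n := by
        refine mul_le_mul (pow_le_pow_left₀ ?_ h1 2) h2 (Finset.prod_nonneg fun i _ => by positivity)
          (by positivity)
        have := Finset.sum_nonneg fun i (_ : i ∈ Finset.univ) => hu i
        linarith
    _ = (1 + n) ^ 2 * 2 ^ n * M ^ (2 * (n + 1)) := by ring
    _ = _ := by rw [hMS]

/-- Weighted `L²` bounds for a kernel imply a weighted `L¹` bound. -/
theorem integral_weighted_le {L A : ℝ} (hL : 0 < L) (hA : 0 < A) (x : Fin n → ℝ)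
    {K : (Fin n → ℝ) → ℂ} (hK : BddMeas K) (h0 : ∫ y, ‖K y‖ ^ 2 ∂μT n ≤ A ^ 2)
    (h1 : ∀ i, ∫ y, ‖K y‖ ^ 2 * chD (x i - y i) ^ (2 * (n + 1)) ∂μT n ≤
      A ^ 2 * (1 / L) ^ (2 * (n + 1))) :
    ∫ y, ‖K y‖ * (1 + L * ∑ i, chD (x i - y i)) ∂μT n ≤
      ((1 + n) ^ 3 * 2 ^ n + 1) * (A * (1 / L) ^ ((n : ℝ) / 2)) := by
  obtain ⟨hKm, M, hM⟩ := id hK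
  have hcD := continuous_chD
  have hbi : ∀ {F : (Fin n → ℝ) → ℝ}, Continuous F → (∃ C, ∀ y, |F y| ≤ C) → ∀ k : ℕ,
      Integrable (fun y => ‖K y‖ ^ k * F y) (μT n) := by
    rintro F hF ⟨C, hC⟩ k
    refine Integrable.of_bound (by have := hF.measurable; fun_prop) (|M| ^ k * C)
      (Filter.Eventually.of_forall fun y => ?_)
    rw [norm_mul, norm_pow, norm_norm]
    refine mul_le_mul (pow_le_pow_left₀ (norm_nonneg _) ((hM y).trans (le_abs_self M)) _) (hC y)
      (norm_nonneg _) (by positivity)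
  have hb : ∀ i (k : ℕ) (y : Fin n → ℝ), |chD (x i - y i) ^ k| ≤ 2 ^ k := fun i k y => by
    rw [abs_of_nonneg (pow_nonneg (chD_nonneg _) _)]
    exact pow_le_pow_left₀ (chD_nonneg _) (chD_le_two _) _
  set B := (1 / L) ^ ((n : ℝ) / 2)
  have hB : 0 < B := by positivity
  have hBn : B ^ 2 = (1 / L) ^ n := by
    rw [← Real.rpow_natCast, ← Real.rpow_mul (by positivity)]
    norm_num
  set θ := A / B
  have hθ : 0 < θ := by positivity
  set Cn : ℝ := (1 + n) ^ 2 * 2 ^ n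
  have hpt : ∀ y, ‖K y‖ * (1 + L * ∑ i, chD (x i - y i)) ≤
      Cn / (2 * θ) * (‖K y‖ ^ 2 + ∑ i, L ^ (2 * (n + 1)) *
        (‖K y‖ ^ 2 * chD (x i - y i) ^ (2 * (n + 1)))) + θ / 2 * chW L x y := by
    intro y
    have hs := sq_mul_prod_le (fun i => L * chD (x i - y i))
      fun i => mul_nonneg hL.le (chD_nonneg _)
    simp only [mul_pow] at hs
    rw [← Finset.mul_sum] at hs
    set U := 1 + L * ∑ i, chD (x i - y i)
    set P := ∏ i, (1 + L ^ 2 * chD (x i - y i) ^ 2)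
    have hP : 0 < P := Finset.prod_pos fun i _ => by positivity
    have hW : chW L x y = P⁻¹ := by rw [chW, Finset.prod_inv_distrib]
    have e1 : ‖K y‖ ^ 2 + ∑ i, L ^ (2 * (n + 1)) * (‖K y‖ ^ 2 * chD (x i - y i) ^ (2 * (n + 1))) =
        ‖K y‖ ^ 2 * (1 + ∑ i, L ^ (2 * (n + 1)) * chD (x i - y i) ^ (2 * (n + 1))) := by
      rw [mul_add (‖K y‖ ^ 2), mul_one (‖K y‖ ^ 2), Finset.mul_sum]
      congr 1
      exact Finset.sum_congr rfl fun i _ => by ring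
    rw [e1, hW]
    have h3 : ‖K y‖ * U ≤ 1 / (2 * θ) * (‖K y‖ ^ 2 * (U ^ 2 * P)) + θ / 2 * P⁻¹ := by
      have h4 : 0 ≤ (‖K y‖ * U * P - θ) ^ 2 / (2 * θ * P) := by positivity
      have h5 : 1 / (2 * θ) * (‖K y‖ ^ 2 * (U ^ 2 * P)) + θ / 2 * P⁻¹ - ‖K y‖ * U =
          (‖K y‖ * U * P - θ) ^ 2 / (2 * θ * P) := by field_simp; ring
      linarith
    refine h3.trans (add_le_add ?_ le_rfl)
    calc 1 / (2 * θ) * (‖K y‖ ^ 2 * (U ^ 2 * P)) ≤ 1 / (2 * θ) * (‖K y‖ ^ 2 *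
          (Cn * (1 + ∑ i, L ^ (2 * (n + 1)) * chD (x i - y i) ^ (2 * (n + 1))))) := by gcongr
      _ = _ := by ring
  have i0 : Integrable (fun y => ‖K y‖ ^ 2) (μT n) := by
    simpa using hbi (F := fun _ => 1) continuous_const ⟨1, by simp⟩ 2
  have i1 : ∀ i, Integrable (fun y => L ^ (2 * (n + 1)) *
      (‖K y‖ ^ 2 * chD (x i - y i) ^ (2 * (n + 1)))) (μT n) := fun i =>
    (hbi (by fun_prop) ⟨_, hb i _⟩ 2).const_mul _
  have i2 : Integrable (fun y => ∑ i, L ^ (2 * (n + 1)) *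
      (‖K y‖ ^ 2 * chD (x i - y i) ^ (2 * (n + 1)))) (μT n) :=
    integrable_finsetSum _ fun i _ => i1 i
  have i3 : Integrable (fun y => ‖K y‖ ^ 2 + ∑ i, L ^ (2 * (n + 1)) *
      (‖K y‖ ^ 2 * chD (x i - y i) ^ (2 * (n + 1)))) (μT n) := i0.add i2
  have hlhs : Integrable (fun y => ‖K y‖ * (1 + L * ∑ i, chD (x i - y i))) (μT n) := by
    have := hbi (F := fun y => 1 + L * ∑ i, chD (x i - y i)) (by fun_prop)
      ⟨1 + L * (n * 2), fun y => by
        have h0 : 0 ≤ ∑ i, chD (x i - y i) := Finset.sum_nonneg fun i _ => chD_nonneg _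
        rw [abs_of_nonneg (by positivity)]
        gcongr
        calc _ ≤ ∑ i : Fin n, (2:ℝ) := Finset.sum_le_sum fun i _ => chD_le_two _
          _ = _ := by simp⟩ 1
    simpa using this
  calc ∫ y, ‖K y‖ * (1 + L * ∑ i, chD (x i - y i)) ∂μT n
      ≤ ∫ y, (Cn / (2 * θ) * (‖K y‖ ^ 2 + ∑ i, L ^ (2 * (n + 1)) *
        (‖K y‖ ^ 2 * chD (x i - y i) ^ (2 * (n + 1)))) + θ / 2 * chW L x y) ∂μT n :=
        integral_mono hlhs ((i3.const_mul _).add ((integrable_chW L x).const_mul _)) hpt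
    _ = Cn / (2 * θ) * (∫ y, ‖K y‖ ^ 2 ∂μT n + ∑ i, L ^ (2 * (n + 1)) *
        ∫ y, (‖K y‖ ^ 2 * chD (x i - y i) ^ (2 * (n + 1))) ∂μT n) +
          θ / 2 * ∫ y, chW L x y ∂μT n := by
        rw [integral_add (i3.const_mul _) ((integrable_chW L x).const_mul _),
          integral_const_mul, integral_const_mul]
        congr 2
        rw [integral_add i0 i2, integral_finsetSum _ fun i _ => i1 i]
        simp_rw [integral_const_mul]
    _ ≤ Cn / (2 * θ) * (A ^ 2 + ∑ i : Fin n, L ^ (2 * (n + 1)) *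
          (A ^ 2 * (1 / L) ^ (2 * (n + 1)))) + θ / 2 * (1 / L) ^ n := by
        gcongr with i
        · exact h1 i
        · exact integral_chW hL x
    _ = (Cn * (1 + n) / 2 + 1 / 2) * (A * B) := by
        have e3 : L ^ (2 * (n + 1)) * (A ^ 2 * (1 / L) ^ (2 * (n + 1))) = A ^ 2 := by
          rw [mul_left_comm, ← mul_pow, mul_one_div_cancel hL.ne', one_pow, mul_one]
        simp only [e3, ← hBn, Finset.sum_const, Finset.card_univ, Fintype.card_fin, nsmul_eq_mul]
        simp only [θ]
        field_simp
    _ ≤ _ := by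
        have : 0 ≤ Cn * (1 + n) := by positivity
        have e4 : ((1:ℝ) + n) ^ 3 * 2 ^ n = Cn * (1 + n) := by simp only [Cn]; ring
        rw [e4]
        refine mul_le_mul_of_nonneg_right ?_ (by positivity)
        linarith

theorem chD_le_add (s t : ℝ) : chD s ≤ chD t + chD (s - t) := by
  have h : Complex.exp (2 * (π : ℂ) * Complex.I * s) - 1 =
      (Complex.exp (2 * (π : ℂ) * Complex.I * t) - 1) +
      Complex.exp (2 * (π : ℂ) * Complex.I * t) *
        (Complex.exp (2 * (π : ℂ) * Complex.I * ((s - t : ℝ) : ℂ)) - 1) := by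
    rw [mul_sub, ← Complex.exp_add]
    push_cast; ring_nf
  have h1 : ‖Complex.exp (2 * (π : ℂ) * Complex.I * t)‖ = 1 := by
    rw [show 2 * (π : ℂ) * Complex.I * t = Complex.I * ((2 * π * t : ℝ) : ℂ) by push_cast; ring,
      Complex.norm_exp_I_mul_ofReal]
  unfold chD
  rw [h]
  refine (norm_add_le _ _).trans ?_
  rw [norm_mul, h1, one_mul]

theorem chD_le_mul_abs (t : ℝ) : chD t ≤ 7 * |t| := by
  rw [chD_eq]
  have h1 := Real.abs_sin_le_abs (x := π * t)
  rw [abs_mul, abs_of_pos Real.pi_pos] at h1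
  have : π ≤ 7 / 2 := by linarith [Real.pi_lt_d2]
  nlinarith [abs_nonneg t]

theorem rpow_lintegral_le {X : Type*} [MeasurableSpace X] (μ : Measure X) [IsProbabilityMeasure μ]
    {r : ℝ} (hr : 1 < r) {φ : X → ℝ≥0∞} (hφ : AEMeasurable φ μ) :
    (∫⁻ x, φ x ∂μ) ^ r ≤ ∫⁻ x, φ x ^ r ∂μ := by
  have h := ENNReal.lintegral_mul_le_Lp_mul_Lq μ (Real.HolderConjugate.conjExponent hr) hφ
    (g := fun _ => 1) aemeasurable_const
  simp only [Pi.mul_apply, mul_one, ENNReal.one_rpow, lintegral_const, measure_univ] at h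
  have h2 := ENNReal.rpow_le_rpow h (show 0 ≤ r by linarith)
  rwa [← ENNReal.rpow_mul, one_div_mul_cancel (by linarith), ENNReal.rpow_one] at h2

theorem dyAvg_sq_le (i : ℕ) {φ : (Fin n → ℝ) → ℝ≥0∞} (hφ : Measurable φ)
    {x : Fin n → ℝ} (hx : x ∈ cube n) :
    dyAvg i φ x ^ (2:ℝ) ≤ dyAvg i (fun y => φ y ^ (2:ℝ)) x := by
  have : IsProbabilityMeasure ((2:ℝ≥0∞) ^ (i * n) • (μT n).restrict (dyCell i x)) := ⟨by
    rw [Measure.smul_apply, Measure.restrict_apply_univ, smul_eq_mul, mul_measure_dyCell i hx]⟩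
  have h := rpow_lintegral_le ((2:ℝ≥0∞) ^ (i * n) • (μT n).restrict (dyCell i x))
    (show (1:ℝ) < 2 by norm_num) hφ.aemeasurable
  rwa [lintegral_smul_measure, lintegral_smul_measure] at h

theorem lintegral_dyAvg_sq_le (i : ℕ) {φ : (Fin n → ℝ) → ℝ≥0∞} (hφ : Measurable φ) :
    ∫⁻ x, dyAvg i φ x ^ (2:ℝ) ∂μT n ≤ ∫⁻ x, φ x ^ (2:ℝ) ∂μT n := by
  calc _ ≤ ∫⁻ x, dyAvg i (fun y => φ y ^ (2:ℝ)) x ∂μT n := by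
        refine lintegral_mono_ae ?_
        filter_upwards [ae_mem_cube] with x hx
        exact dyAvg_sq_le i hφ hx
    _ = _ := by
        have := setLIntegral_dyAvg i (A := (Set.univ : Set (Fin n → ℝ)))
          (fun _ _ _ => by simp) (hφ.pow_const (2:ℝ))
        simpa using this

theorem dyAvg_add (i : ℕ) {φ ψ : (Fin n → ℝ) → ℝ≥0∞} (hφ : Measurable φ) (x : Fin n → ℝ) :
    dyAvg i (fun y => φ y + ψ y) x = dyAvg i φ x + dyAvg i ψ x := by
  rw [dyAvg, dyAvg, dyAvg, lintegral_add_left hφ, mul_add]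

theorem dyAvg_mono (i : ℕ) {φ ψ : (Fin n → ℝ) → ℝ≥0∞} {x : Fin n → ℝ}
    (h : ∀ y ∈ dyCell i x, φ y ≤ ψ y) : dyAvg i φ x ≤ dyAvg i ψ x :=
  mul_le_mul_right (setLIntegral_mono' (measurableSet_dyCell i x) h) _

theorem dyAvg_const (i : ℕ) (c : ℝ≥0∞) {x : Fin n → ℝ} (hx : x ∈ cube n) :
    dyAvg i (fun _ => c) x = c := by
  rw [dyAvg, setLIntegral_const, mul_left_comm, mul_measure_dyCell i hx, mul_one]

theorem dyAvg_le_of_le_on (i : ℕ) {φ : (Fin n → ℝ) → ℝ≥0∞} {c : ℝ≥0∞} {x : Fin n → ℝ}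
    (hx : x ∈ cube n) (h : ∀ y ∈ dyCell i x, φ y ≤ c) : dyAvg i φ x ≤ c :=
  (dyAvg_mono i h).trans (dyAvg_const i c hx).le

theorem dyOsc_le_two_mul (i : ℕ) {g : (Fin n → ℝ) → ℂ} (hg : Measurable g) {x : Fin n → ℝ}
    (hx : x ∈ cube n) : dyOsc i g x ≤ 2 * dyAvg i (fun y => ‖g y‖ₑ) x := by
  rw [dyOsc]
  calc _ ≤ dyAvg i (fun y => ‖g y‖ₑ + ‖dyAvgC i g x‖ₑ) x := dyAvg_mono i fun y _ => enorm_sub_le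
    _ = dyAvg i (fun y => ‖g y‖ₑ) x + ‖dyAvgC i g x‖ₑ := by
        rw [dyAvg_add i (by fun_prop), dyAvg_const i _ hx]
    _ ≤ _ := by
        rw [two_mul]; gcongr; exact enorm_dyAvgC_le i g x

theorem dyOsc_le_of_forall (i : ℕ) {g : (Fin n → ℝ) → ℂ} (hg : BddMeas g) {x : Fin n → ℝ}
    (hx : x ∈ cube n) {c : ℝ≥0∞} (h : ∀ y ∈ dyCell i x, ∀ z ∈ dyCell i x, ‖g y - g z‖ₑ ≤ c) :
    dyOsc i g x ≤ c := by
  refine dyAvg_le_of_le_on i hx fun y hy => ?_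
  rw [← neg_sub, enorm_neg, ← dyAvgC_sub_const i hg _ hx]
  exact (enorm_dyAvgC_le _ _ _).trans (dyAvg_le_of_le_on i hx fun z hz => h z hz y hy)

theorem dyAvgC_add (i : ℕ) {f g : (Fin n → ℝ) → ℂ} (hf : BddMeas f) (hg : BddMeas g)
    (x : Fin n → ℝ) : dyAvgC i (f + g) x = dyAvgC i f x + dyAvgC i g x := by
  rw [dyAvgC, dyAvgC, dyAvgC, ← mul_add]
  congr 1
  exact integral_add hf.integrable.integrableOn hg.integrable.integrableOn

theorem dyOsc_add_le (i : ℕ) {f g : (Fin n → ℝ) → ℂ} (hf : BddMeas f) (hg : BddMeas g)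
    (x : Fin n → ℝ) : dyOsc i (f + g) x ≤ dyOsc i f x + dyOsc i g x := by
  rw [dyOsc, dyOsc, dyOsc, ← dyAvg_add i (by have := hf.1; fun_prop)]
  refine dyAvg_mono i fun y _ => ?_
  rw [dyAvgC_add i hf hg, Pi.add_apply, add_sub_add_comm]
  exact enorm_add_le _ _

theorem dyOsc_const_mul (i : ℕ) (c : ℂ) (f : (Fin n → ℝ) → ℂ) (hf : Measurable f)
    (x : Fin n → ℝ) : dyOsc i (fun y => c * f y) x = ‖c‖ₑ * dyOsc i f x := by
  have h : dyAvgC i (fun y => c * f y) x = c * dyAvgC i f x := by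
    rw [dyAvgC, dyAvgC, integral_const_mul]; ring
  have h2 : ∀ y, ‖c * f y - c * dyAvgC i f x‖ₑ = ‖c‖ₑ * ‖f y - dyAvgC i f x‖ₑ := fun y => by
    rw [← mul_sub, enorm_mul]
  simp_rw [dyOsc, h, dyAvg, h2]
  rw [lintegral_const_mul ‖c‖ₑ (by fun_prop), mul_left_comm]

theorem BddMeas.add {X : Type*} [MeasurableSpace X] {f g : X → ℂ} (hf : BddMeas f)
    (hg : BddMeas g) : BddMeas (f + g) := by
  obtain ⟨hf, M, hM⟩ := hf
  obtain ⟨hg, N, hN⟩ := hg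
  exact ⟨hf.add hg, M + N, fun x => (norm_add_le _ _).trans (add_le_add (hM x) (hN x))⟩

theorem BddMeas.const_mul {X : Type*} [MeasurableSpace X] {f : X → ℂ} (hf : BddMeas f) (c : ℂ) :
    BddMeas (fun x => c * f x) := by
  obtain ⟨hf, M, hM⟩ := hf
  exact ⟨hf.const_mul c, ‖c‖ * M, fun x => by rw [norm_mul]; gcongr; exact hM x⟩

theorem BddMeas.mul {X : Type*} [MeasurableSpace X] {f g : X → ℂ} (hf : BddMeas f)
    (hg : BddMeas g) : BddMeas (fun x => f x * g x) := by
  obtain ⟨hf, M, hM⟩ := hf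
  obtain ⟨hg, N, hN⟩ := hg
  exact ⟨hf.mul hg, M * N, fun x => by
    rw [norm_mul]
    exact mul_le_mul (hM x) (hN x) (norm_nonneg _) ((norm_nonneg _).trans (hM x))⟩

theorem BddMeas.indicator {X : Type*} [MeasurableSpace X] {f : X → ℂ} (hf : BddMeas f) {S : Set X}
    (hS : MeasurableSet S) : BddMeas (S.indicator f) := by
  obtain ⟨hf, M, hM⟩ := hf
  exact ⟨hf.indicator hS, M, fun x => (norm_indicator_le_norm_self f x).trans (hM x)⟩

theorem bddMeas_zero {X : Type*} [MeasurableSpace X] : BddMeas (0 : X → ℂ) :=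
  ⟨measurable_zero, 0, fun x => by simp⟩

theorem bddMeas_sum {X ι : Type*} [MeasurableSpace X] (s : Finset ι) {f : ι → X → ℂ}
    (hf : ∀ j, BddMeas (f j)) : BddMeas (fun x => ∑ j ∈ s, f j x) := by
  classical
  induction s using Finset.induction_on with
  | empty => simpa using (show BddMeas (fun _ : X => (0:ℂ)) from bddMeas_zero)
  | insert a s ha ih =>
    simp_rw [Finset.sum_insert ha]
    exact (hf a).add ih

theorem dyOsc_sum_le {ι : Type*} (i : ℕ) (s : Finset ι) {f : ι → (Fin n → ℝ) → ℂ}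
    (hf : ∀ j, BddMeas (f j)) (x : Fin n → ℝ) :
    dyOsc i (fun y => ∑ j ∈ s, f j y) x ≤ ∑ j ∈ s, dyOsc i (f j) x := by
  classical
  induction s using Finset.induction_on with
  | empty => simp [dyOsc, dyAvg, dyAvgC]
  | insert a s ha ih =>
    simp_rw [Finset.sum_insert ha]
    exact (dyOsc_add_le i (hf a) (bddMeas_sum s hf) x).trans (add_le_add le_rfl ih)

/-- Square function consequence of a bound uniform over signs. -/
theorem sum_lintegral_sq_le_of_signs {X : Type*} [MeasurableSpace X] (μ : Measure X)
    (J : ℕ) (g : ℕ → X → ℂ) (hg : ∀ j, Measurable (g j)) (R B : ℝ≥0∞)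
    (h : ∀ ε : ℕ → ℝ, (∀ j, |ε j| ≤ 1) →
      ∫⁻ x, ‖∑ j ∈ Finset.range J, (ε j : ℂ) * g j x‖ₑ ^ (2:ℝ) ∂μ + R ≤ B) :
    ∑ j ∈ Finset.range J, ∫⁻ x, ‖g j x‖ₑ ^ (2:ℝ) ∂μ + R ≤ B := by
  induction J generalizing R with
  | zero => simpa using h (fun _ => 0) (by simp)
  | succ J ih =>
    rw [Finset.sum_range_succ, add_assoc]
    refine ih _ fun ε hε => ?_
    set a : X → ℂ := fun x => ∑ j ∈ Finset.range J, (ε j : ℂ) * g j x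
    have ha : Measurable a := by
      have := hg
      simp only [a]
      fun_prop
    have hu : ∀ s : ℝ, |s| ≤ 1 → ∫⁻ x, ‖a x + s * g J x‖ₑ ^ (2:ℝ) ∂μ + R ≤ B := by
      intro s hs
      have := h (Function.update ε J s) (fun j => by
        by_cases hj : j = J
        · subst hj; simpa using hs
        · simpa [Function.update_of_ne hj] using hε j)
      refine le_trans (le_of_eq ?_) this
      congr 1
      refine lintegral_congr fun x => ?_
      congr 2
      rw [Finset.sum_range_succ]
      simp only [Function.update_self, a]
      congr 1
      refine Finset.sum_congr rfl fun j hj => ?_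
      rw [Function.update_of_ne (Finset.mem_range.1 hj).ne]
    have h1 := hu 1 (by simp)
    have h2 := hu (-1) (by simp)
    have hpar : ∀ z w : ℂ, ‖z + (1:ℝ) * w‖ₑ ^ (2:ℝ) + ‖z + (-1:ℝ) * w‖ₑ ^ (2:ℝ) =
        2 * (‖z‖ₑ ^ (2:ℝ) + ‖w‖ₑ ^ (2:ℝ)) := by
      intro z w
      have h3 : ∀ u : ℂ, ‖u‖ₑ ^ (2:ℝ) = ENNReal.ofReal (‖u‖ * ‖u‖) := fun u => by
        rw [← ofReal_norm, ENNReal.ofReal_rpow_of_nonneg (norm_nonneg _) (by norm_num)]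
        congr 1; norm_num; ring
      rw [h3, h3, h3, h3, ← ENNReal.ofReal_add (by positivity) (by positivity),
        ← ENNReal.ofReal_add (by positivity) (by positivity),
        show (2:ℝ≥0∞) = ENNReal.ofReal 2 by simp, ← ENNReal.ofReal_mul (by norm_num)]
      congr 1
      have := parallelogram_law_with_norm ℝ z w
      simpa [sub_eq_add_neg, sq] using this
    have h3 : 2 * (∫⁻ x, ‖a x‖ₑ ^ (2:ℝ) ∂μ + (∫⁻ x, ‖g J x‖ₑ ^ (2:ℝ) ∂μ + R)) ≤ 2 * B := by
      calc _ = ∫⁻ x, 2 * (‖a x‖ₑ ^ (2:ℝ) + ‖g J x‖ₑ ^ (2:ℝ)) ∂μ + 2 * R := by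
            have := hg J
            rw [lintegral_const_mul _ (by fun_prop), lintegral_add_left (by fun_prop)]
            ring
        _ = (∫⁻ x, ‖a x + (1:ℝ) * g J x‖ₑ ^ (2:ℝ) ∂μ + R) +
            (∫⁻ x, ‖a x + (-1:ℝ) * g J x‖ₑ ^ (2:ℝ) ∂μ + R) := by
            simp_rw [← hpar]
            have := hg J
            rw [lintegral_add_left (by fun_prop)]
            ring
        _ ≤ 2 * B := by rw [two_mul]; exact add_le_add h1 h2
    exact (ENNReal.mul_le_mul_iff_right (by norm_num) (by norm_num)).1 h3

theorem sum_dist_le (F : ℕ → ℝ≥0∞) (i J : ℕ) :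
    ∑ j ∈ Finset.range J, F ((i - j) + (j - i)) ≤ 2 * ∑' l, F l := by
  rw [← Finset.sum_filter_add_sum_filter_not (Finset.range J) (fun j => j ≤ i), two_mul]
  refine add_le_add ?_ ?_
  · rw [← Finset.sum_image (f := F) (g := fun j => (i - j) + (j - i))]
    · exact ENNReal.sum_le_tsum _
    · intro a ha b hb hab
      simp only [Finset.coe_filter, Finset.mem_range, Set.mem_ofPred_eq] at ha hb hab
      omega
  · rw [← Finset.sum_image (f := F) (g := fun j => (i - j) + (j - i))]
    · exact ENNReal.sum_le_tsum _
    · intro a ha b hb hab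
      simp only [Finset.coe_filter, Finset.mem_range, Set.mem_ofPred_eq] at ha hb hab
      omega

theorem rpow_sum_le_weighted {ι : Type*} (s : Finset ι) {p : ℝ} (hp : 1 < p) (w a : ι → ℝ≥0∞)
    (h0 : ∀ j, w j ≠ 0) (ht : ∀ j, w j ≠ ⊤) :
    (∑ j ∈ s, a j) ^ p ≤ (∑ j ∈ s, w j) ^ (p - 1) * ∑ j ∈ s, w j ^ (1 - p) * a j ^ p := by
  have hp0 : 0 < p := by linarith
  have h := ENNReal.inner_le_weight_mul_Lp_of_nonneg s hp.le w (fun j => (w j)⁻¹ * a j)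
  have e1 : ∀ j, w j * ((w j)⁻¹ * a j) = a j := fun j => by
    rw [← mul_assoc, ENNReal.mul_inv_cancel (h0 j) (ht j), one_mul]
  have e2 : ∀ j, w j * ((w j)⁻¹ * a j) ^ p = w j ^ (1 - p) * a j ^ p := fun j => by
    rw [ENNReal.mul_rpow_of_nonneg _ _ hp0.le, ← mul_assoc, sub_eq_add_neg,
      ENNReal.rpow_add _ _ (h0 j) (ht j), ENNReal.rpow_one, ENNReal.rpow_neg, ENNReal.inv_rpow]
  simp_rw [e1, e2] at h
  have h2 := ENNReal.rpow_le_rpow h hp0.le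
  rw [ENNReal.mul_rpow_of_nonneg _ _ hp0.le, ← ENNReal.rpow_mul, ← ENNReal.rpow_mul,
    inv_mul_cancel₀ hp0.ne', ENNReal.rpow_one] at h2
  convert h2 using 3
  field_simp

/-- Summation of an array whose `l`-th off-diagonals decay geometrically in `L^p`. -/
theorem sum_lintegral_rpow_offdiag_le {X : Type*} [MeasurableSpace X] (μ : Measure X) {p : ℝ}
    (hp : 1 < p) {T : ℝ≥0∞} (hT0 : T ≠ 0) (hTt : T ≠ ⊤) (I J : ℕ) (a : ℕ → ℕ → X → ℝ≥0∞)
    (ha : ∀ i j, Measurable (a i j)) (K : ℝ≥0∞)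
    (h : ∀ l, ∑ q ∈ (Finset.range I ×ˢ Finset.range J).filter
      (fun q => (q.1 - q.2) + (q.2 - q.1) = l), ∫⁻ x, a q.1 q.2 x ^ p ∂μ ≤ (T ^ l) ^ p * K) :
    ∑ i ∈ Finset.range I, ∫⁻ x, (∑ j ∈ Finset.range J, a i j x) ^ p ∂μ ≤
      (2 * (1 - T)⁻¹) ^ (p - 1) * ((1 - T)⁻¹ * K) := by
  have hpow : ∀ l, (T ^ l) ^ (1 - p) * (T ^ l) ^ p = T ^ l := fun l => by
    rw [← ENNReal.rpow_add _ _ (pow_ne_zero _ hT0) (ENNReal.pow_ne_top hTt)]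
    simp
  have h1 : ∀ i, ∫⁻ x, (∑ j ∈ Finset.range J, a i j x) ^ p ∂μ ≤ (2 * (1 - T)⁻¹) ^ (p - 1) *
      ∑ j ∈ Finset.range J, (T ^ ((i - j) + (j - i))) ^ (1 - p) * ∫⁻ x, a i j x ^ p ∂μ := by
    intro i
    have hm : ∀ j, Measurable fun x => a i j x ^ p := fun j => (ha i j).pow_const p
    calc _ ≤ ∫⁻ x, (2 * (1 - T)⁻¹) ^ (p - 1) *
          ∑ j ∈ Finset.range J, (T ^ ((i - j) + (j - i))) ^ (1 - p) * a i j x ^ p ∂μ := by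
          refine lintegral_mono fun x => ?_
          refine (rpow_sum_le_weighted _ hp (fun j => T ^ ((i - j) + (j - i))) _
            (fun j => pow_ne_zero _ hT0) (fun j => ENNReal.pow_ne_top hTt)).trans ?_
          refine mul_le_mul_left (ENNReal.rpow_le_rpow ?_ (by linarith)) _
          refine (sum_dist_le (fun l => T ^ l) i J).trans ?_
          rw [ENNReal.tsum_geometric]
      _ = _ := by
          rw [lintegral_const_mul _ (by fun_prop), lintegral_finsetSum _ (by fun_prop)]
          congr 1
          refine Finset.sum_congr rfl fun j _ => ?_
          rw [lintegral_const_mul _ (hm j)]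
  refine (Finset.sum_le_sum fun i _ => h1 i).trans ?_
  rw [← Finset.mul_sum]
  refine mul_le_mul_right ?_ _
  rw [← Finset.sum_product' (Finset.range I) (Finset.range J)
    (fun i j => (T ^ ((i - j) + (j - i))) ^ (1 - p) * ∫⁻ x, a i j x ^ p ∂μ)]
  rw [← Finset.sum_fiberwise_of_maps_to (t := Finset.range (I + J))
    (g := fun q : ℕ × ℕ => (q.1 - q.2) + (q.2 - q.1))]
  · calc _ ≤ ∑ l ∈ Finset.range (I + J), T ^ l * K := by
          refine Finset.sum_le_sum fun l _ => ?_
          calc _ = (T ^ l) ^ (1 - p) * ∑ q ∈ (Finset.range I ×ˢ Finset.range J).filter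
                (fun q => (q.1 - q.2) + (q.2 - q.1) = l), ∫⁻ x, a q.1 q.2 x ^ p ∂μ := by
                rw [Finset.mul_sum]
                refine Finset.sum_congr rfl fun q hq => ?_
                rw [(Finset.mem_filter.1 hq).2]
            _ ≤ (T ^ l) ^ (1 - p) * ((T ^ l) ^ p * K) := mul_le_mul_right (h l) _
            _ = _ := by rw [← mul_assoc, hpow]
      _ = (∑ l ∈ Finset.range (I + J), T ^ l) * K := by rw [Finset.sum_mul]
      _ ≤ _ := by
          refine mul_le_mul_left ?_ _
          rw [← ENNReal.tsum_geometric]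
          exact ENNReal.sum_le_tsum _
  · intro q hq
    simp only [Finset.mem_product, Finset.mem_range] at hq ⊢
    omega

/-- The integral operator on the torus with kernel `k`. -/
def kerOp (k : (Fin n → ℝ) → (Fin n → ℝ) → ℂ) (f : (Fin n → ℝ) → ℂ) (x : Fin n → ℝ) : ℂ :=
  ∫ y, k x y * f y ∂μT n

/-- Kernels of the normalised dyadic pieces of an exotic pseudo-differential operator. -/
structure KerFam (n : ℕ) (ρ d C : ℝ) (k : ℕ → (Fin n → ℝ) → (Fin n → ℝ) → ℂ) : Prop where
  bddMeas : ∀ j x, BddMeas (k j x)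
  size : ∀ j x, ∫ y, ‖k j x y‖ * (1 + (2:ℝ) ^ ((j:ℝ) * ρ) * ∑ i, chD (x i - y i)) ∂μT n ≤
    C * (2:ℝ) ^ ((j:ℝ) * d)
  l2 : ∀ (J : ℕ) (ε : ℕ → ℝ), (∀ j, |ε j| ≤ 1) → ∀ f, BddMeas f →
    ∫⁻ x, ‖∑ j ∈ Finset.range J, (ε j : ℂ) * kerOp (k j) f x‖ₑ ^ (2:ℝ) ∂μT n ≤
      ENNReal.ofReal (C ^ 2) * ∫⁻ x, ‖f x‖ₑ ^ (2:ℝ) ∂μT n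
  lip : ∀ (j : ℕ) f (M : ℝ), Measurable f → (∀ x, ‖f x‖ ≤ M) → ∀ x x',
    ‖kerOp (k j) f x - kerOp (k j) f x'‖ ≤ C * (2:ℝ) ^ (j:ℝ) * (2:ℝ) ^ ((j:ℝ) * d) * M * ‖x - x'‖

theorem norm_sub_le_of_mem_dyCell {i : ℕ} {x y z : Fin n → ℝ} (hy : y ∈ dyCell i x)
    (hz : z ∈ dyCell i x) : ‖y - z‖ ≤ (1 / 2) ^ i := by
  refine (pi_norm_le_iff_of_nonneg (by positivity)).2 fun k => ?_
  have e : ⌊(2:ℝ) ^ i * y k⌋ = ⌊(2:ℝ) ^ i * z k⌋ :=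
    (congrFun hy k).trans (congrFun hz k).symm
  have h := Int.abs_sub_lt_one_of_floor_eq_floor e
  rw [← mul_sub, abs_mul, abs_of_pos (by positivity)] at h
  rw [Pi.sub_apply, Real.norm_eq_abs, one_div, inv_pow, ← one_div, le_div_iff₀ (by positivity)]
  linarith

section
variable {ρ d C : ℝ} {k : ℕ → (Fin n → ℝ) → (Fin n → ℝ) → ℂ}

theorem kerOp_add {κ : (Fin n → ℝ) → (Fin n → ℝ) → ℂ} (hκ : ∀ x, BddMeas (κ x))
    {f g : (Fin n → ℝ) → ℂ} (hf : BddMeas f) (hg : BddMeas g) :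
    kerOp κ (f + g) = kerOp κ f + kerOp κ g := by
  funext x
  simp only [kerOp, Pi.add_apply, mul_add]
  exact integral_add ((hκ x).mul hf).integrable ((hκ x).mul hg).integrable

theorem bddMeas_weight (L : ℝ) (x : Fin n → ℝ) {κ : (Fin n → ℝ) → ℂ} (hκ : BddMeas κ) :
    Integrable (fun y => ‖κ y‖ * (1 + L * ∑ i, chD (x i - y i))) (μT n) := by
  obtain ⟨hm, M, hM⟩ := hκ
  have hc := continuous_chD
  have hm' : Measurable fun y : Fin n → ℝ => ‖κ y‖ * (1 + L * ∑ i, chD (x i - y i)) := by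
    have : Measurable chD := hc.measurable
    fun_prop
  refine Integrable.of_bound (C := M * (1 + |L| * ∑ i : Fin n, 2)) hm'.aestronglyMeasurable
    (Filter.Eventually.of_forall fun y => ?_)
  rw [norm_mul, norm_norm]
  refine mul_le_mul (hM y) ?_ (norm_nonneg _) ((norm_nonneg _).trans (hM y))
  refine (norm_add_le _ _).trans ?_
  rw [norm_one, norm_mul, Real.norm_eq_abs, Real.norm_eq_abs,
    abs_of_nonneg (Finset.sum_nonneg fun i _ => chD_nonneg _)]
  gcongr
  exact chD_le_two _

theorem KerFam.C_nonneg (hk : KerFam n ρ d C k) : 0 ≤ C := by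
  have := hk.size 0 0
  simp only [Nat.cast_zero, zero_mul, Real.rpow_zero, mul_one, one_mul] at this
  refine le_trans (integral_nonneg fun y => ?_) this
  have : 0 ≤ ∑ i, chD ((0 : Fin n → ℝ) i - y i) := Finset.sum_nonneg fun i _ => chD_nonneg _
  positivity

theorem KerFam.continuous (hk : KerFam n ρ d C k) (j : ℕ) {f : (Fin n → ℝ) → ℂ} (hf : BddMeas f) :
    Continuous (kerOp (k j) f) := by
  obtain ⟨hm, M, hM⟩ := hf
  have hC := hk.C_nonneg
  have hM0 := (norm_nonneg _).trans (hM 0)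
  refine (LipschitzWith.of_dist_le_mul (K := ⟨C * (2:ℝ) ^ (j:ℝ) * (2:ℝ) ^ ((j:ℝ) * d) * M,
    by positivity⟩) fun x x' => ?_).continuous
  rw [dist_eq_norm, dist_eq_norm]
  exact hk.lip j f M hm hM x x'

theorem KerFam.norm_le (hk : KerFam n ρ d C k) (j : ℕ) {f : (Fin n → ℝ) → ℂ} {M : ℝ}
    (hM : ∀ x, ‖f x‖ ≤ M) (x : Fin n → ℝ) :
    ‖kerOp (k j) f x‖ ≤ C * (2:ℝ) ^ ((j:ℝ) * d) * M := by
  have hM0 := (norm_nonneg _).trans (hM 0)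
  refine (norm_integral_le_of_norm_le (g := fun y => ‖k j x y‖ *
    (1 + (2:ℝ) ^ ((j:ℝ) * ρ) * ∑ i, chD (x i - y i)) * M)
    ((bddMeas_weight _ x (hk.bddMeas j x)).mul_const M) (Filter.Eventually.of_forall fun y => ?_)).trans ?_
  · rw [norm_mul]
    have : 0 ≤ ∑ i, chD (x i - y i) := Finset.sum_nonneg fun i _ => chD_nonneg _
    have h2 : 0 ≤ (2:ℝ) ^ ((j:ℝ) * ρ) * ∑ i, chD (x i - y i) := by positivity
    refine mul_le_mul ?_ (hM y) (norm_nonneg _) (by positivity)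
    nlinarith [norm_nonneg (k j x y)]
  · rw [integral_mul_const]
    exact mul_le_mul_of_nonneg_right (hk.size j x) hM0

theorem KerFam.bddMeas_op (hk : KerFam n ρ d C k) (j : ℕ) {f : (Fin n → ℝ) → ℂ} (hf : BddMeas f) :
    BddMeas (kerOp (k j) f) :=
  ⟨(hk.continuous j hf).measurable, _, hk.norm_le j hf.2.choose_spec⟩

theorem KerFam.dyOsc_low (hk : KerFam n ρ d C k) (i j : ℕ) (hji : j ≤ i) {f : (Fin n → ℝ) → ℂ}
    {M : ℝ} (hf : Measurable f) (hM : ∀ x, ‖f x‖ ≤ M) {x : Fin n → ℝ} (hx : x ∈ cube n) :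
    dyOsc i (kerOp (k j) f) x ≤
      ENNReal.ofReal (C * (2:ℝ) ^ ((j:ℝ) * d) * (1 / 2) ^ (i - j) * M) := by
  have hC := hk.C_nonneg
  have hM0 := (norm_nonneg _).trans (hM 0)
  refine dyOsc_le_of_forall i (hk.bddMeas_op j ⟨hf, M, hM⟩) hx fun y hy z hz => ?_
  rw [← ofReal_norm]
  refine ENNReal.ofReal_le_ofReal ((hk.lip j f M hf hM y z).trans ?_)
  have h := norm_sub_le_of_mem_dyCell hy hz
  have e : (2:ℝ) ^ (j:ℝ) * (1 / 2) ^ i = (1 / 2) ^ (i - j) := by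
    rw [Real.rpow_natCast, ← Nat.sub_add_cancel hji, pow_add]
    simp only [Nat.add_sub_cancel]
    rw [mul_left_comm, ← mul_pow]; norm_num
  rw [← e]
  calc C * (2:ℝ) ^ (j:ℝ) * (2:ℝ) ^ ((j:ℝ) * d) * M * ‖y - z‖
      ≤ C * (2:ℝ) ^ (j:ℝ) * (2:ℝ) ^ ((j:ℝ) * d) * M * (1 / 2) ^ i := by gcongr
    _ = _ := by ring

theorem KerFam.l2_finset (hk : KerFam n ρ d C k) (s : Finset ℕ) {f : (Fin n → ℝ) → ℂ}
    (hf : BddMeas f) : ∫⁻ x, ‖∑ j ∈ s, kerOp (k j) f x‖ₑ ^ (2:ℝ) ∂μT n ≤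
      ENNReal.ofReal (C ^ 2) * ∫⁻ x, ‖f x‖ₑ ^ (2:ℝ) ∂μT n := by
  classical
  obtain ⟨J, hJ⟩ := s.exists_nat_subset_range
  refine le_trans (le_of_eq ?_) (hk.l2 J (fun j => if j ∈ s then 1 else 0) (fun j => by
    split_ifs <;> simp) f hf)
  refine lintegral_congr fun x => ?_
  congr 2
  rw [← Finset.sum_subset hJ (fun j _ hj => by simp [hj])]
  exact Finset.sum_congr rfl fun j hj => by simp [hj]

theorem KerFam.dyAvg_high (hk : KerFam n ρ d C k) (hd : d = n * (1 - ρ) / 2)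
    (hρ1 : ρ ≤ 1) (i : ℕ) (s : Finset ℕ) {f : (Fin n → ℝ) → ℂ}
    {M : ℝ} (hf : Measurable f) (hM : ∀ x, ‖f x‖ ≤ M) {x : Fin n → ℝ} (hx : x ∈ cube n) :
    dyAvg i (fun y => ‖∑ j ∈ s, kerOp (k j) f y‖ₑ) x ≤
      ENNReal.ofReal (C * M * (4 ^ n * (2:ℝ) ^ ((i:ℝ) * d) +
        ∑ j ∈ s, (2:ℝ) ^ ((j:ℝ) * d) * (2:ℝ) ^ (-(((j:ℝ) - i) * ρ)))) := by
  have hC := hk.C_nonneg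
  have hM0 := (norm_nonneg _).trans (hM 0)
  set R : ℝ := (2:ℝ) ^ (-((i:ℝ) * ρ)) with hR
  have hR0 : 0 < R := by positivity
  set B : Set (Fin n → ℝ) := {z | ∀ k, chD (x k - z k) ≤ 8 * R} with hB
  have hBm : MeasurableSet B := by
    have : Measurable chD := continuous_chD.measurable
    rw [hB, Set.ofPred_forall]
    exact MeasurableSet.iInter fun k => measurableSet_le (by fun_prop) (by fun_prop)
  have hfb : BddMeas f := ⟨hf, M, hM⟩
  set f1 := B.indicator f with hf1
  set f2 := Bᶜ.indicator f with hf2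
  have hf1b : BddMeas f1 := hfb.indicator hBm
  have hf2b : BddMeas f2 := hfb.indicator hBm.compl
  have hsum : ∀ y, ∑ j ∈ s, kerOp (k j) f y =
      ∑ j ∈ s, kerOp (k j) f1 y + ∑ j ∈ s, kerOp (k j) f2 y := fun y => by
    rw [← Finset.sum_add_distrib]
    refine Finset.sum_congr rfl fun j _ => ?_
    rw [← Pi.add_apply, ← kerOp_add (hk.bddMeas j) hf1b hf2b, Set.indicator_self_add_compl]
  have hg1 : BddMeas fun y => ∑ j ∈ s, kerOp (k j) f1 y :=
    bddMeas_sum s fun j => hk.bddMeas_op j hf1b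
  have hA : dyAvg i (fun y => ‖∑ j ∈ s, kerOp (k j) f1 y‖ₑ) x ≤
      ENNReal.ofReal (C * M * (4 ^ n * (2:ℝ) ^ ((i:ℝ) * d))) := by
    have h1 : dyAvg i (fun y => ‖∑ j ∈ s, kerOp (k j) f1 y‖ₑ) x ^ (2:ℝ) ≤
        ENNReal.ofReal (C * M * (4 ^ n * (2:ℝ) ^ ((i:ℝ) * d))) ^ (2:ℝ) := by
      have := hg1.1
      refine (dyAvg_sq_le i (by fun_prop) hx).trans ?_
      have h2 : ∫⁻ y, ‖f1 y‖ₑ ^ (2:ℝ) ∂μT n ≤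
          ENNReal.ofReal (M ^ 2) * ENNReal.ofReal ((2 * (8 * R)) ^ n) := by
        calc _ ≤ ∫⁻ y, B.indicator (fun _ => ENNReal.ofReal (M ^ 2)) y ∂μT n := by
              refine lintegral_mono fun y => ?_
              by_cases hy : y ∈ B
              · simp only [hf1, Set.indicator_of_mem hy]
                rw [← ofReal_norm, ENNReal.ofReal_rpow_of_nonneg (norm_nonneg _) (by norm_num)]
                refine ENNReal.ofReal_le_ofReal ?_
                rw [Real.rpow_two]
                exact pow_le_pow_left₀ (norm_nonneg _) (hM y) 2
              · simp [hf1, hy]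
          _ ≤ _ := by
              rw [lintegral_indicator_const hBm]
              exact mul_le_mul_right (measure_chD_ball (by positivity) x) _
      calc _ ≤ (2:ℝ≥0∞) ^ (i * n) * ∫⁻ y, ‖∑ j ∈ s, kerOp (k j) f1 y‖ₑ ^ (2:ℝ) ∂μT n := by
            rw [dyAvg]
            exact mul_le_mul_right (setLIntegral_le_lintegral _ _) _
        _ ≤ (2:ℝ≥0∞) ^ (i * n) * (ENNReal.ofReal (C ^ 2) *
            (ENNReal.ofReal (M ^ 2) * ENNReal.ofReal ((2 * (8 * R)) ^ n))) := by
            refine mul_le_mul_right ((hk.l2_finset s hf1b).trans ?_) _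
            exact mul_le_mul_right h2 _
        _ = _ := by
            rw [ENNReal.ofReal_rpow_of_nonneg (by positivity) (by norm_num),
              show (2:ℝ≥0∞) = ENNReal.ofReal 2 by simp, ← ENNReal.ofReal_pow (by norm_num),
              ← ENNReal.ofReal_mul (by positivity), ← ENNReal.ofReal_mul (by positivity),
              ← ENNReal.ofReal_mul (by positivity)]
            congr 1
            have e1 : R ^ n = (2:ℝ) ^ (-((i:ℝ) * ρ * n)) := by
              rw [hR, ← Real.rpow_natCast, ← Real.rpow_mul (by norm_num)]; ring_nf
            have e2 : ((2:ℝ) ^ ((i:ℝ) * d)) ^ 2 = 2 ^ (i * n) * R ^ n := by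
              rw [e1, ← Real.rpow_natCast, ← Real.rpow_natCast, ← Real.rpow_mul (by norm_num),
                ← Real.rpow_add (by norm_num), hd]
              congr 1; push_cast; ring
            have e3 : (2 * (8 * R)) ^ n = 4 ^ n * 4 ^ n * R ^ n := by
              rw [← mul_pow, ← mul_pow]; congr 1; ring
            rw [e3, Real.rpow_two, mul_pow (C * M), mul_pow (4 ^ n), e2]
            ring
    exact (ENNReal.rpow_le_rpow_iff (by norm_num)).1 h1
  have hAB : ∀ j, ∀ y ∈ dyCell i x, ‖kerOp (k j) f2 y‖ ≤
      C * M * ((2:ℝ) ^ ((j:ℝ) * d) * (2:ℝ) ^ (-(((j:ℝ) - i) * ρ))) := by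
    intro j y hy
    have hxx : x ∈ dyCell i x := rfl
    set Q : ℝ := (2:ℝ) ^ (-(((j:ℝ) - i) * ρ)) with hQ
    have hQ0 : 0 < Q := by positivity
    have hQR : Q * ((2:ℝ) ^ ((j:ℝ) * ρ) * R) = 1 := by
      rw [hQ, hR, ← Real.rpow_add (by norm_num), ← Real.rpow_add (by norm_num)]
      rw [← Real.rpow_zero 2]; congr 1; ring
    refine (norm_integral_le_of_norm_le (g := fun z => ‖k j y z‖ *
      (1 + (2:ℝ) ^ ((j:ℝ) * ρ) * ∑ i, chD (y i - z i)) * (M * Q))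
      ((bddMeas_weight _ y (hk.bddMeas j y)).mul_const _)
      (Filter.Eventually.of_forall fun z => ?_)).trans ?_
    · have hs0 : 0 ≤ ∑ i, chD (y i - z i) := Finset.sum_nonneg fun i _ => chD_nonneg _
      by_cases hz : z ∈ B
      · simp only [hf2, Set.indicator_of_notMem (show z ∉ Bᶜ by simpa using hz), mul_zero, norm_zero]
        positivity
      · rw [norm_mul, hf2, Set.indicator_of_mem (show z ∈ Bᶜ from hz), mul_assoc]
        refine mul_le_mul_of_nonneg_left ?_ (norm_nonneg _)
        refine (hM z).trans ?_
        obtain ⟨κ, hκ⟩ : ∃ κ, 8 * R < chD (x κ - z κ) := by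
          simpa [hB] using hz
        have h1 := chD_le_add (x κ - z κ) (y κ - z κ)
        have h2 : chD (x κ - z κ - (y κ - z κ)) ≤ 7 * R := by
          refine (chD_le_mul_abs _).trans ?_
          gcongr
          have h3 := (norm_le_pi_norm (x - y) κ).trans (norm_sub_le_of_mem_dyCell hxx hy)
          rw [Pi.sub_apply, Real.norm_eq_abs] at h3
          rw [show x κ - z κ - (y κ - z κ) = x κ - y κ by ring]
          refine h3.trans ?_
          rw [hR, one_div, inv_pow, ← Real.rpow_natCast, ← Real.rpow_neg (by norm_num)]
          refine Real.rpow_le_rpow_of_exponent_le (by norm_num) ?_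
          have : (0:ℝ) ≤ i := by positivity
          nlinarith
        have h4 : R ≤ ∑ i, chD (y i - z i) := by
          refine le_trans (by linarith : R ≤ chD (y κ - z κ)) ?_
          exact Finset.single_le_sum (f := fun i => chD (y i - z i)) (fun i _ => chD_nonneg _)
            (Finset.mem_univ κ)
        have h5 : 1 ≤ (1 + (2:ℝ) ^ ((j:ℝ) * ρ) * ∑ i, chD (y i - z i)) * Q := by
          have : (2:ℝ) ^ ((j:ℝ) * ρ) * R ≤ (2:ℝ) ^ ((j:ℝ) * ρ) * ∑ i, chD (y i - z i) := by gcongr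
          nlinarith
        nlinarith
    · rw [integral_mul_const]
      calc _ ≤ C * (2:ℝ) ^ ((j:ℝ) * d) * (M * Q) :=
            mul_le_mul_of_nonneg_right (hk.size j y) (by positivity)
        _ = _ := by ring
  calc _ ≤ dyAvg i (fun y => ‖∑ j ∈ s, kerOp (k j) f1 y‖ₑ + ENNReal.ofReal (C * M *
        ∑ j ∈ s, (2:ℝ) ^ ((j:ℝ) * d) * (2:ℝ) ^ (-(((j:ℝ) - i) * ρ)))) x := by
        refine dyAvg_mono i fun y hy => ?_
        rw [hsum]
        refine (enorm_add_le _ _).trans (add_le_add le_rfl ?_)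
        rw [← ofReal_norm]
        refine ENNReal.ofReal_le_ofReal ((norm_sum_le _ _).trans ?_)
        rw [Finset.mul_sum]
        exact Finset.sum_le_sum fun j _ => hAB j y hy
    _ = dyAvg i (fun y => ‖∑ j ∈ s, kerOp (k j) f1 y‖ₑ) x + ENNReal.ofReal (C * M *
        ∑ j ∈ s, (2:ℝ) ^ ((j:ℝ) * d) * (2:ℝ) ^ (-(((j:ℝ) - i) * ρ))) := by
        have := hg1.1
        rw [dyAvg_add i (by fun_prop), dyAvg_const i _ hx]
    _ ≤ _ := by
        rw [mul_add, ENNReal.ofReal_add (by positivity)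
          (mul_nonneg (by positivity) (Finset.sum_nonneg fun j _ => by positivity))]
        exact add_le_add hA le_rfl
end

section
variable {ρ d C : ℝ} {k : ℕ → (Fin n → ℝ) → (Fin n → ℝ) → ℂ}

theorem KerFam.dyOsc_le (hk : KerFam n ρ d C k) (hd : d = n * (1 - ρ) / 2)
    (hρ1 : ρ ≤ 1) {ε : ℝ} (hε1 : ε ≤ 1) (hερ : ε ≤ ρ) (hεd : ε ≤ d) (i j : ℕ)
    {f : (Fin n → ℝ) → ℂ} {M : ℝ} (hf : Measurable f) (hM : ∀ x, ‖f x‖ ≤ M)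
    {x : Fin n → ℝ} (hx : x ∈ cube n) :
    ENNReal.ofReal ((2:ℝ) ^ (-((j:ℝ) * d))) * dyOsc i (kerOp (k j) f) x ≤
      ENNReal.ofReal (2 * (C + 1) * (4 ^ n + 1) *
        (2:ℝ) ^ (-(((i - j) + (j - i) : ℕ) : ℝ) * ε) * M) := by
  have hC := hk.C_nonneg
  have hM0 := (norm_nonneg _).trans (hM 0)
  have hjd : (2:ℝ) ^ (-((j:ℝ) * d)) * (2:ℝ) ^ ((j:ℝ) * d) = 1 := by
    rw [← Real.rpow_add (by norm_num)]; simp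
  have h4 : (1:ℝ) ≤ 4 ^ n := one_le_pow₀ (by norm_num)
  rcases le_or_gt j i with hji | hij
  · refine (mul_le_mul_right (hk.dyOsc_low i j hji hf hM hx) _).trans ?_
    rw [← ENNReal.ofReal_mul (by positivity)]
    refine ENNReal.ofReal_le_ofReal ?_
    rw [show j - i = 0 by omega, add_zero]
    have h1 : ((1:ℝ) / 2) ^ (i - j) ≤ (2:ℝ) ^ (-((i - j : ℕ) : ℝ) * ε) := by
      rw [one_div, inv_pow, ← Real.rpow_natCast, ← Real.rpow_neg (by norm_num)]
      refine Real.rpow_le_rpow_of_exponent_le (by norm_num) ?_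
      have : (0:ℝ) ≤ ((i - j : ℕ) : ℝ) := by positivity
      nlinarith
    calc (2:ℝ) ^ (-((j:ℝ) * d)) * (C * (2:ℝ) ^ ((j:ℝ) * d) * (1 / 2) ^ (i - j) * M)
        = C * ((2:ℝ) ^ (-((j:ℝ) * d)) * (2:ℝ) ^ ((j:ℝ) * d)) * (1 / 2) ^ (i - j) * M := by ring
      _ = C * (1 / 2) ^ (i - j) * M := by rw [hjd, mul_one]
      _ ≤ _ := by
        gcongr
        nlinarith
  · have h1 := hk.dyAvg_high hd hρ1 i {j} hf hM hx
    simp only [Finset.sum_singleton] at h1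
    refine (mul_le_mul_right ((dyOsc_le_two_mul i (hk.bddMeas_op j ⟨hf, M, hM⟩).1 hx).trans
      (mul_le_mul_right h1 2)) _).trans ?_
    rw [show (2:ℝ≥0∞) = ENNReal.ofReal 2 by simp, ← ENNReal.ofReal_mul (by positivity),
      ← ENNReal.ofReal_mul (by positivity)]
    refine ENNReal.ofReal_le_ofReal ?_
    rw [show i - j = 0 by omega, zero_add, Nat.cast_sub hij.le]
    have hl : (0:ℝ) ≤ (j:ℝ) - i := by
      rw [sub_nonneg]; exact_mod_cast hij.le
    have e1 : (2:ℝ) ^ (-((j:ℝ) * d)) * (2:ℝ) ^ ((i:ℝ) * d) ≤ (2:ℝ) ^ (-((j:ℝ) - i) * ε) := by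
      rw [← Real.rpow_add (by norm_num)]
      refine Real.rpow_le_rpow_of_exponent_le (by norm_num) ?_
      nlinarith
    have e2 : (2:ℝ) ^ (-(((j:ℝ) - i) * ρ)) ≤ (2:ℝ) ^ (-((j:ℝ) - i) * ε) := by
      refine Real.rpow_le_rpow_of_exponent_le (by norm_num) ?_
      nlinarith
    set E := (2:ℝ) ^ (-((j:ℝ) - i) * ε)
    have hE : 0 < E := by positivity
    calc (2:ℝ) ^ (-((j:ℝ) * d)) * (2 * (C * M * (4 ^ n * (2:ℝ) ^ ((i:ℝ) * d) +
          (2:ℝ) ^ ((j:ℝ) * d) * (2:ℝ) ^ (-(((j:ℝ) - i) * ρ)))))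
        = 2 * C * M * (4 ^ n * ((2:ℝ) ^ (-((j:ℝ) * d)) * (2:ℝ) ^ ((i:ℝ) * d)) +
          ((2:ℝ) ^ (-((j:ℝ) * d)) * (2:ℝ) ^ ((j:ℝ) * d)) * (2:ℝ) ^ (-(((j:ℝ) - i) * ρ))) := by ring
      _ ≤ 2 * C * M * (4 ^ n * E + 1 * E) := by rw [hjd]; gcongr
      _ = 2 * C * (4 ^ n + 1) * E * M := by ring
      _ ≤ _ := by gcongr; linarith

theorem KerFam.offdiag (hk : KerFam n ρ d C k) (hd : d = n * (1 - ρ) / 2)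
    (hρ1 : ρ ≤ 1) {ε : ℝ} (hε1 : ε ≤ 1) (hερ : ε ≤ ρ) (hεd : ε ≤ d) {p : ℝ} (hp : 2 < p)
    (I J l : ℕ) {f : (Fin n → ℝ) → ℂ} (hf : BddMeas f) :
    ∑ q ∈ (Finset.range I ×ˢ Finset.range J).filter (fun q => (q.1 - q.2) + (q.2 - q.1) = l),
      ∫⁻ x, (ENNReal.ofReal ((2:ℝ) ^ (-((q.2:ℝ) * (d * (p - 2) / p)))) *
        dyOsc q.1 (kerOp (k q.2) f) x) ^ p ∂μT n ≤
    ENNReal.ofReal (4 * p * (2 * (2 * (C + 1) * (4 ^ n + 1) * (2:ℝ) ^ (-(l:ℝ) * ε))) ^ (p - 2) /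
      (p - 2)) * (ENNReal.ofReal (8 * C ^ 2)) * ∫⁻ x, ‖f x‖ₑ ^ p ∂μT n := by
  have hC := hk.C_nonneg
  have hp0 : 0 < p := by linarith
  set s := (Finset.range I ×ˢ Finset.range J).filter (fun q => (q.1 - q.2) + (q.2 - q.1) = l)
    with hs
  set G : ℕ × ℕ → ((Fin n → ℝ) → ℂ) → (Fin n → ℝ) → ℝ≥0∞ := fun q f => (cube n).indicator fun x =>
    ENNReal.ofReal ((2:ℝ) ^ (-((q.2:ℝ) * d))) * dyOsc q.1 (kerOp (k q.2) f) x with hG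
  have hGm : ∀ q f, Measurable (G q f) := fun q f =>
    ((measurable_dyOsc q.1 _).const_mul _).indicator measurableSet_cube
  have key := marcinkiewicz_two_top (μT n) hp
    (A := 2 * (C + 1) * (4 ^ n + 1) * (2:ℝ) ^ (-(l:ℝ) * ε)) (by positivity)
    (ENNReal.ofReal (8 * C ^ 2)) s (fun q => ENNReal.ofReal ((2:ℝ) ^ (2 * ((q.2:ℝ) * d)))) G
    (fun q _ f _ => hGm q f) ?_ ?_ ?_ f hf
  · refine le_trans (Finset.sum_le_sum fun q _ => le_of_eq ?_) key
    rw [← lintegral_const_mul _ ((hGm q f).pow_const p)]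
    refine lintegral_congr_ae ?_
    filter_upwards [ae_mem_cube] with x hx
    simp only [hG, Set.indicator_of_mem hx]
    rw [ENNReal.mul_rpow_of_nonneg _ _ hp0.le, ENNReal.mul_rpow_of_nonneg _ _ hp0.le, ← mul_assoc]
    congr 1
    rw [ENNReal.ofReal_rpow_of_pos (by positivity), ENNReal.ofReal_rpow_of_pos (by positivity),
      ← ENNReal.ofReal_mul (by positivity), ← Real.rpow_mul (by norm_num),
      ← Real.rpow_mul (by norm_num), ← Real.rpow_add (by norm_num)]
    congr 2
    field_simp
    ring
  · intro q _ f g hf hg x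
    simp only [hG]
    by_cases hx : x ∈ cube n
    · simp only [Set.indicator_of_mem hx]
      rw [← mul_add, kerOp_add (hk.bddMeas _) hf hg]
      exact mul_le_mul_right (dyOsc_add_le _ (hk.bddMeas_op _ hf) (hk.bddMeas_op _ hg) x) _
    · simp [hx]
  · intro q hq f hf M hM0 hM x
    simp only [hG]
    by_cases hx : x ∈ cube n
    · simp only [Set.indicator_of_mem hx]
      refine (hk.dyOsc_le hd hρ1 hε1 hερ hεd q.1 q.2 hf hM hx).trans (le_of_eq ?_)
      rw [(Finset.mem_filter.1 hq).2]
    · simp [hx]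
  · intro f hf t ht
    have h1 : ∀ q, ENNReal.ofReal ((2:ℝ) ^ (2 * ((q.2:ℝ) * d))) *
        μT n {x | ENNReal.ofReal t < G q f x} ≤ ENNReal.ofReal (t ^ (-2:ℝ)) *
          (4 * ∫⁻ x, ‖kerOp (k q.2) f x‖ₑ ^ (2:ℝ) ∂μT n) := by
      intro q
      have hT : (ENNReal.ofReal t) ^ (2:ℝ) ≠ 0 := by simp [ht]
      have hT' : (ENNReal.ofReal t) ^ (2:ℝ) ≠ ⊤ := by simp
      have h2 : μT n {x | ENNReal.ofReal t < G q f x} ≤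
          ENNReal.ofReal (t ^ (-2:ℝ)) * ∫⁻ x, G q f x ^ (2:ℝ) ∂μT n := by
        have h3 := mul_meas_ge_le_lintegral (μ := μT n) ((hGm q f).pow_const (2:ℝ))
          ((ENNReal.ofReal t) ^ (2:ℝ))
        have h4 : μT n {x | ENNReal.ofReal t < G q f x} ≤
            μT n {x | (ENNReal.ofReal t) ^ (2:ℝ) ≤ G q f x ^ (2:ℝ)} :=
          measure_mono fun x hx => ENNReal.rpow_le_rpow (le_of_lt hx) (by norm_num)
        have h5 := (mul_le_mul_right h4 ((ENNReal.ofReal t) ^ (2:ℝ))).trans h3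
        rw [Real.rpow_neg ht.le, ENNReal.ofReal_inv_of_pos (by positivity),
          ← ENNReal.ofReal_rpow_of_pos ht]
        rwa [← ENNReal.mul_le_iff_le_inv hT hT']
      refine (mul_le_mul_right h2 _).trans ?_
      rw [mul_left_comm]
      refine mul_le_mul_right ?_ _
      have hSm := (hk.bddMeas_op q.2 hf).1
      calc _ = ∫⁻ x, ENNReal.ofReal ((2:ℝ) ^ (2 * ((q.2:ℝ) * d))) * G q f x ^ (2:ℝ) ∂μT n := by
            rw [lintegral_const_mul _ ((hGm q f).pow_const (2:ℝ))]
        _ ≤ ∫⁻ x, 4 * (dyAvg q.1 (fun y => ‖kerOp (k q.2) f y‖ₑ) x) ^ (2:ℝ) ∂μT n := by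
            refine lintegral_mono_ae ?_
            filter_upwards [ae_mem_cube] with x hx
            simp only [hG, Set.indicator_of_mem hx]
            have e : ENNReal.ofReal ((2:ℝ) ^ (2 * ((q.2:ℝ) * d))) *
                ENNReal.ofReal ((2:ℝ) ^ (-((q.2:ℝ) * d))) ^ (2:ℝ) = 1 := by
              rw [ENNReal.ofReal_rpow_of_pos (by positivity), ← Real.rpow_mul (by norm_num),
                ← ENNReal.ofReal_mul (by positivity), ← Real.rpow_add (by norm_num)]
              rw [show 2 * ((q.2:ℝ) * d) + -((q.2:ℝ) * d) * 2 = 0 by ring]; simp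
            rw [ENNReal.mul_rpow_of_nonneg _ _ (by norm_num), ← mul_assoc, e, one_mul]
            refine (ENNReal.rpow_le_rpow (dyOsc_le_two_mul _ hSm hx) (by norm_num)).trans ?_
            rw [ENNReal.mul_rpow_of_nonneg _ _ (by norm_num)]
            refine mul_le_mul_left (le_of_eq ?_) _
            rw [ENNReal.rpow_two]; norm_num
        _ ≤ _ := by
            rw [lintegral_const_mul _ ((measurable_dyAvg _ _).pow_const _)]
            refine mul_le_mul_right ?_ _
            exact lintegral_dyAvg_sq_le _ (by fun_prop)
    refine (Finset.sum_le_sum fun q _ => h1 q).trans ?_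
    rw [← Finset.mul_sum, ← Finset.mul_sum]
    have h2 : ∑ q ∈ s, ∫⁻ x, ‖kerOp (k q.2) f x‖ₑ ^ (2:ℝ) ∂μT n ≤
        2 * ∑ j ∈ Finset.range J, ∫⁻ x, ‖kerOp (k j) f x‖ₑ ^ (2:ℝ) ∂μT n := by
      rw [← Finset.sum_fiberwise_of_maps_to (t := Finset.range J) (g := fun q : ℕ × ℕ => q.2)
        (fun q hq => by simp [hs] at hq ⊢; omega), Finset.mul_sum]
      refine Finset.sum_le_sum fun j _ => ?_
      rw [Finset.sum_congr rfl (g := fun _ => ∫⁻ x, ‖kerOp (k j) f x‖ₑ ^ (2:ℝ) ∂μT n)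
        (fun q hq => by rw [(Finset.mem_filter.1 hq).2]), Finset.sum_const, nsmul_eq_mul]
      refine mul_le_mul_left ?_ _
      have hsub : s.filter (fun q => q.2 = j) ⊆ {(j + l, j), (j - l, j)} := by
        intro q hq
        simp only [hs, Finset.mem_filter, Finset.mem_insert, Finset.mem_singleton,
          Prod.ext_iff] at hq ⊢
        omega
      exact_mod_cast (Finset.card_le_card hsub).trans Finset.card_le_two
    have h3 : ∑ j ∈ Finset.range J, ∫⁻ x, ‖kerOp (k j) f x‖ₑ ^ (2:ℝ) ∂μT n ≤
        ENNReal.ofReal (C ^ 2) * ∫⁻ x, ‖f x‖ₑ ^ (2:ℝ) ∂μT n := by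
      have := sum_lintegral_sq_le_of_signs (μT n) J (fun j => kerOp (k j) f)
        (fun j => (hk.bddMeas_op j hf).1) 0 _ (fun ε hε => by
          rw [add_zero]; exact hk.l2 J ε hε f hf)
      simpa using this
    calc _ ≤ ENNReal.ofReal (t ^ (-2:ℝ)) * (4 * (2 * (ENNReal.ofReal (C ^ 2) *
          ∫⁻ x, ‖f x‖ₑ ^ (2:ℝ) ∂μT n))) := by
          refine mul_le_mul_right (mul_le_mul_right (h2.trans (mul_le_mul_right h3 _)) _) _
      _ = _ := by
          rw [ENNReal.ofReal_mul (by norm_num : (0:ℝ) ≤ 8)]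
          rw [show ENNReal.ofReal 8 = 4 * 2 by norm_num]
          ring
end

/-- The weighted sum of the dyadic pieces. -/
def kerSum (k : ℕ → (Fin n → ℝ) → (Fin n → ℝ) → ℂ) (m : ℝ) (J : ℕ) (f : (Fin n → ℝ) → ℂ)
    (x : Fin n → ℝ) : ℂ :=
  ∑ j ∈ Finset.range J, (((2:ℝ) ^ (-((j:ℝ) * m)) : ℝ) : ℂ) * kerOp (k j) f x

theorem dySharp_le_of_forall {N : ℕ} {g : (Fin n → ℝ) → ℂ} {x : Fin n → ℝ} {c : ℝ≥0∞}
    (h : ∀ i ≤ N, dyOsc i g x ≤ c) : dySharp N g x ≤ c :=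
  Finset.sup_le fun i hi => h i (by simpa [Nat.lt_succ_iff] using hi)

theorem lintegral_dySharp_le (p : ℝ) (N : ℕ) (g : (Fin n → ℝ) → ℂ) :
    ∫⁻ x, dySharp N g x ^ p ∂μT n ≤ ∑ i ∈ Finset.range (N + 1), ∫⁻ x, dyOsc i g x ^ p ∂μT n := by
  rw [← lintegral_finsetSum _ fun i _ => (measurable_dyOsc i g).pow_const p]
  refine lintegral_mono fun x => ?_
  obtain ⟨i, hi, h⟩ := Finset.exists_mem_eq_sup (Finset.range (N + 1)) (by simp)
    (fun i => dyOsc i g x)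
  simp only [dySharp]
  rw [h]
  exact Finset.single_le_sum (f := fun i => dyOsc i g x ^ p) (fun _ _ => zero_le) hi

theorem sum_half_pow_dist_le (i J : ℕ) :
    ∑ j ∈ Finset.range J, ((1:ℝ) / 2) ^ ((i - j) + (j - i)) ≤ 4 := by
  have h := sum_dist_le (fun l => ENNReal.ofReal (((1:ℝ) / 2) ^ l)) i J
  rw [← ENNReal.ofReal_sum_of_nonneg (fun j _ => by positivity),
    ← ENNReal.ofReal_tsum_of_nonneg (fun l => by positivity) summable_geometric_two,
    tsum_geometric_two, show (2:ℝ≥0∞) = ENNReal.ofReal 2 by simp,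
    ← ENNReal.ofReal_mul (by norm_num), ENNReal.ofReal_le_ofReal_iff (by norm_num)] at h
  linarith

section
variable {ρ d C : ℝ} {k : ℕ → (Fin n → ℝ) → (Fin n → ℝ) → ℂ}

theorem KerFam.bddMeas_const_mul_op (hk : KerFam n ρ d C k) (m : ℝ) (j : ℕ)
    {f : (Fin n → ℝ) → ℂ} (hf : BddMeas f) :
    BddMeas fun x => (((2:ℝ) ^ (-((j:ℝ) * m)) : ℝ) : ℂ) * kerOp (k j) f x :=
  (hk.bddMeas_op j hf).const_mul _

theorem KerFam.bddMeas_kerSum (hk : KerFam n ρ d C k) (m : ℝ) (J : ℕ)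
    {f : (Fin n → ℝ) → ℂ} (hf : BddMeas f) : BddMeas (kerSum k m J f) :=
  bddMeas_sum _ fun j => hk.bddMeas_const_mul_op m j hf

theorem KerFam.l2_kerSum (hk : KerFam n ρ d C k) {m : ℝ} (hm : 0 ≤ m) (J : ℕ)
    {f : (Fin n → ℝ) → ℂ} (hf : BddMeas f) :
    ∫⁻ x, ‖kerSum k m J f x‖ₑ ^ (2:ℝ) ∂μT n ≤
      ENNReal.ofReal (C ^ 2) * ∫⁻ x, ‖f x‖ₑ ^ (2:ℝ) ∂μT n :=
  hk.l2 J _ (fun j => by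
    rw [abs_of_pos (by positivity)]
    refine Real.rpow_le_one_of_one_le_of_nonpos (by norm_num) ?_
    have : (0:ℝ) ≤ j := by positivity
    nlinarith) f hf

theorem kernel_sharp_of_lt (hρ0 : 0 < ρ) (hρ1 : ρ < 1) (hn : 1 ≤ n) (hd : d = n * (1 - ρ) / 2)
    {p : ℝ} (hp : 2 < p) (C : ℝ) : ∃ D : ℝ≥0∞, D ≠ ⊤ ∧ ∀ k, KerFam n ρ d C k → ∀ (J N : ℕ) f,
      BddMeas f → ∫⁻ x, dySharp N (kerSum k (d * (p - 2) / p) J f) x ^ p ∂μT n ≤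
        D * ∫⁻ x, ‖f x‖ₑ ^ p ∂μT n := by
  have hp0 : 0 < p := by linarith
  have hd0 : 0 < d := by
    have : (1:ℝ) ≤ n := by exact_mod_cast hn
    have : 0 < 1 - ρ := by linarith
    rw [hd]; positivity
  set ε := min 1 (min ρ d) with hε
  have hε0 : 0 < ε := lt_min one_pos (lt_min hρ0 hd0)
  have hε1 : ε ≤ 1 := min_le_left _ _
  have hερ : ε ≤ ρ := (min_le_right _ _).trans (min_le_left _ _)
  have hεd : ε ≤ d := (min_le_right _ _).trans (min_le_right _ _)
  set τ : ℝ := (2:ℝ) ^ (-(ε * (p - 2) / p)) with hτ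
  have hτ0 : 0 < τ := by positivity
  have hτ1 : τ < 1 := by
    refine Real.rpow_lt_one_of_one_lt_of_neg (by norm_num) ?_
    have : 0 < p - 2 := by linarith
    simp only [neg_neg_iff_pos]
    positivity
  set T := ENNReal.ofReal τ with hT
  set A₀ : ℝ := 2 * (2 * (C + 1) * (4 ^ n + 1)) with hA₀
  refine ⟨(2 * (1 - T)⁻¹) ^ (p - 1) * ((1 - T)⁻¹ * (ENNReal.ofReal (4 * p * A₀ ^ (p - 2) /
      (p - 2)) * ENNReal.ofReal (8 * C ^ 2))), ?_, fun k hk J N f hf => ?_⟩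
  · have h1 : (1 - T)⁻¹ ≠ ⊤ := by
      rw [ENNReal.inv_ne_top]
      refine (tsub_pos_of_lt ?_).ne'
      rw [hT, ← ENNReal.ofReal_one]
      exact (ENNReal.ofReal_lt_ofReal_iff one_pos).2 hτ1
    refine ENNReal.mul_ne_top (ENNReal.rpow_ne_top_of_nonneg (by linarith)
      (ENNReal.mul_ne_top (by norm_num) h1)) (ENNReal.mul_ne_top h1
      (ENNReal.mul_ne_top ENNReal.ofReal_ne_top ENNReal.ofReal_ne_top))
  have hC := hk.C_nonneg
  set m := d * (p - 2) / p with hm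
  refine (lintegral_dySharp_le p N _).trans ?_
  have h1 := sum_lintegral_rpow_offdiag_le (μT n) (show 1 < p by linarith) (T := T)
    (by rw [hT]; simpa using hτ0) ENNReal.ofReal_ne_top (N + 1) J
    (fun i j x => ENNReal.ofReal ((2:ℝ) ^ (-((j:ℝ) * m))) * dyOsc i (kerOp (k j) f) x)
    (fun i j => (measurable_dyOsc i _).const_mul _)
    (ENNReal.ofReal (4 * p * A₀ ^ (p - 2) / (p - 2)) * ENNReal.ofReal (8 * C ^ 2) *
      ∫⁻ x, ‖f x‖ₑ ^ p ∂μT n) (fun l => by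
        refine (hk.offdiag hd hρ1.le hε1 hερ hεd hp (N + 1) J l hf).trans (le_of_eq ?_)
        have hA : 2 * (2 * (C + 1) * (4 ^ n + 1) * (2:ℝ) ^ (-(l:ℝ) * ε)) =
            A₀ * (2:ℝ) ^ (-(l:ℝ) * ε) := by rw [hA₀]; ring
        have h2 : ((2:ℝ) ^ (-(l:ℝ) * ε)) ^ (p - 2) = (τ ^ l) ^ p := by
          rw [hτ, ← Real.rpow_natCast, ← Real.rpow_mul (by norm_num), ← Real.rpow_mul (by positivity),
            ← Real.rpow_mul (by norm_num)]
          congr 1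
          field_simp
        have h3 : ENNReal.ofReal (4 * p * (A₀ * (2:ℝ) ^ (-(l:ℝ) * ε)) ^ (p - 2) / (p - 2)) =
            (T ^ l) ^ p * ENNReal.ofReal (4 * p * A₀ ^ (p - 2) / (p - 2)) := by
          rw [hT, ← ENNReal.ofReal_pow hτ0.le, ENNReal.ofReal_rpow_of_pos (by positivity),
            ← ENNReal.ofReal_mul (by positivity),
            Real.mul_rpow (by positivity) (by positivity), h2]
          congr 1; ring
        rw [hA, h3]
        ring)
  refine le_trans ?_ (h1.trans (le_of_eq (by ring)))
  refine Finset.sum_le_sum fun i _ => lintegral_mono fun x => ENNReal.rpow_le_rpow ?_ hp0.le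
  refine (dyOsc_sum_le i _ (fun j => hk.bddMeas_const_mul_op m j hf) x).trans
    (Finset.sum_le_sum fun j _ => ?_)
  rw [dyOsc_const_mul _ _ _ (hk.bddMeas_op j hf).1]
  refine mul_le_mul_left (le_of_eq ?_) _
  rw [← ofReal_norm, Complex.norm_real, Real.norm_of_nonneg (by positivity)]

theorem KerFam.dySharp_le_of_one (hk : KerFam n 1 0 C k) (J N : ℕ)
    {f : (Fin n → ℝ) → ℂ} {M : ℝ} (hf : Measurable f) (hM : ∀ x, ‖f x‖ ≤ M)
    {x : Fin n → ℝ} (hx : x ∈ cube n) :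
    dySharp N (kerSum k 0 J f) x ≤ ENNReal.ofReal ((C + 1) * (12 + 2 * 4 ^ n) * M) := by
  have hC := hk.C_nonneg
  have hM0 := (norm_nonneg _).trans (hM 0)
  have hfb : BddMeas f := ⟨hf, M, hM⟩
  refine dySharp_le_of_forall fun i _ => ?_
  have e : kerSum k 0 J f = (fun y => ∑ j ∈ (Finset.range J).filter (fun j => j ≤ i),
      kerOp (k j) f y) + fun y => ∑ j ∈ (Finset.range J).filter (fun j => ¬ j ≤ i),
      kerOp (k j) f y := by
    funext y
    rw [Pi.add_apply, Finset.sum_filter_add_sum_filter_not]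
    simp [kerSum]
  have hb : ∀ s : Finset ℕ, BddMeas fun y => ∑ j ∈ s, kerOp (k j) f y := fun s =>
    bddMeas_sum s fun j => hk.bddMeas_op j hfb
  rw [e]
  refine (dyOsc_add_le i (hb _) (hb _) x).trans ?_
  have h1 : dyOsc i (fun y => ∑ j ∈ (Finset.range J).filter (fun j => j ≤ i),
      kerOp (k j) f y) x ≤ ENNReal.ofReal (C * M * 4) := by
    refine (dyOsc_sum_le i _ (fun j => hk.bddMeas_op j hfb) x).trans ?_
    calc _ ≤ ∑ j ∈ (Finset.range J).filter (fun j => j ≤ i),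
          ENNReal.ofReal (C * M * (1 / 2) ^ ((i - j) + (j - i))) := by
          refine Finset.sum_le_sum fun j hj => ?_
          have hji := (Finset.mem_filter.1 hj).2
          refine (hk.dyOsc_low i j hji hf hM hx).trans (ENNReal.ofReal_le_ofReal (le_of_eq ?_))
          rw [show j - i = 0 by omega]
          simp; ring
      _ ≤ ∑ j ∈ Finset.range J, ENNReal.ofReal (C * M * (1 / 2) ^ ((i - j) + (j - i))) :=
          Finset.sum_le_sum_of_subset (Finset.filter_subset _ _)
      _ ≤ _ := by
          rw [← ENNReal.ofReal_sum_of_nonneg (fun j _ => by positivity), ← Finset.mul_sum]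
          refine ENNReal.ofReal_le_ofReal ?_
          gcongr
          exact sum_half_pow_dist_le i J
  have h2 : dyOsc i (fun y => ∑ j ∈ (Finset.range J).filter (fun j => ¬ j ≤ i),
      kerOp (k j) f y) x ≤ ENNReal.ofReal (2 * (C * M * (4 ^ n + 4))) := by
    refine (dyOsc_le_two_mul i (hb _).1 hx).trans ?_
    rw [ENNReal.ofReal_mul (by norm_num), show ENNReal.ofReal 2 = 2 by simp]
    refine mul_le_mul_right ((hk.dyAvg_high (by simp) le_rfl i _ hf hM hx).trans
      (ENNReal.ofReal_le_ofReal ?_)) _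
    gcongr
    · simp
    · calc _ = ∑ j ∈ (Finset.range J).filter (fun j => ¬ j ≤ i),
            ((1:ℝ) / 2) ^ ((i - j) + (j - i)) := by
            refine Finset.sum_congr rfl fun j hj => ?_
            have hji : i ≤ j := by have := (Finset.mem_filter.1 hj).2; omega
            rw [mul_zero, Real.rpow_zero, one_mul, mul_one, show i - j = 0 by omega, zero_add,
              ← Nat.cast_sub hji, Real.rpow_neg (by norm_num), Real.rpow_natCast, one_div, inv_pow]
        _ ≤ ∑ j ∈ Finset.range J, ((1:ℝ) / 2) ^ ((i - j) + (j - i)) :=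
            Finset.sum_le_sum_of_subset_of_nonneg (Finset.filter_subset _ _)
              fun j _ _ => by positivity
        _ ≤ 4 := sum_half_pow_dist_le i J
  refine (add_le_add h1 h2).trans ?_
  rw [← ENNReal.ofReal_add (by positivity) (by positivity)]
  refine ENNReal.ofReal_le_ofReal ?_
  have : 0 ≤ (12 + 2 * (4:ℝ) ^ n) * M := by positivity
  nlinarith

theorem kernel_sharp_of_one {p : ℝ} (hp : 2 < p) (C : ℝ) : ∃ D : ℝ≥0∞, D ≠ ⊤ ∧
    ∀ k, KerFam n 1 0 C k → ∀ (J N : ℕ) f,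
      BddMeas f → ∫⁻ x, dySharp N (kerSum k 0 J f) x ^ p ∂μT n ≤
        D * ∫⁻ x, ‖f x‖ₑ ^ p ∂μT n := by
  refine ⟨ENNReal.ofReal (4 * p * (2 * ((C + 1) * (12 + 2 * 4 ^ n))) ^ (p - 2) / (p - 2)) *
    ENNReal.ofReal (4 * C ^ 2), ENNReal.mul_ne_top ENNReal.ofReal_ne_top ENNReal.ofReal_ne_top,
    fun k hk J N f hf => ?_⟩
  have hC := hk.C_nonneg
  have hGm : ∀ f, Measurable ((cube n).indicator (dySharp N (kerSum k 0 J f))) := fun f =>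
    (measurable_dySharp N _).indicator measurableSet_cube
  have key := marcinkiewicz_two_top (μT n) hp (A := (C + 1) * (12 + 2 * 4 ^ n)) (by positivity)
    (ENNReal.ofReal (4 * C ^ 2)) (Finset.univ : Finset Unit) (fun _ => 1)
    (fun _ f => (cube n).indicator (dySharp N (kerSum k 0 J f))) (fun _ _ f _ => hGm f)
    ?_ ?_ ?_ f hf
  · simp only [Finset.univ_unique, one_mul, Finset.sum_singleton] at key
    refine le_trans (le_of_eq (lintegral_congr_ae ?_)) key
    filter_upwards [ae_mem_cube] with x hx
    simp only [Set.indicator_of_mem hx]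
  · intro _ _ f g hf hg x
    by_cases hx : x ∈ cube n
    · simp only [Set.indicator_of_mem hx]
      have e : kerSum k 0 J (f + g) = kerSum k 0 J f + kerSum k 0 J g := by
        funext y
        simp only [kerSum, kerOp_add (hk.bddMeas _) hf hg, Pi.add_apply, mul_add,
          Finset.sum_add_distrib]
      rw [e]
      refine dySharp_le_of_forall fun i hi => ?_
      refine (dyOsc_add_le i (hk.bddMeas_kerSum 0 J hf) (hk.bddMeas_kerSum 0 J hg) x).trans ?_
      have hi' : i ∈ Finset.range (N + 1) := by simp; omega
      exact add_le_add (Finset.le_sup (f := fun i => dyOsc i (kerSum k 0 J f) x) hi')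
        (Finset.le_sup (f := fun i => dyOsc i (kerSum k 0 J g) x) hi')
    · simp [hx]
  · intro _ _ f hf M hM0 hM x
    by_cases hx : x ∈ cube n
    · simp only [Set.indicator_of_mem hx]
      exact hk.dySharp_le_of_one J N hf hM hx
    · simp [hx]
  · intro f hf t ht
    simp only [Finset.univ_unique, one_mul, Finset.sum_singleton]
    set g := kerSum k 0 J f with hg
    have hgm : Measurable g := (hk.bddMeas_kerSum 0 J hf).1
    have h1 := dyadic_maximal_weak (n := n) 0 N (φ := fun y => ‖g y‖ₑ ^ (2:ℝ)) (by fun_prop)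
      (S := Set.univ) (fun x y _ => by simp) (ENNReal.ofReal (t ^ 2 / 4))
    rw [Measure.restrict_univ] at h1
    have h2 : μT n {x | ENNReal.ofReal t < (cube n).indicator (dySharp N g) x} ≤
        μT n {x | x ∈ Set.univ ∧ ∃ k, 0 ≤ k ∧ k ≤ N ∧ ENNReal.ofReal (t ^ 2 / 4) <
          dyAvg k (fun y => ‖g y‖ₑ ^ (2:ℝ)) x} := by
      refine measure_mono fun x hx => ?_
      simp only [Set.mem_ofPred_eq] at hx ⊢
      have hxc : x ∈ cube n := by
        by_contra h
        simp [h] at hx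
      rw [Set.indicator_of_mem hxc, dySharp, Finset.lt_sup_iff] at hx
      obtain ⟨i, hi, hx⟩ := hx
      refine ⟨trivial, i, Nat.zero_le _, by simpa [Nat.lt_succ_iff] using hi, ?_⟩
      have h3 := hx.trans_le (dyOsc_le_two_mul i hgm hxc)
      have h4 := ENNReal.rpow_lt_rpow h3 (show (0:ℝ) < 2 by norm_num)
      rw [ENNReal.mul_rpow_of_nonneg _ _ (by norm_num), ENNReal.ofReal_rpow_of_pos ht] at h4
      have h5 := h4.trans_le (mul_le_mul_right (dyAvg_sq_le i (φ := fun y => ‖g y‖ₑ) (by fun_prop) hxc) _)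
      rw [show (2:ℝ≥0∞) ^ (2:ℝ) = 4 by rw [ENNReal.rpow_two]; norm_num] at h5
      rw [ENNReal.ofReal_div_of_pos (by norm_num), show ENNReal.ofReal 4 = 4 by norm_num]
      rw [Real.rpow_two] at h5
      exact ENNReal.div_lt_of_lt_mul' h5
    have h3 := ((mul_le_mul_right h2 _).trans h1).trans (hk.l2_kerSum le_rfl J hf)
    rw [ENNReal.mul_le_iff_le_inv (by simpa using pow_pos ht 2) ENNReal.ofReal_ne_top] at h3
    refine h3.trans (le_of_eq ?_)
    rw [← mul_assoc, ← ENNReal.ofReal_inv_of_pos (by positivity),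
      ← ENNReal.ofReal_mul (by positivity), ← ENNReal.ofReal_mul (by positivity)]
    congr 2
    rw [Real.rpow_neg ht.le, Real.rpow_two]
    field_simp

/-- `L^p` bounds, `p ≥ 2`, for sums of the dyadic pieces at the critical order. -/
theorem kernel_Lp (hρ0 : 0 < ρ) (hρ1 : ρ ≤ 1) (hn : 1 ≤ n) (hd : d = n * (1 - ρ) / 2)
    {p : ℝ} (hp : 2 ≤ p) (C : ℝ) : ∃ D : ℝ≥0∞, D ≠ ⊤ ∧ ∀ k, KerFam n ρ d C k → ∀ (J : ℕ) f,
      BddMeas f → ∫⁻ x, ‖kerSum k (d * (p - 2) / p) J f x‖ₑ ^ p ∂μT n ≤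
        D * ∫⁻ x, ‖f x‖ₑ ^ p ∂μT n := by
  rcases hp.eq_or_lt with rfl | hp
  · refine ⟨ENNReal.ofReal (C ^ 2), ENNReal.ofReal_ne_top, fun k hk J f hf => ?_⟩
    exact hk.l2_kerSum (by simp) J hf
  have hp0 : 0 < p := by linarith
  obtain ⟨D, hD, H⟩ : ∃ D : ℝ≥0∞, D ≠ ⊤ ∧ ∀ k, KerFam n ρ d C k → ∀ (J N : ℕ) f,
      BddMeas f → ∫⁻ x, dySharp N (kerSum k (d * (p - 2) / p) J f) x ^ p ∂μT n ≤
        D * ∫⁻ x, ‖f x‖ₑ ^ p ∂μT n := by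
    rcases hρ1.eq_or_lt with rfl | h
    · obtain rfl : d = 0 := by simpa using hd
      simp only [zero_mul, zero_div]
      exact kernel_sharp_of_one hp C
    · exact kernel_sharp_of_lt hρ0 h hn hd hp C
  refine ⟨2 ^ (p - 1) * ((ENNReal.ofReal (2 ^ p * p / (p - 1)) * 2 ^ n) ^ p * D +
    ENNReal.ofReal (C ^ 2) ^ (p / 2)), ?_, fun k hk J f hf => ?_⟩
  · refine ENNReal.mul_ne_top (ENNReal.rpow_ne_top_of_nonneg (by linarith) (by norm_num))
      (ENNReal.add_ne_top.2 ⟨ENNReal.mul_ne_top (ENNReal.rpow_ne_top_of_nonneg hp0.le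
        (ENNReal.mul_ne_top ENNReal.ofReal_ne_top (by finiteness))) hD,
        ENNReal.rpow_ne_top_of_nonneg (by positivity) ENNReal.ofReal_ne_top⟩)
  have hm0 : 0 ≤ d * (p - 2) / p := by
    have : 0 ≤ d := by
      have : 0 ≤ 1 - ρ := by linarith
      rw [hd]; positivity
    have : 0 ≤ p - 2 := by linarith
    positivity
  set m := d * (p - 2) / p
  have hb := hk.bddMeas_kerSum m J hf
  have hc : Continuous (kerSum k m J f) :=
    continuous_finsetSum _ fun j _ => continuous_const.mul (hk.continuous j hf)
  refine (fefferman_stein (by linarith) hb hc (fun N => H k hk J N f hf)).trans ?_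
  rw [mul_assoc, add_mul, mul_assoc _ D]
  refine mul_le_mul_right (add_le_add le_rfl ?_) _
  have hgm := hb.1
  have hfm := hf.1
  calc (∫⁻ x, ‖kerSum k m J f x‖ₑ ∂μT n) ^ p
      = ((∫⁻ x, ‖kerSum k m J f x‖ₑ ∂μT n) ^ (2:ℝ)) ^ (p / 2) := by
        rw [← ENNReal.rpow_mul]; congr 1; ring
    _ ≤ (ENNReal.ofReal (C ^ 2) * ∫⁻ x, ‖f x‖ₑ ^ (2:ℝ) ∂μT n) ^ (p / 2) := by
        refine ENNReal.rpow_le_rpow ?_ (by positivity)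
        exact (rpow_lintegral_le _ (by norm_num) (by fun_prop)).trans (hk.l2_kerSum hm0 J hf)
    _ ≤ _ := by
        rw [ENNReal.mul_rpow_of_nonneg _ _ (by positivity)]
        refine mul_le_mul_right ?_ _
        refine (rpow_lintegral_le _ (by linarith) (by fun_prop)).trans (le_of_eq ?_)
        refine lintegral_congr fun x => ?_
        rw [← ENNReal.rpow_mul]; congr 1; ring
end

open scoped ComplexConjugate

/-- The adjoint kernel. -/
def adjK (K : (Fin n → ℝ) → (Fin n → ℝ) → ℂ) (x y : Fin n → ℝ) : ℂ := conj (K y x)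

/-- Bounded, jointly measurable kernels. -/
def BddKer (K : (Fin n → ℝ) → (Fin n → ℝ) → ℂ) : Prop := BddMeas (Function.uncurry K)

theorem BddKer.adj {K : (Fin n → ℝ) → (Fin n → ℝ) → ℂ} (hK : BddKer K) : BddKer (adjK K) := by
  obtain ⟨hm, M, hM⟩ := hK
  refine ⟨?_, M, fun z => ?_⟩
  · exact Complex.continuous_conj.measurable.comp (hm.comp measurable_swap)
  · simpa [Function.uncurry, adjK] using hM (z.2, z.1)

theorem BddKer.bddMeas {K : (Fin n → ℝ) → (Fin n → ℝ) → ℂ} (hK : BddKer K) (x : Fin n → ℝ) :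
    BddMeas (K x) := by
  obtain ⟨hm, M, hM⟩ := hK
  exact ⟨hm.comp measurable_prodMk_left, M, fun y => hM (x, y)⟩

theorem BddKer.bddMeas_op {K : (Fin n → ℝ) → (Fin n → ℝ) → ℂ} (hK : BddKer K)
    {f : (Fin n → ℝ) → ℂ} (hf : BddMeas f) : BddMeas (kerOp K f) := by
  obtain ⟨hm, M, hM⟩ := hK
  obtain ⟨hfm, A, hA⟩ := hf
  refine ⟨?_, M * A, fun x => ?_⟩
  · have : Measurable (Function.uncurry fun x y => K x y * f y) :=
      hm.mul (hfm.comp measurable_snd)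
    exact (this.stronglyMeasurable.integral_prod_right (ν := μT n)).measurable
  · have h := norm_integral_le_of_norm_le_const (μ := μT n) (C := M * A)
      (f := fun y => K x y * f y) (Filter.Eventually.of_forall fun y => by
        rw [norm_mul]
        exact mul_le_mul (hM (x, y)) (hA y) (norm_nonneg _) ((norm_nonneg _).trans (hM (x, y))))
    simpa [kerOp] using h

theorem integral_kerOp_adj {K : (Fin n → ℝ) → (Fin n → ℝ) → ℂ} (hK : BddKer K)
    {f g : (Fin n → ℝ) → ℂ} (hf : BddMeas f) (hg : BddMeas g) :
    ∫ x, conj (g x) * kerOp (adjK K) f x ∂μT n = ∫ y, conj (kerOp K g y) * f y ∂μT n := by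
  have hinteg : Integrable (Function.uncurry fun x y => conj (g x) * (adjK K x y * f y))
      ((μT n).prod (μT n)) := by
    have h1 : BddMeas (Function.uncurry fun x y : Fin n → ℝ => conj (g x) * (adjK K x y * f y)) := by
      obtain ⟨hgm, A, hA⟩ := hg
      obtain ⟨hfm, B, hB⟩ := hf
      refine BddMeas.mul ⟨?_, A, fun z => by simpa using hA z.1⟩
        (BddMeas.mul hK.adj ⟨hfm.comp measurable_snd, B, fun z => hB z.2⟩)
      exact Complex.continuous_conj.measurable.comp (hgm.comp measurable_fst)
    exact h1.integrable
  calc _ = ∫ x, ∫ y, conj (g x) * (adjK K x y * f y) ∂μT n ∂μT n := by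
        refine integral_congr_ae (Filter.Eventually.of_forall fun x => ?_)
        simp only [kerOp, integral_const_mul]
    _ = ∫ y, ∫ x, conj (g x) * (adjK K x y * f y) ∂μT n ∂μT n := integral_integral_swap hinteg
    _ = _ := by
        refine integral_congr_ae (Filter.Eventually.of_forall fun y => ?_)
        simp only [kerOp]
        rw [← integral_conj, ← integral_mul_const]
        refine integral_congr_ae (Filter.Eventually.of_forall fun x => ?_)
        simp only [adjK, map_mul]; ring

theorem lintegral_kerOp_adj_le {K : (Fin n → ℝ) → (Fin n → ℝ) → ℂ} (hK : BddKer K) {p q : ℝ}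
    (hpq : p.HolderConjugate q) {D : ℝ≥0∞}
    (h : ∀ f, BddMeas f → ∫⁻ x, ‖kerOp K f x‖ₑ ^ q ∂μT n ≤ D * ∫⁻ x, ‖f x‖ₑ ^ q ∂μT n)
    {f : (Fin n → ℝ) → ℂ} (hf : BddMeas f) :
    ∫⁻ x, ‖kerOp (adjK K) f x‖ₑ ^ p ∂μT n ≤ D ^ (p / q) * ∫⁻ x, ‖f x‖ₑ ^ p ∂μT n := by
  have hp1 := hpq.lt
  have hp0 : 0 < p := by linarith
  have hq0 : 0 < q := hpq.symm.pos
  set u := kerOp (adjK K) f with hu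
  have hub : BddMeas u := hK.adj.bddMeas_op hf
  set g : (Fin n → ℝ) → ℂ := fun x => ((‖u x‖ ^ (p - 2) : ℝ) : ℂ) * u x with hg
  have hgn : ∀ x, ‖g x‖ = ‖u x‖ ^ (p - 1) := fun x => by
    rw [hg]
    simp only [norm_mul, Complex.norm_real, Real.norm_eq_abs]
    rw [abs_of_nonneg (by positivity)]
    rcases eq_or_ne ‖u x‖ 0 with h0 | h0
    · rw [h0, mul_zero, Real.zero_rpow (by linarith)]
    · rw [show p - 1 = (p - 2) + 1 by ring, Real.rpow_add_one h0]
  have hgb : BddMeas g := by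
    obtain ⟨hm, M, hM⟩ := hub
    refine ⟨?_, M ^ (p - 1), fun x => ?_⟩
    · exact (Complex.measurable_ofReal.comp (hm.norm.pow_const _)).mul hm
    · rw [hgn]; exact Real.rpow_le_rpow (norm_nonneg _) (hM x) (by linarith)
  set A := ∫⁻ x, ‖u x‖ₑ ^ p ∂μT n with hA
  have hAt : A ≠ ⊤ := by
    obtain ⟨hm, M, hM⟩ := hub
    refine ne_top_of_le_ne_top (ENNReal.rpow_ne_top_of_nonneg hp0.le (ENNReal.ofReal_ne_top (r := M))) ?_
    calc A ≤ ∫⁻ x, ENNReal.ofReal M ^ p ∂μT n := by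
          refine lintegral_mono fun x => ENNReal.rpow_le_rpow ?_ hp0.le
          rw [← ofReal_norm]; exact ENNReal.ofReal_le_ofReal (hM x)
      _ = _ := by simp
  have hgA : ∫⁻ x, ‖g x‖ₑ ^ q ∂μT n = A := by
    refine lintegral_congr fun x => ?_
    rw [← ofReal_norm, hgn, ← ofReal_norm, ENNReal.ofReal_rpow_of_nonneg (by positivity) hq0.le,
      ENNReal.ofReal_rpow_of_nonneg (by positivity) hp0.le, ← Real.rpow_mul (by positivity)]
    congr 2
    have := hpq.symm.sub_one_mul_conj
    have := hpq.sub_one_mul_conj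
    linarith
  have h1 : A ≤ ∫⁻ y, ‖f y‖ₑ * ‖kerOp K g y‖ₑ ∂μT n := by
    have e : A = ‖∫ x, conj (g x) * u x ∂μT n‖ₑ := by
      have e1 : ∀ x, conj (g x) * u x = ((‖u x‖ ^ p : ℝ) : ℂ) := fun x => by
        simp only [hg, map_mul, Complex.conj_ofReal]
        rw [mul_assoc, ← Complex.normSq_eq_conj_mul_self, Complex.normSq_eq_norm_sq,
          ← Complex.ofReal_mul]
        congr 1
        rcases eq_or_ne ‖u x‖ 0 with h0 | h0
        · rw [h0, Real.zero_rpow hp0.ne']; simp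
        · rw [← Real.rpow_natCast, ← Real.rpow_add (by positivity)]
          congr 1; push_cast; ring
      simp_rw [e1]
      rw [integral_complex_ofReal, ← ofReal_norm, Complex.norm_real,
        Real.norm_of_nonneg (integral_nonneg fun x => by positivity),
        ofReal_integral_eq_lintegral_ofReal ?_ (Filter.Eventually.of_forall fun x => by positivity)]
      · refine lintegral_congr fun x => ?_
        rw [← ofReal_norm, ENNReal.ofReal_rpow_of_nonneg (by positivity) hp0.le]
      · obtain ⟨hm, M, hM⟩ := hub
        refine Integrable.of_bound (C := M ^ p) (hm.norm.pow_const p).aestronglyMeasurable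
          (Filter.Eventually.of_forall fun x => ?_)
        rw [Real.norm_of_nonneg (by positivity)]
        exact Real.rpow_le_rpow (norm_nonneg _) (hM x) hp0.le
    rw [e, hu, integral_kerOp_adj hK hf hgb]
    refine (enorm_integral_le_lintegral_enorm _).trans (le_of_eq ?_)
    refine lintegral_congr fun y => ?_
    rw [enorm_mul, mul_comm, RCLike.enorm_conj]
  have hfm := hf.1
  have hKg := (hK.bddMeas_op hgb).1
  have h2 := h1.trans (ENNReal.lintegral_mul_le_Lp_mul_Lq (μT n) hpq
    (f := fun y => ‖f y‖ₑ) (g := fun y => ‖kerOp K g y‖ₑ) (by fun_prop) (by fun_prop))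
  have h3 : A ≤ (∫⁻ x, ‖f x‖ₑ ^ p ∂μT n) ^ (1 / p) * (D * A) ^ (1 / q) := by
    refine h2.trans (mul_le_mul_right (ENNReal.rpow_le_rpow ?_ (by positivity)) _)
    rw [← hgA]
    exact h g hgb
  rcases eq_or_ne A 0 with h0 | h0
  · rw [h0]; exact zero_le
  have h4 : A ^ (1 / p) ≤ (∫⁻ x, ‖f x‖ₑ ^ p ∂μT n) ^ (1 / p) * D ^ (1 / q) := by
    rw [ENNReal.mul_rpow_of_nonneg _ _ (by positivity), ← mul_assoc] at h3
    have e : A = A ^ (1 / p) * A ^ (1 / q) := by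
      rw [← ENNReal.rpow_add _ _ h0 hAt]
      have := hpq.inv_add_inv_eq_one
      rw [one_div, one_div, this, ENNReal.rpow_one]
    nth_rewrite 1 [e] at h3
    refine (ENNReal.mul_le_mul_iff_left ?_ ?_).1 h3
    · simp [h0, hAt]
    · exact ENNReal.rpow_ne_top_of_nonneg (by positivity) hAt
  have h5 := ENNReal.rpow_le_rpow h4 hp0.le
  rw [← ENNReal.rpow_mul, one_div_mul_cancel hp0.ne', ENNReal.rpow_one,
    ENNReal.mul_rpow_of_nonneg _ _ hp0.le, ← ENNReal.rpow_mul, one_div_mul_cancel hp0.ne',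
    ENNReal.rpow_one, ← ENNReal.rpow_mul, mul_comm] at h5
  convert h5 using 2
  congr 1; ring

theorem eChar_zero (x : Fin n → ℝ) : eChar x 0 = 1 := by simp [eChar]

theorem eChar_add (x : Fin n → ℝ) (ξ η : Fin n → ℤ) :
    eChar x (ξ + η) = eChar x ξ * eChar x η := by
  simp only [eChar, ← Complex.exp_add, ← mul_add, ← Finset.sum_add_distrib, Pi.add_apply]
  push_cast; rfl

theorem eChar_add_left (x y : Fin n → ℝ) (ξ : Fin n → ℤ) :
    eChar (x + y) ξ = eChar x ξ * eChar y ξ := by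
  simp only [eChar, ← Complex.exp_add, ← mul_add, ← Finset.sum_add_distrib, Pi.add_apply]
  push_cast; congr 3; ext j; ring

theorem norm_eChar (x : Fin n → ℝ) (ξ : Fin n → ℤ) : ‖eChar x ξ‖ = 1 := by
  have : eChar x ξ = Complex.exp ((2 * π * ∑ j, x j * ξ j : ℝ) * Complex.I) := by
    rw [eChar]; push_cast; congr 1; ring
  rw [this, Complex.norm_exp_ofReal_mul_I]

theorem conj_eChar (x : Fin n → ℝ) (ξ : Fin n → ℤ) : conj (eChar x ξ) = eChar x (-ξ) := by
  simp only [eChar, ← Complex.exp_conj, map_mul, map_sum, Complex.conj_ofReal, Complex.conj_I,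
    Pi.neg_apply]
  push_cast
  simp [Complex.conj_ofNat]

theorem eChar_neg_left (x : Fin n → ℝ) (ξ : Fin n → ℤ) : eChar (-x) ξ = eChar x (-ξ) := by
  simp [eChar]

theorem contDiff_eChar (ξ : Fin n → ℤ) : ContDiff ℝ (⊤ : ℕ∞) fun x : Fin n → ℝ => eChar x ξ := by
  unfold eChar
  refine ContDiff.cexp (contDiff_const.mul (ContDiff.sum fun i _ => ContDiff.mul ?_ contDiff_const))
  exact Complex.ofRealCLM.contDiff.comp (contDiff_apply ℝ ℝ i)

theorem per_eChar (ξ : Fin n → ℤ) : Per fun x : Fin n → ℝ => eChar x ξ := by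
  intro x v
  simp only [eChar_add_left]
  have : eChar (fun j => (v j : ℝ)) ξ = 1 := by
    rw [eChar, Complex.exp_eq_one_iff]
    exact ⟨∑ j, v j * ξ j, by push_cast; ring⟩
  rw [this, mul_one]

theorem fc_eq (f : (Fin n → ℝ) → ℂ) (ξ : Fin n → ℤ) :
    fc f ξ = ∫ x, eChar x (-ξ) * f x ∂μT n := by
  simp [fc, eChar]

theorem continuous_eChar (ξ : Fin n → ℤ) : Continuous fun x : Fin n → ℝ => eChar x ξ :=
  (contDiff_eChar ξ).continuous

theorem bddMeas_eChar (ξ : Fin n → ℤ) : BddMeas fun x : Fin n → ℝ => eChar x ξ :=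
  ⟨(continuous_eChar ξ).measurable, 1, fun x => (norm_eChar x ξ).le⟩

section Torus
local instance : MeasureSpace UnitAddCircle := ⟨AddCircle.haarAddCircle⟩
local instance : Measure.IsAddHaarMeasure (volume : Measure UnitAddCircle) :=
  inferInstanceAs (Measure.IsAddHaarMeasure AddCircle.haarAddCircle)
local instance : IsProbabilityMeasure (volume : Measure UnitAddCircle) :=
  inferInstanceAs (IsProbabilityMeasure AddCircle.haarAddCircle)

/-- Representative in the unit cube of a point of the torus. -/
def torusRep (t : UnitAddTorus (Fin n)) : Fin n → ℝ := fun i => (AddCircle.equivIco 1 0 (t i) : ℝ)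

theorem measurable_torusRep : Measurable (torusRep (n := n)) :=
  measurable_pi_lambda _ fun i => measurable_subtype_coe.comp
    ((AddCircle.measurableEquivIco 1 0).measurable.comp (measurable_pi_apply i))

theorem torusRep_coe {x : Fin n → ℝ} (hx : x ∈ cube n) :
    torusRep (fun i => ((x i : ℝ) : UnitAddCircle)) = x := by
  ext i
  have := hx i (Set.mem_univ i)
  exact AddCircle.equivIco_coe_of_mem (p := (1:ℝ)) (a := 0) (by simpa using this)

theorem restrict_Ioc_box : (volume : Measure (Fin n → ℝ)).restrict
    {x | ∀ i, x i ∈ Set.Ioc ((0 : Fin n → ℝ) i) ((0 : Fin n → ℝ) i + 1)} = μT n := by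
  refine Measure.restrict_congr_set ?_
  have h1 := Measure.univ_pi_Ioc_ae_eq_Icc (μ := fun _ : Fin n => (volume : Measure ℝ))
    (f := fun _ => 0) (g := fun _ => 1)
  have h2 := Measure.univ_pi_Ico_ae_eq_Icc (μ := fun _ : Fin n => (volume : Measure ℝ))
    (f := fun _ => 0) (g := fun _ => 1)
  have h3 := h1.trans h2.symm
  rw [← volume_pi] at h3
  have e : {x : Fin n → ℝ | ∀ i, x i ∈ Set.Ioc ((0 : Fin n → ℝ) i) ((0 : Fin n → ℝ) i + 1)} =
      Set.univ.pi fun _ => Set.Ioc (0:ℝ) 1 := by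
    ext x; simp [Set.mem_pi]
  rw [e]; exact h3

theorem lintegral_torus (f : UnitAddTorus (Fin n) → ℝ≥0∞) :
    ∫⁻ t, f t = ∫⁻ x, f (fun i => (x i : UnitAddCircle)) ∂μT n := by
  rw [UnitAddTorus.lintegral_preimage f 0, restrict_Ioc_box]

theorem integral_torus (f : UnitAddTorus (Fin n) → ℂ) :
    ∫ t, f t = ∫ x, f (fun i => (x i : UnitAddCircle)) ∂μT n := by
  rw [UnitAddTorus.integral_preimage f 0, restrict_Ioc_box]

theorem mFourier_coe (ξ : Fin n → ℤ) (x : Fin n → ℝ) :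
    UnitAddTorus.mFourier ξ (fun i => (x i : UnitAddCircle)) = eChar x ξ := by
  simp only [UnitAddTorus.mFourier, ContinuousMap.coe_mk, fourier_coe_apply, eChar,
    ← Complex.exp_sum, Finset.mul_sum]
  congr 1; refine Finset.sum_congr rfl fun i _ => ?_
  push_cast; ring

theorem tsum_fc_sq {g : (Fin n → ℝ) → ℂ} (hg : BddMeas g) :
    ∑' ξ, ‖fc g ξ‖ₑ ^ (2:ℝ) = ∫⁻ x, ‖g x‖ₑ ^ (2:ℝ) ∂μT n := by
  obtain ⟨hm, M, hM⟩ := hg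
  set G : UnitAddTorus (Fin n) → ℂ := fun t => g (torusRep t) with hG
  have hGm : Measurable G := hm.comp measurable_torusRep
  have hGL : MemLp G 2 volume :=
    MemLp.of_bound hGm.aestronglyMeasurable M (Filter.Eventually.of_forall fun t => hM _)
  have hc : ∀ ξ, UnitAddTorus.mFourierCoeff (hGL.toLp G) ξ = fc g ξ := fun ξ => by
    rw [fc_eq, UnitAddTorus.mFourierCoeff]
    calc _ = ∫ t, UnitAddTorus.mFourier (-ξ) t • G t := by
          refine integral_congr_ae ?_
          filter_upwards [hGL.coeFn_toLp] with t ht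
          rw [ht]
      _ = _ := by
          rw [integral_torus]
          refine integral_congr_ae ?_
          filter_upwards [ae_mem_cube] with x hx
          rw [mFourier_coe, hG]
          simp only [torusRep_coe hx, smul_eq_mul]
  have h := UnitAddTorus.hasSum_sq_mFourierCoeff (hGL.toLp G)
  simp only [hc] at h
  have h2 : ∫ t, ‖(hGL.toLp G) t‖ ^ 2 = ∫ t, ‖G t‖ ^ 2 := by
    refine integral_congr_ae ?_
    filter_upwards [hGL.coeFn_toLp] with t ht
    rw [ht]
  rw [h2] at h
  have e : ∀ z : ℂ, ‖z‖ₑ ^ (2:ℝ) = ENNReal.ofReal (‖z‖ ^ 2) := fun z => by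
    rw [← ofReal_norm, ENNReal.ofReal_rpow_of_nonneg (norm_nonneg _) (by norm_num)]; norm_num
  simp_rw [e]
  rw [← ENNReal.ofReal_tsum_of_nonneg (fun _ => by positivity) h.summable, h.tsum_eq,
    ofReal_integral_eq_lintegral_ofReal, lintegral_torus]
  · refine lintegral_congr_ae ?_
    filter_upwards [ae_mem_cube] with x hx
    rw [hG]; simp only [torusRep_coe hx]
  · exact (hGL.integrable_norm_pow (by norm_num))
  · exact Filter.Eventually.of_forall fun t => by positivity

theorem Per.torusRep_coe {f : (Fin n → ℝ) → ℂ} (hf : Per f) (x : Fin n → ℝ) :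
    f (torusRep (fun i => ((x i : ℝ) : UnitAddCircle))) = f x := by
  have h : ∀ i, ∃ m : ℤ, torusRep (fun i => ((x i : ℝ) : UnitAddCircle)) i = x i + m := fun i => by
    refine ⟨-⌊x i⌋, ?_⟩
    have := AddCircle.coe_equivIco_mk_apply (p := (1:ℝ)) (x := x i)
    simp only [div_one, mul_one] at this
    rw [torusRep]
    refine this.trans ?_
    rw [Int.fract]; push_cast; ring
  choose m hm using h
  rw [← hf x m]
  congr 1
  ext i; rw [hm i]; rfl

theorem Per.integral_add {f : (Fin n → ℝ) → ℂ} (hf : Per f) (h : Fin n → ℝ) :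
    ∫ x, f (x + h) ∂μT n = ∫ x, f x ∂μT n := by
  set F : UnitAddTorus (Fin n) → ℂ := fun t => f (torusRep t) with hF
  have e1 : ∫ x, f x ∂μT n = ∫ t, F t := by
    rw [integral_torus]
    refine integral_congr_ae (Filter.Eventually.of_forall fun x => ?_)
    exact (hf.torusRep_coe x).symm
  have e2 : ∫ x, f (x + h) ∂μT n = ∫ t, F (t + fun i => (h i : UnitAddCircle)) := by
    rw [integral_torus]
    refine integral_congr_ae (Filter.Eventually.of_forall fun x => ?_)
    simp only [hF]
    rw [← hf.torusRep_coe (x + h)]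
    congr 2
  rw [e1, e2, integral_add_right_eq_self]
end Torus

theorem fc_eChar_mul (f : (Fin n → ℝ) → ℂ) (η ξ : Fin n → ℤ) :
    fc (fun x => eChar x η * f x) ξ = fc f (ξ - η) := by
  rw [fc_eq, fc_eq]
  congr 1; ext x
  rw [← mul_assoc, ← eChar_add]
  congr 2; abel

theorem fc_sum {ι : Type*} (s : Finset ι) {f : ι → (Fin n → ℝ) → ℂ} (hf : ∀ i ∈ s, BddMeas (f i))
    (ξ : Fin n → ℤ) : fc (fun x => ∑ i ∈ s, f i x) ξ = ∑ i ∈ s, fc (f i) ξ := by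
  simp only [fc_eq, Finset.mul_sum]
  rw [integral_finsetSum]
  exact fun i hi => ((bddMeas_eChar (-ξ)).mul (hf i hi)).integrable

theorem fc_const_mul (c : ℂ) (f : (Fin n → ℝ) → ℂ) (ξ : Fin n → ℤ) :
    fc (fun x => c * f x) ξ = c * fc f ξ := by
  rw [fc_eq, fc_eq, ← integral_const_mul]
  congr 1; ext x; ring

theorem fc_one (ξ : Fin n → ℤ) : fc (fun _ : Fin n → ℝ => 1) ξ = if ξ = 0 then 1 else 0 := by
  split_ifs with h
  · subst h; rw [fc_eq]; simp [eChar_zero]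
  · obtain ⟨i, hi⟩ := Function.ne_iff.1 h
    have h1 := (per_eChar (-ξ)).integral_add (Pi.single i (1 / (2 * (ξ i : ℝ))))
    have hi' : (ξ i : ℂ) ≠ 0 := by simpa using hi
    have : eChar (Pi.single i (1 / (2 * (ξ i : ℝ)))) (-ξ) = -1 := by
      rw [eChar, Finset.sum_eq_single i (by intro j _ hj; simp [hj]) (by simp)]
      simp only [Pi.single_eq_same, Pi.neg_apply]
      rw [show 2 * (π:ℂ) * Complex.I * (((1 / (2 * (ξ i : ℝ)) : ℝ) : ℂ) * ((-ξ i : ℤ) : ℂ)) =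
        -(π * Complex.I) by push_cast; field_simp, Complex.exp_neg, Complex.exp_pi_mul_I]
      norm_num
    simp only [eChar_add_left, this, mul_neg_one, integral_neg] at h1
    rw [fc_eq]; simp only [mul_one]
    have h2 : (2:ℂ) * ∫ x, eChar x (-ξ) ∂μT n = 0 := by linear_combination -h1
    simpa using h2

theorem lintegral_sum_eChar_sq (F : Finset (Fin n → ℤ)) (c : (Fin n → ℤ) → ℂ) :
    ∫⁻ x, ‖∑ ξ ∈ F, c ξ * eChar x ξ‖ₑ ^ (2:ℝ) ∂μT n = ∑ ξ ∈ F, ‖c ξ‖ₑ ^ (2:ℝ) := by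
  have hb : ∀ ξ, BddMeas fun x => c ξ * eChar x ξ := fun ξ => (bddMeas_eChar ξ).const_mul (c ξ)
  have hs := bddMeas_sum F hb
  rw [← tsum_fc_sq (g := fun x => ∑ ξ ∈ F, c ξ * eChar x ξ) hs]
  have e : ∀ η, fc (fun x => ∑ ξ ∈ F, c ξ * eChar x ξ) η = if η ∈ F then c η else 0 := fun η => by
    rw [fc_sum F (fun ξ _ => hb ξ)]
    have : ∀ ξ, fc (fun x => c ξ * eChar x ξ) η = if η = ξ then c ξ else 0 := fun ξ => by
      rw [fc_const_mul]
      have := fc_eChar_mul (fun _ => 1) ξ η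
      simp only [mul_one] at this
      rw [this, fc_one]
      simp [sub_eq_zero]
    simp [this]
  simp_rw [e]
  rw [tsum_eq_sum (s := F)]
  · exact Finset.sum_congr rfl fun ξ hξ => by simp [hξ]
  · intro ξ hξ; simp [hξ]

/-- Smooth periodic functions. -/
structure SmoothPer (f : (Fin n → ℝ) → ℂ) : Prop where
  smooth : ContDiff ℝ (⊤ : ℕ∞) f
  per : Per f

/-- Iterated partial derivative along a word. -/
def pdw (u : List (Fin n)) (f : (Fin n → ℝ) → ℂ) : (Fin n → ℝ) → ℂ := u.foldr pd f

/-- Iterated difference along a word. -/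
def ddw (v : List (Fin n)) (g : (Fin n → ℤ) → ℂ) : (Fin n → ℤ) → ℂ := v.foldr dd g

theorem pdw_nil (f : (Fin n → ℝ) → ℂ) : pdw [] f = f := rfl
theorem pdw_cons (k : Fin n) (u : List (Fin n)) (f : (Fin n → ℝ) → ℂ) :
    pdw (k :: u) f = pd k (pdw u f) := rfl
theorem pdw_append (u u' : List (Fin n)) (f : (Fin n → ℝ) → ℂ) :
    pdw (u ++ u') f = pdw u (pdw u' f) := List.foldr_append
theorem ddw_nil (g : (Fin n → ℤ) → ℂ) : ddw [] g = g := rfl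
theorem ddw_cons (k : Fin n) (v : List (Fin n)) (g : (Fin n → ℤ) → ℂ) :
    ddw (k :: v) g = dd k (ddw v g) := rfl
theorem ddw_append (v v' : List (Fin n)) (g : (Fin n → ℤ) → ℂ) :
    ddw (v ++ v') g = ddw v (ddw v' g) := List.foldr_append

theorem smooth_pd {f : (Fin n → ℝ) → ℂ} (hf : ContDiff ℝ (⊤ : ℕ∞) f) (k : Fin n) :
    ContDiff ℝ (⊤ : ℕ∞) (pd k f) :=
  (hf.fderiv_right (m := (⊤ : ℕ∞)) (by simp)).clm_apply contDiff_const

theorem smooth_pdw {f : (Fin n → ℝ) → ℂ} (hf : ContDiff ℝ (⊤ : ℕ∞) f) (u : List (Fin n)) :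
    ContDiff ℝ (⊤ : ℕ∞) (pdw u f) := by
  induction u with
  | nil => exact hf
  | cons k u ih => exact smooth_pd ih k

theorem differentiable_of_smooth {f : (Fin n → ℝ) → ℂ} (hf : ContDiff ℝ (⊤ : ℕ∞) f) :
    Differentiable ℝ f := hf.differentiable (by simp)

theorem pd_add {f g : (Fin n → ℝ) → ℂ} (hf : ContDiff ℝ (⊤ : ℕ∞) f) (hg : ContDiff ℝ (⊤ : ℕ∞) g)
    (k : Fin n) : pd k (fun x => f x + g x) = fun x => pd k f x + pd k g x := by
  ext x
  simp only [pd]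
  rw [fderiv_fun_add (differentiable_of_smooth hf x) (differentiable_of_smooth hg x)]; rfl

theorem pd_const_mul {f : (Fin n → ℝ) → ℂ} (hf : ContDiff ℝ (⊤ : ℕ∞) f) (c : ℂ)
    (k : Fin n) : pd k (fun x => c * f x) = fun x => c * pd k f x := by
  ext x
  simp only [pd]
  rw [fderiv_const_mul (differentiable_of_smooth hf x)]; rfl

theorem pd_mul {f g : (Fin n → ℝ) → ℂ} (hf : ContDiff ℝ (⊤ : ℕ∞) f) (hg : ContDiff ℝ (⊤ : ℕ∞) g)
    (k : Fin n) : pd k (fun x => f x * g x) = fun x => pd k f x * g x + f x * pd k g x := by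
  ext x
  simp only [pd]
  rw [fderiv_fun_mul (differentiable_of_smooth hf x) (differentiable_of_smooth hg x)]
  simp; ring

theorem pd_comm {f : (Fin n → ℝ) → ℂ} (hf : ContDiff ℝ (⊤ : ℕ∞) f) (k l : Fin n) :
    pd k (pd l f) = pd l (pd k f) := by
  ext x
  have hs : IsSymmSndFDerivAt ℝ f x := hf.contDiffAt.isSymmSndFDerivAt (by
    simp only [minSmoothness_of_isRCLikeNormedField]; exact WithTop.coe_le_coe.2 le_top)
  have h1 : DifferentiableAt ℝ (fderiv ℝ f) x :=
    ((hf.fderiv_right (m := (⊤ : ℕ∞)) (by simp)).differentiable (by simp)) x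
  have h2 : ∀ k l : Fin n, pd k (pd l f) x =
      fderiv ℝ (fderiv ℝ f) x (Pi.single k 1) (Pi.single l 1) := fun k l => by
    change fderiv ℝ (fun y => fderiv ℝ f y (Pi.single l 1)) x (Pi.single k 1) = _
    rw [fderiv_clm_apply h1 (differentiableAt_const _)]
    simp
  rw [h2, h2]; exact hs _ _

theorem pdw_add {f g : (Fin n → ℝ) → ℂ} (hf : ContDiff ℝ (⊤ : ℕ∞) f) (hg : ContDiff ℝ (⊤ : ℕ∞) g)
    (u : List (Fin n)) : pdw u (fun x => f x + g x) = fun x => pdw u f x + pdw u g x := by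
  induction u with
  | nil => rfl
  | cons k u ih => rw [pdw_cons, ih, pd_add (smooth_pdw hf u) (smooth_pdw hg u)]; rfl

theorem pdw_const_mul {f : (Fin n → ℝ) → ℂ} (hf : ContDiff ℝ (⊤ : ℕ∞) f) (c : ℂ)
    (u : List (Fin n)) : pdw u (fun x => c * f x) = fun x => c * pdw u f x := by
  induction u with
  | nil => rfl
  | cons k u ih => rw [pdw_cons, ih, pd_const_mul (smooth_pdw hf u)]; rfl

theorem pdw_zero (u : List (Fin n)) : pdw u (fun _ => 0) = fun _ => 0 := by
  have := pdw_const_mul (f := fun _ : Fin n → ℝ => (0:ℂ)) contDiff_const 0 u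
  simpa using this

theorem pdw_sub {f g : (Fin n → ℝ) → ℂ} (hf : ContDiff ℝ (⊤ : ℕ∞) f) (hg : ContDiff ℝ (⊤ : ℕ∞) g)
    (u : List (Fin n)) : pdw u (fun x => f x - g x) = fun x => pdw u f x - pdw u g x := by
  have h1 := pdw_add hf (contDiff_const.mul hg : ContDiff ℝ (⊤ : ℕ∞) fun x => (-1 : ℂ) * g x) u
  rw [pdw_const_mul hg] at h1
  simpa [sub_eq_add_neg] using h1

theorem pdw_sum {ι : Type*} (s : Finset ι) {f : ι → (Fin n → ℝ) → ℂ}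
    (hf : ∀ i, ContDiff ℝ (⊤ : ℕ∞) (f i)) (u : List (Fin n)) :
    pdw u (fun x => ∑ i ∈ s, f i x) = fun x => ∑ i ∈ s, pdw u (f i) x := by
  classical
  induction s using Finset.induction_on with
  | empty => simpa using pdw_zero u
  | insert a s ha ih =>
    simp only [Finset.sum_insert ha]
    rw [pdw_add (hf a) (ContDiff.sum fun i _ => hf i), ih]

theorem pdw_perm {u u' : List (Fin n)} (h : u.Perm u') {f : (Fin n → ℝ) → ℂ}
    (hf : ContDiff ℝ (⊤ : ℕ∞) f) : pdw u f = pdw u' f := by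
  induction h with
  | nil => rfl
  | cons x _ ih => rw [pdw_cons, pdw_cons, ih]
  | swap x y l => simp only [pdw_cons]; exact pd_comm (smooth_pdw hf l) _ _
  | trans _ _ ih1 ih2 => exact ih1.trans ih2

theorem dd_comm (k l : Fin n) (g : (Fin n → ℤ) → ℂ) : dd k (dd l g) = dd l (dd k g) := by
  ext ξ; simp only [dd]
  rw [add_right_comm]; ring

theorem ddw_perm {u u' : List (Fin n)} (h : u.Perm u') (g : (Fin n → ℤ) → ℂ) :
    ddw u g = ddw u' g := by
  induction h with
  | nil => rfl
  | cons x _ ih => rw [ddw_cons, ddw_cons, ih]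
  | swap x y l => simp only [ddw_cons]; exact dd_comm _ _ _
  | trans _ _ ih1 ih2 => exact ih1.trans ih2

theorem mIdxList_count_perm (u : List (Fin n)) : u.Perm (mIdxList fun j => u.count j) := by
  classical
  rw [List.perm_iff_count]
  intro j
  rw [mIdxList, List.count_flatMap]
  have : (fun a => List.count j (List.replicate (List.count a u) a)) =
      fun a => if a = j then u.count j else 0 := by
    ext a
    rw [List.count_replicate]
    by_cases h : a = j <;> simp [h]
  simp only [Function.comp_def, this]
  rw [← Fin.sum_univ_def]
  simp

theorem length_eq_sum_count (u : List (Fin n)) : (u.length : ℝ) = ∑ j, ((u.count j : ℕ) : ℝ) := by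
  rw [← List.sum_toFinset_count_eq_length u]
  push_cast
  refine Finset.sum_subset (Finset.subset_univ _) fun j _ hj => ?_
  have : j ∉ u := by simpa using hj
  simp [List.count_eq_zero_of_not_mem this]

theorem ddw_add (v : List (Fin n)) (g h : (Fin n → ℤ) → ℂ) :
    ddw v (fun ξ => g ξ + h ξ) = fun ξ => ddw v g ξ + ddw v h ξ := by
  induction v with
  | nil => rfl
  | cons k v ih => rw [ddw_cons, ih]; ext ξ; simp only [ddw_cons, dd]; ring

theorem ddw_const_mul (v : List (Fin n)) (c : ℂ) (g : (Fin n → ℤ) → ℂ) :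
    ddw v (fun ξ => c * g ξ) = fun ξ => c * ddw v g ξ := by
  induction v with
  | nil => rfl
  | cons k v ih => rw [ddw_cons, ih]; ext ξ; simp only [ddw_cons, dd]; ring

theorem ddw_zero (v : List (Fin n)) : ddw v (fun _ => 0) = fun _ => 0 := by
  simpa using ddw_const_mul v 0 fun _ => 0

theorem ddw_sum {ι : Type*} (s : Finset ι) (g : ι → (Fin n → ℤ) → ℂ) (v : List (Fin n)) :
    ddw v (fun ξ => ∑ i ∈ s, g i ξ) = fun ξ => ∑ i ∈ s, ddw v (g i) ξ := by
  classical
  induction s using Finset.induction_on with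
  | empty => simpa using ddw_zero v
  | insert a s ha ih => simp only [Finset.sum_insert ha]; rw [ddw_add, ih]

theorem dd_mul (k : Fin n) (g h : (Fin n → ℤ) → ℂ) :
    dd k (fun ξ => g ξ * h ξ) = fun ξ => (dd k g ξ * h ξ + dd k g ξ * dd k h ξ) + g ξ * dd k h ξ := by
  ext ξ; simp only [dd]; ring

theorem SmoothPer.add {f g : (Fin n → ℝ) → ℂ} (hf : SmoothPer f) (hg : SmoothPer g) :
    SmoothPer fun x => f x + g x :=
  ⟨hf.1.add hg.1, fun x v => by simp only [hf.2 x v, hg.2 x v]⟩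

theorem SmoothPer.sub {f g : (Fin n → ℝ) → ℂ} (hf : SmoothPer f) (hg : SmoothPer g) :
    SmoothPer fun x => f x - g x :=
  ⟨hf.1.sub hg.1, fun x v => by simp only [hf.2 x v, hg.2 x v]⟩

theorem SmoothPer.mul {f g : (Fin n → ℝ) → ℂ} (hf : SmoothPer f) (hg : SmoothPer g) :
    SmoothPer fun x => f x * g x :=
  ⟨hf.1.mul hg.1, fun x v => by simp only [hf.2 x v, hg.2 x v]⟩

theorem SmoothPer.const (c : ℂ) : SmoothPer fun _ : Fin n → ℝ => c :=
  ⟨contDiff_const, fun _ _ => rfl⟩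

theorem SmoothPer.sum {ι : Type*} (s : Finset ι) {f : ι → (Fin n → ℝ) → ℂ}
    (hf : ∀ i, SmoothPer (f i)) : SmoothPer fun x => ∑ i ∈ s, f i x :=
  ⟨ContDiff.sum fun i _ => (hf i).1, fun x v => Finset.sum_congr rfl fun i _ => (hf i).2 x v⟩

theorem smoothPer_eChar (ξ : Fin n → ℤ) : SmoothPer fun x : Fin n → ℝ => eChar x ξ :=
  ⟨contDiff_eChar ξ, per_eChar ξ⟩

theorem Per.pd {f : (Fin n → ℝ) → ℂ} (hf : Per f) (k : Fin n) : Per (pd k f) := by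
  intro x v
  have : f = fun y => f (y + fun j => (v j : ℝ)) := by ext y; exact (hf y v).symm
  simp only [_root_.pd]
  conv_rhs => rw [this]
  rw [fderiv_comp_add_right]

theorem SmoothPer.pdw {f : (Fin n → ℝ) → ℂ} (hf : SmoothPer f) (u : List (Fin n)) :
    SmoothPer (pdw u f) := by
  refine ⟨smooth_pdw hf.1 u, ?_⟩
  induction u with
  | nil => exact hf.2
  | cons k u ih => exact ih.pd k

theorem SmoothPer.ddw {b : (Fin n → ℝ) → (Fin n → ℤ) → ℂ} (hb : ∀ ξ, SmoothPer fun x => b x ξ)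
    (v : List (Fin n)) (ξ : Fin n → ℤ) : SmoothPer fun x => ddw v (b x) ξ := by
  induction v generalizing ξ with
  | nil => exact hb ξ
  | cons k v ih => exact (ih _).sub (ih _)

theorem ddw_pdw {b : (Fin n → ℝ) → (Fin n → ℤ) → ℂ} (hb : ∀ ξ, SmoothPer fun x => b x ξ)
    (u v : List (Fin n)) (x : Fin n → ℝ) (ξ : Fin n → ℤ) :
    ddw v (fun ξ => pdw u (fun x => b x ξ) x) ξ = pdw u (fun x => ddw v (b x) ξ) x := by
  induction v generalizing ξ with
  | nil => rfl
  | cons k v ih =>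
    simp only [ddw_cons, dd, ih]
    rw [pdw_sub (SmoothPer.ddw hb v _).1 (SmoothPer.ddw hb v _).1]

theorem SmoothPer.bddMeas {f : (Fin n → ℝ) → ℂ} (hf : SmoothPer f) : BddMeas f := by
  refine ⟨hf.1.continuous.measurable, ?_⟩
  obtain ⟨M, hM⟩ := (isCompact_Icc (a := (0 : Fin n → ℝ)) (b := 1)).exists_bound_of_continuousOn
    hf.1.continuous.continuousOn
  refine ⟨M, fun x => ?_⟩
  have h := hf.2 x fun i => -⌊x i⌋
  rw [← h]
  refine hM _ ⟨fun i => ?_, fun i => ?_⟩ <;> simp only [Pi.add_apply, Pi.zero_apply, Pi.one_apply] <;>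
    push_cast
  · linarith [Int.floor_le (x i)]
  · linarith [Int.lt_floor_add_one (x i)]

theorem norm_sub_le_pd {f : (Fin n → ℝ) → ℂ} (hf : ContDiff ℝ (⊤ : ℕ∞) f) {k : Fin n} {M : ℝ}
    (hM : ∀ x, ‖pd k f x‖ ≤ M) (h : ℝ) (x : Fin n → ℝ) :
    ‖f (x + Pi.single k h) - f x‖ ≤ M * |h| := by
  have hd : ∀ t : ℝ, HasDerivAt (fun t : ℝ => f (x + t • Pi.single k 1))
      (pd k f (x + t • Pi.single k 1)) t := fun t => by
    have h1 := (differentiable_of_smooth hf (x + t • Pi.single k 1)).hasFDerivAt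
    have h2 : HasDerivAt (fun t : ℝ => x + t • (Pi.single k 1 : Fin n → ℝ)) (Pi.single k 1) t := by
      simpa using ((hasDerivAt_id t).smul_const (Pi.single k (1:ℝ) : Fin n → ℝ)).const_add x
    exact h1.comp_hasDerivAt t h2
  have := Convex.norm_image_sub_le_of_norm_hasDerivWithin_le (s := Set.univ)
    (fun t _ => (hd t).hasDerivWithinAt) (fun t _ => hM _) convex_univ (Set.mem_univ 0)
    (Set.mem_univ h)
  simpa [← Pi.single_smul] using this

theorem pdw_comp_add {f : (Fin n → ℝ) → ℂ} (u : List (Fin n)) (y : Fin n → ℝ) :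
    pdw u (fun x => f (x + y)) = fun x => pdw u f (x + y) := by
  induction u with
  | nil => rfl
  | cons k u ih => rw [pdw_cons, ih]; ext x; simp only [pd, pdw_cons]; rw [fderiv_comp_add_right]

theorem norm_fc_le {f : (Fin n → ℝ) → ℂ} {M : ℝ} (hM : ∀ x, ‖f x‖ ≤ M) (ξ : Fin n → ℤ) :
    ‖fc f ξ‖ ≤ M := by
  rw [fc_eq]
  have h := norm_integral_le_of_norm_le_const (μ := μT n) (C := M)
    (f := fun x => eChar x (-ξ) * f x) (Filter.Eventually.of_forall fun y => by
      rw [norm_mul, norm_eChar, one_mul]; exact hM y)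
  simpa using h

theorem norm_fc_decay {k : Fin n} {ζ : Fin n → ℤ} (hζ : ζ k ≠ 0) (N : ℕ)
    {f : (Fin n → ℝ) → ℂ} (hf : SmoothPer f) {M : ℝ}
    (hM : ∀ x, ‖pdw (List.replicate N k) f x‖ ≤ M) :
    ‖fc f ζ‖ ≤ M * (1 / (4 * |(ζ k : ℝ)|)) ^ N := by
  induction N generalizing f M with
  | zero => simpa using norm_fc_le (f := f) hM ζ
  | succ N ih =>
    set h : ℝ := 1 / (2 * (ζ k : ℝ)) with hh
    have hζ' : (ζ k : ℝ) ≠ 0 := by exact_mod_cast hζ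
    have hsh : SmoothPer fun x => f (x + Pi.single k h) :=
      ⟨hf.1.comp (contDiff_id.add contDiff_const), fun x v => by
        rw [add_right_comm, hf.2]⟩
    have hD := hsh.sub hf
    have key : fc (fun x => f (x + Pi.single k h) - f x) ζ = -2 * fc f ζ := by
      have e1 : fc (fun x => f (x + Pi.single k h)) ζ = - fc f ζ := by
        have hp := ((smoothPer_eChar (-ζ)).mul hf).2.integral_add (Pi.single k h)
        rw [fc_eq, fc_eq, ← hp, ← integral_neg]
        congr 1; ext x
        rw [eChar_add_left]
        have : eChar (Pi.single k h) (-ζ) = -1 := by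
          rw [eChar, Finset.sum_eq_single k (by intro j _ hj; simp [hj]) (by simp)]
          simp only [Pi.single_eq_same, Pi.neg_apply]
          have : (ζ k : ℂ) ≠ 0 := by exact_mod_cast hζ
          rw [show 2 * (π:ℂ) * Complex.I * ((h : ℂ) * ((-ζ k : ℤ) : ℂ)) =
            -(π * Complex.I) by rw [hh]; push_cast; field_simp, Complex.exp_neg,
            Complex.exp_pi_mul_I]
          norm_num
        rw [this]; ring
      have e2 : fc (fun x => f (x + Pi.single k h) - f x) ζ =
          fc (fun x => f (x + Pi.single k h)) ζ - fc f ζ := by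
        rw [fc_eq, fc_eq, fc_eq, ← integral_sub]
        · congr 1; ext x; ring
        · exact ((bddMeas_eChar (-ζ)).mul hsh.bddMeas).integrable
        · exact ((bddMeas_eChar (-ζ)).mul hf.bddMeas).integrable
      rw [e2, e1]; ring
    have hb := ih hD (M := M * |h|) fun x => by
      rw [pdw_sub hsh.1 hf.1, pdw_comp_add]
      exact norm_sub_le_pd (smooth_pdw hf.1 _) hM h x
    rw [key, norm_mul] at hb
    norm_num at hb
    have e : |h| = 2 * (1 / (4 * |(ζ k : ℝ)|)) := by
      rw [hh, abs_div, abs_mul, abs_one, abs_two]; field_simp; norm_num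
    rw [e] at hb
    rw [pow_succ]
    norm_num at hb ⊢
    linarith

theorem one_le_jb (ξ : Fin n → ℤ) : 1 ≤ jb ξ :=
  Real.one_le_sqrt.2 (by have := Finset.sum_nonneg (s := Finset.univ) fun j (_ : j ∈ Finset.univ) => sq_nonneg (ξ j : ℝ); linarith)

theorem jb_pos (ξ : Fin n → ℤ) : 0 < jb ξ := one_pos.trans_le (one_le_jb ξ)

theorem abs_le_jb (ξ : Fin n → ℤ) (k : Fin n) : |(ξ k : ℝ)| ≤ jb ξ := by
  refine Real.le_sqrt_of_sq_le ?_
  rw [sq_abs]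
  have := Finset.single_le_sum (f := fun j => (ξ j : ℝ) ^ 2) (fun j _ => sq_nonneg _)
    (Finset.mem_univ k)
  linarith

theorem jb_sq (ξ : Fin n → ℤ) : jb ξ ^ 2 = 1 + ∑ j, ((ξ j : ℝ)) ^ 2 :=
  Real.sq_sqrt (by have := Finset.sum_nonneg (s := Finset.univ) fun j (_ : j ∈ Finset.univ) => sq_nonneg (ξ j : ℝ); linarith)

theorem jb_le_one_add_sum (ξ : Fin n → ℤ) : jb ξ ≤ 1 + ∑ j, |(ξ j : ℝ)| := by
  have h0 : 0 ≤ ∑ j, |(ξ j : ℝ)| := Finset.sum_nonneg fun j _ => abs_nonneg _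
  refine Real.sqrt_le_iff.2 ⟨by linarith, ?_⟩
  have h := Finset.sum_sq_le_sq_sum_of_nonneg (s := Finset.univ) (f := fun j => |(ξ j : ℝ)|)
    fun j _ => abs_nonneg _
  simp only [sq_abs] at h
  nlinarith

theorem one_add_sum_le_jb (ξ : Fin n → ℤ) : 1 + ∑ j, |(ξ j : ℝ)| ≤ (n + 1) * jb ξ := by
  have h := Finset.sum_le_sum fun j (_ : j ∈ Finset.univ) => abs_le_jb ξ j
  simp only [Finset.sum_const, Finset.card_univ, Fintype.card_fin, nsmul_eq_mul] at h
  linarith [one_le_jb ξ]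

theorem sum_sq_add_single (ξ : Fin n → ℤ) (k : Fin n) (c : ℤ) :
    ∑ j, (((ξ + Pi.single k c : Fin n → ℤ) j : ℤ) : ℝ) ^ 2 = ∑ j, (ξ j : ℝ) ^ 2 + (2 * c * ξ k + c ^ 2) := by
  classical
  rw [← Finset.add_sum_erase _ _ (Finset.mem_univ k), ← Finset.add_sum_erase Finset.univ
    (fun j => (ξ j : ℝ) ^ 2) (Finset.mem_univ k)]
  have : ∑ j ∈ Finset.univ.erase k, (((ξ + Pi.single k c : Fin n → ℤ) j : ℤ) : ℝ) ^ 2 =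
      ∑ j ∈ Finset.univ.erase k, (ξ j : ℝ) ^ 2 := Finset.sum_congr rfl fun j hj => by
    simp [Finset.ne_of_mem_erase hj]
  rw [this]; simp; ring

theorem jb_add_single_le (ξ : Fin n → ℤ) (k : Fin n) {c : ℤ} (hc : c ^ 2 = 1) :
    jb (ξ + Pi.single k c) ≤ 2 * jb ξ := by
  refine abs_le_of_sq_le_sq' ?_ (by linarith [one_le_jb ξ]) |>.2
  have hc' : (c : ℝ) ^ 2 = 1 := by exact_mod_cast hc
  rw [jb_sq, sum_sq_add_single, mul_pow, jb_sq]
  have h1 := Finset.single_le_sum (f := fun j => (ξ j : ℝ) ^ 2) (fun j _ => sq_nonneg _)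
    (Finset.mem_univ k)
  nlinarith [sq_nonneg ((c : ℝ) - ξ k)]

theorem jb_le_add_single (ξ : Fin n → ℤ) (k : Fin n) :
    jb ξ ≤ 2 * jb (ξ + Pi.single k 1) := by
  have := jb_add_single_le (ξ + Pi.single k 1) k (c := -1) (by norm_num)
  rwa [add_assoc, ← Pi.single_add, add_neg_cancel, Pi.single_zero, add_zero] at this

theorem rpow_le_of_comparable {x y S : ℝ} (hx : 0 < x) (hy : 0 < y) (hS : 1 ≤ S) (h1 : x ≤ S * y)
    (h2 : y ≤ S * x) (s : ℝ) : x ^ s ≤ S ^ |s| * y ^ s := by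
  have hS0 : 0 < S := by linarith
  rcases le_total 0 s with hs | hs
  · rw [abs_of_nonneg hs, ← Real.mul_rpow hS0.le hy.le]
    exact Real.rpow_le_rpow hx.le h1 hs
  · rw [abs_of_nonpos hs, Real.rpow_neg hS0.le]
    have : (S * x) ^ s ≤ y ^ s := Real.rpow_le_rpow_of_nonpos hy h2 hs
    rw [Real.mul_rpow hS0.le hx.le] at this
    rw [← div_eq_inv_mul, le_div_iff₀ (by positivity)]
    linarith

/-- Families of periodic symbols with uniform estimates. -/
structure USym {ι : Type*} (ρ δ μ : ℝ) (b : ι → (Fin n → ℝ) → (Fin n → ℤ) → ℂ) : Prop where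
  smooth : ∀ i ξ, SmoothPer fun x => b i x ξ
  bound : ∀ u v : List (Fin n), ∃ C : ℝ, ∀ i x ξ,
    ‖pdw u (fun x => ddw v (b i x) ξ) x‖ ≤ C * jb ξ ^ (μ - ρ * v.length + δ * u.length)

/-- Families of Fourier multipliers with uniform estimates. -/
def UMul {ι : Type*} (ν : ℝ) (c : ι → (Fin n → ℤ) → ℂ) : Prop :=
  ∀ v : List (Fin n), ∃ C : ℝ, ∀ i ξ, ‖ddw v (c i) ξ‖ ≤ C * jb ξ ^ (ν - v.length)

section
variable {ι : Type*} {ρ δ μ ν : ℝ} {b b' : ι → (Fin n → ℝ) → (Fin n → ℤ) → ℂ}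
  {c : ι → (Fin n → ℤ) → ℂ}

theorem USym.exists_bound (hb : USym ρ δ μ b) (u v : List (Fin n)) : ∃ C : ℝ, 0 ≤ C ∧ ∀ i x ξ,
    ‖pdw u (fun x => ddw v (b i x) ξ) x‖ ≤ C * jb ξ ^ (μ - ρ * v.length + δ * u.length) := by
  obtain ⟨C, hC⟩ := hb.bound u v
  refine ⟨|C|, abs_nonneg _, fun i x ξ => (hC i x ξ).trans ?_⟩
  exact mul_le_mul_of_nonneg_right (le_abs_self C) (Real.rpow_nonneg (jb_pos ξ).le _)

theorem USym.dd (hb : USym ρ δ μ b) (k : Fin n) :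
    USym ρ δ (μ - ρ) fun i x => dd k (b i x) := by
  refine ⟨fun i ξ => SmoothPer.ddw (hb.smooth i) [k] ξ, fun u v => ?_⟩
  obtain ⟨C, hC⟩ := hb.bound u (v ++ [k])
  refine ⟨C, fun i x ξ => ?_⟩
  have := hC i x ξ
  simp only [ddw_append] at this
  refine this.trans_eq ?_
  congr 2
  simp only [List.length_append, List.length_singleton]
  push_cast; ring

theorem UMul.dd (hc : UMul ν c) (k : Fin n) : UMul (ν - 1) fun i => dd k (c i) := by
  intro v
  obtain ⟨C, hC⟩ := hc (v ++ [k])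
  refine ⟨C, fun i ξ => ?_⟩
  have := hC i ξ
  simp only [ddw_append] at this
  refine this.trans_eq ?_
  congr 2
  simp only [List.length_append, List.length_singleton]
  push_cast; ring

theorem USym.mono {μ' : ℝ} (hb : USym ρ δ μ b) (h : μ ≤ μ') : USym ρ δ μ' b := by
  refine ⟨hb.smooth, fun u v => ?_⟩
  obtain ⟨C, hC0, hC⟩ := hb.exists_bound u v
  refine ⟨C, fun i x ξ => (hC i x ξ).trans (mul_le_mul_of_nonneg_left ?_ hC0)⟩
  exact Real.rpow_le_rpow_of_exponent_le (one_le_jb ξ) (by linarith)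

theorem smoothPer_mul_bound (hc : UMul ν c) (hb : USym ρ δ μ b) (hρ : ρ ≤ 1) (u v : List (Fin n)) :
    ∃ C : ℝ, ∀ i x ξ, ‖pdw u (fun x => ddw v (fun ξ => c i ξ * b i x ξ) ξ) x‖ ≤
      C * jb ξ ^ (μ + ν - ρ * v.length + δ * u.length) := by
  induction v using List.reverseRecOn generalizing μ ν b c with
  | nil =>
    obtain ⟨C, hC⟩ := hc []
    obtain ⟨C', hC'0, hC'⟩ := hb.exists_bound u []
    refine ⟨C * C', fun i x ξ => ?_⟩
    simp only [ddw_nil] at hC hC' ⊢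
    rw [pdw_const_mul (hb.smooth i ξ).1, norm_mul]
    refine (mul_le_mul (hC i ξ) (hC' i x ξ) (norm_nonneg _) ((norm_nonneg _).trans (hC i ξ))).trans
      (le_of_eq ?_)
    rw [mul_mul_mul_comm, ← Real.rpow_add (jb_pos ξ)]
    congr 2; simp; ring
  | append_singleton v k ih =>
    obtain ⟨C1, h1⟩ := ih (hc.dd k) hb
    obtain ⟨C2, h2⟩ := ih (hc.dd k) (hb.dd k)
    obtain ⟨C3, h3⟩ := ih hc (hb.dd k)
    refine ⟨|C1| + |C2| + |C3|, fun i x ξ => ?_⟩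
    have s1 : ∀ ξ, SmoothPer fun x => _root_.dd k (c i) ξ * b i x ξ := fun ξ =>
      (SmoothPer.const _).mul (hb.smooth i ξ)
    have s2 : ∀ ξ, SmoothPer fun x => _root_.dd k (c i) ξ * _root_.dd k (b i x) ξ := fun ξ =>
      (SmoothPer.const _).mul ((hb.dd k).smooth i ξ)
    have s3 : ∀ ξ, SmoothPer fun x => c i ξ * _root_.dd k (b i x) ξ := fun ξ =>
      (SmoothPer.const _).mul ((hb.dd k).smooth i ξ)
    have e : (fun x => ddw (v ++ [k]) (fun ξ => c i ξ * b i x ξ) ξ) = fun x =>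
        (ddw v (fun ξ => _root_.dd k (c i) ξ * b i x ξ) ξ +
        ddw v (fun ξ => _root_.dd k (c i) ξ * _root_.dd k (b i x) ξ) ξ) +
        ddw v (fun ξ => c i ξ * _root_.dd k (b i x) ξ) ξ := by
      ext x
      rw [ddw_append, ddw_cons, ddw_nil, dd_mul, ddw_add, ddw_add]
    rw [e, pdw_add ((SmoothPer.ddw s1 v ξ).add (SmoothPer.ddw s2 v ξ)).1 (SmoothPer.ddw s3 v ξ).1,
      pdw_add (SmoothPer.ddw s1 v ξ).1 (SmoothPer.ddw s2 v ξ).1]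
    have m : ∀ {D s : ℝ} {z : ℂ}, ‖z‖ ≤ D * jb ξ ^ s →
        s ≤ (μ + ν - ρ * (v ++ [k]).length + δ * u.length) →
        ‖z‖ ≤ |D| * jb ξ ^ (μ + ν - ρ * (v ++ [k]).length + δ * u.length) := by
      intro D s z h hs
      refine h.trans ((mul_le_mul_of_nonneg_right (le_abs_self D)
        (Real.rpow_nonneg (jb_pos ξ).le _)).trans (mul_le_mul_of_nonneg_left ?_ (abs_nonneg _)))
      exact Real.rpow_le_rpow_of_exponent_le (one_le_jb ξ) hs
    have n1 := m (h1 i x ξ) (by simp; linarith)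
    have n2 := m (h2 i x ξ) (by simp; linarith)
    have n3 := m (h3 i x ξ) (by simp; linarith)
    refine (norm_add_le _ _).trans ?_
    refine (add_le_add (norm_add_le _ _) le_rfl).trans ?_
    rw [add_mul, add_mul]
    exact add_le_add (add_le_add n1 n2) n3

theorem USym.mul (hc : UMul ν c) (hb : USym ρ δ μ b) (hρ : ρ ≤ 1) :
    USym ρ δ (μ + ν) fun i x ξ => c i ξ * b i x ξ :=
  ⟨fun i ξ => (SmoothPer.const _).mul (hb.smooth i ξ), smoothPer_mul_bound hc hb hρ⟩

theorem USym.comp {κ : Type*} (hb : USym ρ δ μ b) (e : κ → ι) : USym ρ δ μ fun j => b (e j) :=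
  ⟨fun j => hb.smooth (e j), fun u v => (hb.bound u v).imp fun _ h j => h (e j)⟩

end

/-- The dyadic shell `jb ξ ∼ 2 ^ j`. -/
def Shell (S : ℝ) (j : ℕ) (ξ : Fin n → ℤ) : Prop :=
  (2:ℝ) ^ (j:ℝ) ≤ S * jb ξ ∧ jb ξ ≤ S * (2:ℝ) ^ (j:ℝ)

/-- Families of symbols localized to dyadic shells. -/
structure LocSym (ρ δ μ : ℝ) (b : ℕ → (Fin n → ℝ) → (Fin n → ℤ) → ℂ) : Prop where
  smooth : ∀ i ξ, SmoothPer fun x => b i x ξ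
  bound : ∀ u v : List (Fin n), ∃ C : ℝ, ∀ j x ξ,
    ‖pdw u (fun x => ddw v (b j x) ξ) x‖ ≤ C * (2:ℝ) ^ ((j:ℝ) * (μ - ρ * v.length + δ * u.length))
  supp : ∃ S : ℝ, 1 ≤ S ∧ ∀ j x ξ, ¬ Shell S j ξ → b j x ξ = 0

theorem ddw_eq_zero_of_not_shell {S : ℝ} (hS : 1 ≤ S) {j : ℕ} {g : (Fin n → ℤ) → ℂ}
    (hg : ∀ ξ, ¬ Shell S j ξ → g ξ = 0) (v : List (Fin n)) {ξ : Fin n → ℤ}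
    (hξ : ¬ Shell (2 ^ v.length * S) j ξ) : ddw v g ξ = 0 := by
  induction v generalizing ξ with
  | nil => exact hg ξ (by simpa using hξ)
  | cons k v ih =>
    have hT : 1 ≤ 2 ^ v.length * S := one_le_mul_of_one_le_of_one_le (one_le_pow₀ (by norm_num)) hS
    rw [List.length_cons, pow_succ'] at hξ
    set T := 2 ^ v.length * S
    have hp : (0:ℝ) < 2 ^ (j:ℝ) := by positivity
    have h1 : ¬ Shell T j ξ := fun h => hξ ⟨by nlinarith [h.1, one_le_jb ξ], by nlinarith [h.2]⟩
    have h2 : ¬ Shell T j (ξ + Pi.single k 1) := fun h => hξ ⟨by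
        have := jb_add_single_le ξ k (c := 1) (by norm_num)
        nlinarith [h.1], by
        have := jb_le_add_single ξ k
        nlinarith [h.2]⟩
    rw [ddw_cons, dd, ih h1, ih h2, sub_zero]

section
variable {ρ δ μ : ℝ} {b b' : ℕ → (Fin n → ℝ) → (Fin n → ℤ) → ℂ}

theorem pdw_ddw_eq_zero {S : ℝ} (hS : 1 ≤ S) {j : ℕ} {b : (Fin n → ℝ) → (Fin n → ℤ) → ℂ}
    (hb : ∀ x ξ, ¬ Shell S j ξ → b x ξ = 0) (u v : List (Fin n)) {ξ : Fin n → ℤ}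
    (hξ : ¬ Shell (2 ^ v.length * S) j ξ) (x : Fin n → ℝ) :
    pdw u (fun x => ddw v (b x) ξ) x = 0 := by
  have : (fun x => ddw v (b x) ξ) = fun _ => 0 := by
    ext x; exact ddw_eq_zero_of_not_shell hS (hb x) v hξ
  rw [this, pdw_zero]

theorem USym.loc (hb : USym ρ δ μ b) {S : ℝ} (hS : 1 ≤ S)
    (h : ∀ j x ξ, ¬ Shell S j ξ → b j x ξ = 0) : LocSym ρ δ μ b := by
  refine ⟨hb.smooth, fun u v => ?_, S, hS, h⟩
  obtain ⟨C, hC0, hC⟩ := hb.exists_bound u v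
  set s := μ - ρ * v.length + δ * u.length
  set T := 2 ^ v.length * S
  have hT : 1 ≤ T := one_le_mul_of_one_le_of_one_le (one_le_pow₀ (by norm_num)) hS
  refine ⟨C * T ^ |s|, fun j x ξ => ?_⟩
  by_cases hsh : Shell T j ξ
  · refine (hC j x ξ).trans ?_
    rw [mul_assoc, Real.rpow_mul (by norm_num)]
    exact mul_le_mul_of_nonneg_left
      (rpow_le_of_comparable (jb_pos ξ) (by positivity) hT hsh.2 hsh.1 s) hC0
  · rw [pdw_ddw_eq_zero hS (h j) u v hsh, norm_zero]; positivity

theorem LocSym.exists_bound (hb : LocSym ρ δ μ b) (u v : List (Fin n)) : ∃ C : ℝ, 0 ≤ C ∧ ∀ j x ξ,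
    ‖pdw u (fun x => ddw v (b j x) ξ) x‖ ≤
      C * (2:ℝ) ^ ((j:ℝ) * (μ - ρ * v.length + δ * u.length)) := by
  obtain ⟨C, hC⟩ := hb.bound u v
  exact ⟨|C|, abs_nonneg _, fun j x ξ => (hC j x ξ).trans
    (mul_le_mul_of_nonneg_right (le_abs_self C) (by positivity))⟩

theorem card_shell_le (S : ℝ) : ∃ m : ℕ, ∀ (ξ : Fin n → ℤ) (J : Finset ℕ),
    (∀ j ∈ J, Shell S j ξ) → J.card ≤ m := by
  obtain ⟨m, hm⟩ := pow_unbounded_of_one_lt (S ^ 2) (one_lt_two : (1:ℝ) < 2)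
  refine ⟨m + 1, fun ξ J hJ => ?_⟩
  rcases J.eq_empty_or_nonempty with rfl | hne
  · simp
  have hsub : J ⊆ Finset.Icc (J.min' hne) (J.min' hne + m) := fun j hj => by
    refine Finset.mem_Icc.2 ⟨J.min'_le j hj, ?_⟩
    by_contra! hlt
    have h0 := hJ _ (J.min'_mem hne)
    have h1 := hJ j hj
    set i := J.min' hne
    have hS : 0 < S := by
      by_contra! hS
      have : (0:ℝ) < 2 ^ (j:ℝ) := by positivity
      nlinarith [h1.1, jb_pos ξ]
    have h2 : (2:ℝ) ^ (j:ℝ) ≤ S ^ 2 * (2:ℝ) ^ (i:ℝ) := by nlinarith [h1.1, h0.2]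
    rw [Real.rpow_natCast, Real.rpow_natCast] at h2
    have h3 : (2:ℝ) ^ (i + m) ≤ 2 ^ j := pow_le_pow_right₀ (by norm_num) hlt.le
    rw [pow_add] at h3
    have : (0:ℝ) < 2 ^ i := by positivity
    nlinarith
  refine (Finset.card_le_card hsub).trans ?_
  simp; omega

/-- Uniform symbol estimates for signed sums of a localized family. -/
theorem LocSym.usym_sum (hb : LocSym ρ δ μ b) :
    USym ρ δ μ fun (i : ℕ × {ε : ℕ → ℂ // ∀ j, ‖ε j‖ ≤ 1}) x ξ =>
      ∑ j ∈ Finset.range i.1, i.2.1 j * b j x ξ := by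
  classical
  refine ⟨fun i ξ => SmoothPer.sum _ fun j => (SmoothPer.const _).mul (hb.smooth j ξ),
    fun u v => ?_⟩
  obtain ⟨C, hC0, hC⟩ := hb.exists_bound u v
  obtain ⟨S, hS, hsupp⟩ := hb.supp
  set s := μ - ρ * v.length + δ * u.length
  set T := 2 ^ v.length * S
  have hT : 1 ≤ T := one_le_mul_of_one_le_of_one_le (one_le_pow₀ (by norm_num)) hS
  obtain ⟨m, hm⟩ := card_shell_le (n := n) T
  refine ⟨m * (C * T ^ |s|), fun i x ξ => ?_⟩
  have e : (fun x => ddw v (fun ξ => ∑ j ∈ Finset.range i.1, i.2.1 j * b j x ξ) ξ) =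
      fun x => ∑ j ∈ Finset.range i.1, i.2.1 j * ddw v (b j x) ξ := by
    ext x; rw [ddw_sum]; simp only [ddw_const_mul]
  rw [e, pdw_sum _ fun j => ((SmoothPer.const _).mul (SmoothPer.ddw (hb.smooth j) v ξ)).1]
  refine (norm_sum_le _ _).trans ?_
  rw [← Finset.sum_filter_add_sum_filter_not _ (fun j => Shell T j ξ)]
  have h0 : ∀ j, ¬ Shell T j ξ → ‖pdw u (fun x => i.2.1 j * ddw v (b j x) ξ) x‖ = 0 := fun j hj => by
    rw [pdw_const_mul (SmoothPer.ddw (hb.smooth j) v ξ).1]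
    simp only [pdw_ddw_eq_zero hS (hsupp j) u v hj]
    simp
  rw [Finset.sum_eq_zero (s := Finset.filter (fun j => ¬ Shell T j ξ) _)
    fun j hj => h0 j (Finset.mem_filter.1 hj).2, add_zero]
  refine (Finset.sum_le_card_nsmul _ _ (C * T ^ |s| * jb ξ ^ s) fun j hj => ?_).trans ?_
  · have hsh := (Finset.mem_filter.1 hj).2
    rw [pdw_const_mul (SmoothPer.ddw (hb.smooth j) v ξ).1, norm_mul]
    refine (mul_le_of_le_one_left (norm_nonneg _) (i.2.2 j)).trans ((hC j x ξ).trans ?_)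
    rw [mul_assoc, Real.rpow_mul (by norm_num)]
    exact mul_le_mul_of_nonneg_left
      (rpow_le_of_comparable (by positivity) (jb_pos ξ) hT hsh.1 hsh.2 s) hC0
  · rw [nsmul_eq_mul, mul_assoc (m:ℝ)]
    refine mul_le_mul_of_nonneg_right ?_ (mul_nonneg (by positivity) (Real.rpow_nonneg (jb_pos ξ).le _))
    exact_mod_cast hm ξ _ fun j hj => (Finset.mem_filter.1 hj).2

theorem LocSym.usym (hb : LocSym ρ δ μ b) : USym ρ δ μ b := by
  classical
  have h := hb.usym_sum.comp (κ := ℕ) fun j => (j + 1, ⟨fun i => if i = j then 1 else 0, fun i => by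
    by_cases h : i = j <;> simp [h]⟩)
  simpa using h

theorem LocSym.congr_eq (hb : LocSym ρ δ μ b) {μ' : ℝ} (h : μ = μ') : LocSym ρ δ μ' b := h ▸ hb

theorem LocSym.mono {μ' : ℝ} (hb : LocSym ρ δ μ b) (h : μ ≤ μ') : LocSym ρ δ μ' b := by
  obtain ⟨S, hS, hsupp⟩ := hb.supp
  exact (hb.usym.mono h).loc hS hsupp

theorem LocSym.scale (hb : LocSym ρ δ μ b) (s : ℝ) :
    LocSym ρ δ (μ + s) fun j x ξ => (((2:ℝ) ^ ((j:ℝ) * s) : ℝ) : ℂ) * b j x ξ := by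
  obtain ⟨S, hS, hsupp⟩ := hb.supp
  refine ⟨fun i ξ => (SmoothPer.const _).mul (hb.smooth i ξ), fun u v => ?_, S, hS,
    fun j x ξ h => by rw [hsupp j x ξ h, mul_zero]⟩
  obtain ⟨C, hC⟩ := hb.bound u v
  refine ⟨C, fun j x ξ => ?_⟩
  simp only [ddw_const_mul]
  rw [pdw_const_mul (SmoothPer.ddw (hb.smooth j) v ξ).1, norm_mul, Complex.norm_real,
    Real.norm_of_nonneg (by positivity)]
  refine (mul_le_mul_of_nonneg_left (hC j x ξ) (by positivity)).trans (le_of_eq ?_)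
  rw [mul_left_comm, ← Real.rpow_add (by norm_num)]
  congr 2; ring

theorem LocSym.const_mul (hb : LocSym ρ δ μ b) (c : ℂ) : LocSym ρ δ μ fun j x ξ => c * b j x ξ := by
  obtain ⟨S, hS, hsupp⟩ := hb.supp
  refine ⟨fun i ξ => (SmoothPer.const _).mul (hb.smooth i ξ), fun u v => ?_, S, hS,
    fun j x ξ h => by rw [hsupp j x ξ h, mul_zero]⟩
  obtain ⟨C, hC⟩ := hb.bound u v
  refine ⟨‖c‖ * C, fun j x ξ => ?_⟩
  simp only [ddw_const_mul]
  rw [pdw_const_mul (SmoothPer.ddw (hb.smooth j) v ξ).1, norm_mul, mul_assoc]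
  exact mul_le_mul_of_nonneg_left (hC j x ξ) (norm_nonneg _)

theorem LocSym.add (hb : LocSym ρ δ μ b) (hb' : LocSym ρ δ μ b') :
    LocSym ρ δ μ fun j x ξ => b j x ξ + b' j x ξ := by
  obtain ⟨S, hS, hsupp⟩ := hb.supp
  obtain ⟨S', hS', hsupp'⟩ := hb'.supp
  have mon : ∀ {A B : ℝ} {j : ℕ} {ξ : Fin n → ℤ}, A ≤ B → Shell A j ξ → Shell B j ξ :=
    fun hAB h => ⟨h.1.trans (mul_le_mul_of_nonneg_right hAB (jb_pos _).le),
      h.2.trans (mul_le_mul_of_nonneg_right hAB (by positivity))⟩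
  refine ⟨fun i ξ => (hb.smooth i ξ).add (hb'.smooth i ξ), fun u v => ?_, max S S',
    hS.trans (le_max_left _ _), fun j x ξ h => ?_⟩
  · obtain ⟨C, hC⟩ := hb.bound u v
    obtain ⟨C', hC'⟩ := hb'.bound u v
    refine ⟨C + C', fun j x ξ => ?_⟩
    simp only [ddw_add]
    rw [pdw_add (SmoothPer.ddw (hb.smooth j) v ξ).1 (SmoothPer.ddw (hb'.smooth j) v ξ).1, add_mul]
    exact (norm_add_le _ _).trans (add_le_add (hC j x ξ) (hC' j x ξ))
  · rw [hsupp j x ξ fun h' => h (mon (le_max_left _ _) h'),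
      hsupp' j x ξ fun h' => h (mon (le_max_right _ _) h'), add_zero]

theorem LocSym.ddw (hb : LocSym ρ δ μ b) (v : List (Fin n)) :
    LocSym ρ δ (μ - ρ * v.length) fun j x => ddw v (b j x) := by
  obtain ⟨S, hS, hsupp⟩ := hb.supp
  refine ⟨fun i ξ => SmoothPer.ddw (hb.smooth i) v ξ, fun u w => ?_, 2 ^ v.length * S,
    one_le_mul_of_one_le_of_one_le (one_le_pow₀ (by norm_num)) hS,
    fun j x ξ h => ddw_eq_zero_of_not_shell hS (hsupp j x) v h⟩
  obtain ⟨C, hC⟩ := hb.bound u (w ++ v)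
  refine ⟨C, fun i x ξ => ?_⟩
  have := hC i x ξ
  simp only [ddw_append] at this
  refine this.trans_eq ?_
  congr 2
  simp only [List.length_append]
  push_cast; ring

theorem LocSym.pd (hb : LocSym ρ δ μ b) (k : Fin n) :
    LocSym ρ δ (μ + δ) fun j x ξ => pd k (fun x => b j x ξ) x := by
  obtain ⟨S, hS, hsupp⟩ := hb.supp
  refine ⟨fun i ξ => (hb.smooth i ξ).pdw [k], fun u v => ?_, S, hS, fun j x ξ h => ?_⟩
  · obtain ⟨C, hC⟩ := hb.bound (u ++ [k]) v
    refine ⟨C, fun i x ξ => ?_⟩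
    have := hC i x ξ
    rw [pdw_append] at this
    have e : (fun x => _root_.ddw v (fun ξ => _root_.pd k (fun x => b i x ξ) x) ξ) =
        pdw [k] fun x => _root_.ddw v (b i x) ξ := by
      ext x; exact ddw_pdw (hb.smooth i) [k] v x ξ
    rw [e]
    refine this.trans_eq ?_
    congr 2
    simp only [List.length_append, List.length_singleton]
    push_cast; ring
  · have := pdw_ddw_eq_zero hS (hsupp j) [k] [] (ξ := ξ) (by simpa using h) x
    exact this

end

theorem ddw_const (v : List (Fin n)) (hv : v ≠ []) (c : ℂ) : ddw v (fun _ => c) = fun _ => 0 := by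
  obtain ⟨v', k, rfl⟩ := List.eq_nil_or_concat v |>.resolve_left hv
  rw [List.concat_eq_append, ddw_append]
  have : ddw [k] (fun _ => c) = fun _ => 0 := by ext ξ; simp [ddw, dd]
  rw [this, ddw_zero]

theorem uMul_coord {ι : Type*} (k : Fin n) : UMul 1 fun (_ : ι) (ξ : Fin n → ℤ) => ((ξ k : ℤ) : ℂ) := by
  intro v
  refine ⟨1, fun _ ξ => ?_⟩
  rcases List.eq_nil_or_concat v with rfl | ⟨v', l, rfl⟩
  · simpa [ddw_nil] using abs_le_jb ξ k
  · rw [List.concat_eq_append, ddw_append]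
    have : ddw [l] (fun ξ : Fin n → ℤ => ((ξ k : ℤ) : ℂ)) =
        fun _ => (((Pi.single l 1 : Fin n → ℤ) k : ℤ) : ℂ) := by
      ext ξ; simp [ddw, dd]
    rw [this]
    by_cases hv : v' = []
    · subst hv
      simp only [ddw_nil, List.nil_append, List.length_singleton, Nat.cast_one, sub_self,
        Real.rpow_zero, mul_one]
      by_cases h : l = k
      · subst h; simp
      · simp [Ne.symm h]
    · rw [ddw_const _ hv]
      simp only [norm_zero, one_mul]
      exact Real.rpow_nonneg (jb_pos ξ).le _

theorem LocSym.coord_mul {ρ δ μ : ℝ} {b : ℕ → (Fin n → ℝ) → (Fin n → ℤ) → ℂ}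
    (hb : LocSym ρ δ μ b) (hρ : ρ ≤ 1) (k : Fin n) :
    LocSym ρ δ (μ + 1) fun j x ξ => ((ξ k : ℤ) : ℂ) * b j x ξ := by
  obtain ⟨S, hS, hsupp⟩ := hb.supp
  exact (USym.mul (uMul_coord k) hb.usym hρ).loc hS fun j x ξ h => by rw [hsupp j x ξ h, mul_zero]

/-- A smooth bump equal to `1` on the unit ball and supported in the ball of radius `2`. -/
def bumpB (n : ℕ) : ContDiffBump (0 : Fin n → ℝ) := ⟨1, 2, one_pos, one_lt_two⟩

/-- The low frequency cutoff profile. -/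
def bumpC (x : Fin n → ℝ) : ℂ := (bumpB n x : ℝ)

theorem smooth_bumpC : ContDiff ℝ (⊤ : ℕ∞) (bumpC (n := n)) :=
  Complex.ofRealCLM.contDiff.comp (bumpB n).contDiff

theorem bumpC_eq_one {x : Fin n → ℝ} (hx : ‖x‖ ≤ 1) : bumpC x = 1 := by
  rw [bumpC, (bumpB n).one_of_mem_closedBall (by simpa [bumpB] using hx)]; simp

theorem bumpC_eq_zero {x : Fin n → ℝ} (hx : 2 ≤ ‖x‖) : bumpC x = 0 := by
  rw [bumpC, (bumpB n).zero_of_le_dist (by simpa [bumpB] using hx)]; simp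

theorem norm_bumpC_le (x : Fin n → ℝ) : ‖bumpC x‖ ≤ 1 := by
  rw [bumpC, Complex.norm_real, Real.norm_of_nonneg (bumpB n).nonneg]; exact (bumpB n).le_one

theorem hasCompactSupport_bumpC : HasCompactSupport (bumpC (n := n)) :=
  (bumpB n).hasCompactSupport.comp_left (g := fun t : ℝ => (t : ℂ)) Complex.ofReal_zero

theorem pdw_bounded {f : (Fin n → ℝ) → ℂ} (hf : ContDiff ℝ (⊤ : ℕ∞) f) (hc : HasCompactSupport f)
    (u : List (Fin n)) : ∃ M, ∀ x, ‖pdw u f x‖ ≤ M := by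
  have h : HasCompactSupport (pdw u f) := by
    induction u with
    | nil => exact hc
    | cons k u ih =>
      exact (ih.fderiv (𝕜 := ℝ)).comp_left (g := fun L : (Fin n → ℝ) →L[ℝ] ℂ => L (Pi.single k 1)) rfl
  exact (smooth_pdw hf u).continuous.bounded_above_of_compact_support h

theorem norm_ddw_dilate_le (v : List (Fin n)) {G : (Fin n → ℝ) → ℂ} (hG : ContDiff ℝ (⊤ : ℕ∞) G)
    {M : ℝ} (hM : ∀ x, ‖pdw v G x‖ ≤ M) {h : ℝ} (hh : 0 ≤ h) (ξ : Fin n → ℤ) :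
    ‖ddw v (fun ξ => G (h • castZ ξ)) ξ‖ ≤ M * h ^ v.length := by
  induction v using List.reverseRecOn generalizing G M with
  | nil => simp only [List.length_nil, pow_zero, mul_one]; exact hM _
  | append_singleton v k ih =>
    have hGh : ContDiff ℝ (⊤ : ℕ∞) fun x => G (x + Pi.single k h) :=
      hG.comp (contDiff_id.add contDiff_const)
    have e : ddw [k] (fun ξ => G (h • castZ ξ)) = fun ξ =>
        (fun x => G (x + Pi.single k h) - G x) (h • castZ ξ) := by
      ext ξ
      simp only [ddw, List.foldr, dd]
      congr 2
      ext i
      by_cases hi : i = k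
      · subst hi; simp [castZ, mul_add]
      · simp [castZ, hi]
    rw [ddw_append, e]
    refine (ih (M := M * |h|) (hGh.sub hG) fun x => ?_).trans (le_of_eq ?_)
    · rw [pdw_sub hGh hG, pdw_comp_add]
      refine norm_sub_le_pd (smooth_pdw hG _) (fun x => ?_) h x
      have := hM x
      rwa [pdw_perm (List.perm_append_singleton k v) hG] at this
    · rw [abs_of_nonneg hh, List.length_append, List.length_singleton, pow_succ]; ring

/-- Low frequency cutoff at scale `2 ^ j`. -/
def cutLow (j : ℕ) (ξ : Fin n → ℤ) : ℂ := bumpC (((2:ℝ) ^ j)⁻¹ • castZ ξ)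

/-- Dyadic frequency cutoffs. -/
def cutDy : ℕ → (Fin n → ℤ) → ℂ
  | 0 => cutLow 0
  | j + 1 => fun ξ => cutLow (j + 1) ξ - cutLow j ξ

theorem sum_cutDy (J : ℕ) (ξ : Fin n → ℤ) : ∑ j ∈ Finset.range (J + 1), cutDy j ξ = cutLow J ξ := by
  induction J with
  | zero => simp [cutDy]
  | succ J ih => rw [Finset.sum_range_succ, ih]; simp [cutDy]

theorem norm_castZ_le (ξ : Fin n → ℤ) : ‖castZ ξ‖ ≤ jb ξ :=
  (pi_norm_le_iff_of_nonneg (jb_pos ξ).le).2 fun i => by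
    simpa [castZ] using abs_le_jb ξ i

theorem jb_le_norm_castZ (ξ : Fin n → ℤ) : jb ξ ≤ 1 + n * ‖castZ ξ‖ := by
  refine (jb_le_one_add_sum ξ).trans ?_
  have := Finset.sum_le_sum fun j (_ : j ∈ Finset.univ) => (norm_le_pi_norm (castZ ξ) j)
  simp [castZ] at this
  linarith

theorem cutLow_eq_zero {j : ℕ} {ξ : Fin n → ℤ} (h : 2 * 2 ^ j ≤ ‖castZ ξ‖) : cutLow j ξ = 0 := by
  refine bumpC_eq_zero ?_
  rw [norm_smul, Real.norm_of_nonneg (by positivity), ← div_eq_inv_mul, le_div_iff₀ (by positivity)]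
  exact h

theorem cutLow_eq_one {j : ℕ} {ξ : Fin n → ℤ} (h : ‖castZ ξ‖ ≤ 2 ^ j) : cutLow j ξ = 1 := by
  refine bumpC_eq_one ?_
  rw [norm_smul, Real.norm_of_nonneg (by positivity), ← div_eq_inv_mul, div_le_one (by positivity)]
  exact h

theorem cutDy_supp (j : ℕ) (ξ : Fin n → ℤ) (h : ¬ Shell (2 * n + 2) j ξ) : cutDy j ξ = 0 := by
  have hj := jb_le_norm_castZ ξ
  have hk := norm_castZ_le ξ
  have h1 := one_le_jb ξ
  have hp : (1:ℝ) ≤ 2 ^ j := one_le_pow₀ (by norm_num)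
  have hn : (0:ℝ) ≤ n := by positivity
  by_contra hne
  apply h
  rw [Shell, Real.rpow_natCast]
  have hlt : ‖castZ ξ‖ < 2 * 2 ^ j := by
    by_contra! hle
    apply hne
    cases j with
    | zero => exact cutLow_eq_zero hle
    | succ j =>
      simp only [cutDy]
      rw [cutLow_eq_zero hle, cutLow_eq_zero (by
        have : (0:ℝ) < 2 ^ j := by positivity
        rw [pow_succ] at hle; linarith), sub_zero]
  refine ⟨?_, by nlinarith⟩
  cases j with
  | zero => simp; nlinarith
  | succ j =>
    have : ¬ ‖castZ ξ‖ ≤ 2 ^ j := fun hle => by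
      apply hne
      simp only [cutDy]
      rw [cutLow_eq_one hle, cutLow_eq_one (by
        have : (0:ℝ) < 2 ^ j := by positivity
        rw [pow_succ]; linarith), sub_self]
    rw [pow_succ]; nlinarith

theorem uMul_cutDy : UMul 0 (cutDy (n := n)) := by
  have hB : ∀ v : List (Fin n), ∃ C : ℝ, 0 ≤ C ∧ ∀ j ξ, ‖ddw v (cutLow j) ξ‖ ≤ C * (((2:ℝ) ^ j)⁻¹) ^ v.length := by
    intro v
    obtain ⟨M, hM⟩ := pdw_bounded smooth_bumpC hasCompactSupport_bumpC v
    exact ⟨M, (norm_nonneg _).trans (hM 0), fun j ξ => norm_ddw_dilate_le v smooth_bumpC hM (by positivity) ξ⟩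
  have hL : LocSym 1 0 0 fun j (_ : Fin n → ℝ) ξ => cutDy j ξ := by
    refine ⟨fun j ξ => SmoothPer.const _, fun u v => ?_, 2 * n + 2, by
      have : (0:ℝ) ≤ n := by positivity
      linarith, fun j x ξ h => cutDy_supp j ξ h⟩
    cases u with
    | cons k u =>
      refine ⟨0, fun j x ξ => ?_⟩
      have h0 : ∀ c : ℂ, pdw (k :: u) (fun _ : Fin n → ℝ => c) = fun _ => 0 := fun c => by
        obtain ⟨u', l, h⟩ := List.eq_nil_or_concat (k :: u) |>.resolve_left (by simp)
        rw [h, List.concat_eq_append, pdw_append]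
        have : pdw [l] (fun _ : Fin n → ℝ => c) = fun _ => 0 := by ext x; simp [pdw, pd]
        rw [this, pdw_zero]
      rw [h0]; simp
    | nil =>
      obtain ⟨C, hC0, hC⟩ := hB v
      refine ⟨C + C * 2 ^ v.length, fun j x ξ => ?_⟩
      have e : (2:ℝ) ^ ((j:ℝ) * (0 - 1 * v.length + 0 * ([] : List (Fin n)).length)) =
          (((2:ℝ) ^ j)⁻¹) ^ v.length := by
        rw [Real.rpow_mul (by norm_num), Real.rpow_natCast]
        simp only [zero_mul, add_zero, one_mul, zero_sub]
        rw [Real.rpow_neg (by positivity), Real.rpow_natCast, inv_pow]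
      rw [e, pdw_nil]
      cases j with
      | zero =>
        refine (hC 0 ξ).trans ?_
        exact mul_le_mul_of_nonneg_right (le_add_of_nonneg_right (by positivity)) (by positivity)
      | succ j =>
        have e2 : ddw v (cutDy (j + 1)) ξ = ddw v (cutLow (j + 1)) ξ - ddw v (cutLow j) ξ := by
          have h := ddw_add v (cutLow (n := n) (j + 1)) fun ξ => (-1) * cutLow j ξ
          rw [ddw_const_mul] at h
          have h' := congrFun h ξ
          simp only [neg_mul, one_mul, ← sub_eq_add_neg] at h'
          exact h'
        rw [show (fun ξ => cutDy (j+1) ξ) = cutDy (n := n) (j + 1) from rfl, e2]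
        refine (norm_sub_le _ _).trans ?_
        rw [add_mul]
        refine add_le_add (hC _ ξ) ((hC _ ξ).trans (le_of_eq ?_))
        rw [mul_assoc, ← mul_pow]
        congr 2
        rw [pow_succ, mul_inv]; field_simp
  intro v
  obtain ⟨C, hC⟩ := hL.usym.bound [] v
  refine ⟨C, fun j ξ => ?_⟩
  have := hC j 0 ξ
  rw [pdw_nil] at this
  refine this.trans_eq ?_
  congr 2; simp

/-- The dyadic pieces of a symbol. -/
theorem loc_cutDy_mul {ρ δ μ : ℝ} (hρ : ρ ≤ 1) {a : (Fin n → ℝ) → (Fin n → ℤ) → ℂ}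
    (ha : USym ρ δ μ fun (_ : Unit) => a) :
    LocSym ρ δ 0 fun j x ξ => (((2:ℝ) ^ ((j:ℝ) * (-μ)) : ℝ) : ℂ) * (cutDy j ξ * a x ξ) := by
  have h1 : USym ρ δ (μ + 0) fun (j : ℕ) x ξ => cutDy j ξ * a x ξ :=
    USym.mul uMul_cutDy (ha.comp (κ := ℕ) fun _ => ()) hρ
  have h2 := h1.loc (S := 2 * n + 2) (by
      have : (0:ℝ) ≤ n := by positivity
      linarith) fun j x ξ h => by simp only [cutDy_supp j ξ h, zero_mul]
  exact (h2.scale (-μ)).congr_eq (by ring)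

theorem eLpNorm_two_eq (f : (Fin n → ℝ) → ℂ) :
    eLpNorm f 2 (μT n) = (∫⁻ x, ‖f x‖ₑ ^ (2:ℝ) ∂μT n) ^ ((1:ℝ) / 2) := by
  rw [eLpNorm_eq_lintegral_rpow_enorm_toReal two_ne_zero ofNat_ne_top]
  simp

theorem ddw_comp_update (g : (Fin n → ℤ) → ℂ) (k : Fin n) (t : ℤ) {v : List (Fin n)} (hk : k ∉ v)
    (ξ : Fin n → ℤ) :
    ddw v (fun ξ => g (Function.update ξ k t)) ξ = ddw v g (Function.update ξ k t) := by
  induction v generalizing ξ with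
  | nil => rfl
  | cons i v ih =>
    rw [List.mem_cons, not_or] at hk
    have e : Function.update (ξ + Pi.single i 1) k t = Function.update ξ k t + Pi.single i 1 := by
      ext j
      by_cases hj : j = k
      · subst hj; simp [hk.1]
      · simp [hj]
    rw [ddw_cons, ddw_cons, dd, dd, ih hk.2, ih hk.2, e]

theorem sub_eq_sum_dd (g : (Fin n → ℤ) → ℂ) (k : Fin n) (z ξ : Fin n → ℤ) {L : ℕ}
    (h : z k ≤ ξ k ∧ ξ k < z k + L) :
    g ξ = g (Function.update ξ k (z k)) + ∑ t ∈ Finset.range L,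
      (if z k + t < ξ k then 1 else 0) * dd k g (Function.update ξ k (z k + t)) := by
  obtain ⟨d, hd⟩ := Int.le.dest h.1
  have hdL : d < L := by omega
  have e : ∀ t : ℕ, dd k g (Function.update ξ k (z k + t)) =
      g (Function.update ξ k (z k + (t + 1 : ℕ))) - g (Function.update ξ k (z k + t)) := by
    intro t
    rw [dd]
    congr 2
    ext j
    by_cases hj : j = k
    · subst hj; simp; ring
    · simp [hj]
  have e2 : ∑ t ∈ Finset.range L, (if z k + t < ξ k then 1 else 0) * dd k g (Function.update ξ k (z k + t)) =
      ∑ t ∈ Finset.range d, dd k g (Function.update ξ k (z k + t)) := by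
    rw [← Finset.sum_subset (Finset.range_subset_range.2 hdL.le)]
    · refine Finset.sum_congr rfl fun t ht => ?_
      rw [Finset.mem_range] at ht
      rw [if_pos (by omega), one_mul]
    · intro t _ ht
      rw [Finset.mem_range] at ht
      rw [if_neg (by omega), zero_mul]
  rw [e2, Finset.sum_congr rfl fun t _ => e t,
    Finset.sum_range_sub fun t : ℕ => g (Function.update ξ k (z k + t))]
  rw [hd]
  simp

/-- A symbol varying slowly on a box acts boundedly on functions with spectrum in that box. -/
theorem eLpNorm_box_le {L : ℕ} (hL : 0 < L) (z : Fin n → ℤ) (F : Finset (Fin n → ℤ))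
    (hF : ∀ ξ ∈ F, ∀ i, z i ≤ ξ i ∧ ξ i < z i + L) (s : List (Fin n)) (hs : s.Nodup) :
    ∀ (B : (Fin n → ℝ) → (Fin n → ℤ) → ℂ) (M : ℝ), 0 ≤ M → (∀ ξ, Measurable fun x => B x ξ) →
    (∀ x ξ ξ', (∀ i ∈ s, ξ i = ξ' i) → B x ξ = B x ξ') →
    (∀ v : List (Fin n), v.Sublist s → ∀ x ξ, (∀ i, z i ≤ ξ i ∧ ξ i < z i + L) →
      ‖ddw v (B x) ξ‖ ≤ M * (1 / L) ^ v.length) → ∀ c : (Fin n → ℤ) → ℂ,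
    eLpNorm (fun x => ∑ ξ ∈ F, c ξ * B x ξ * eChar x ξ) 2 (μT n) ≤
      ENNReal.ofReal (2 ^ s.length * M) * (∑ ξ ∈ F, ‖c ξ‖ₑ ^ (2:ℝ)) ^ ((1:ℝ)/2) := by
  have hL' : (0:ℝ) < L := by exact_mod_cast hL
  induction s with
  | nil =>
    intro B M hM hB hdep hbd c
    have hz : ∀ i, z i ≤ z i ∧ z i < z i + L := fun i => ⟨le_rfl, by omega⟩
    have e : (fun x => ∑ ξ ∈ F, c ξ * B x ξ * eChar x ξ) =
        fun x => B x z * ∑ ξ ∈ F, c ξ * eChar x ξ := by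
      ext x
      rw [Finset.mul_sum]
      refine Finset.sum_congr rfl fun ξ _ => ?_
      rw [hdep x ξ z (by simp)]; ring
    rw [e, ← lintegral_sum_eChar_sq, ← eLpNorm_two_eq]
    have hb : ∀ x, ‖B x z‖ ≤ M := fun x => by
      have := hbd [] (List.Sublist.refl _) x z hz
      rw [ddw_nil] at this
      simpa using this
    have := eLpNorm_le_mul_eLpNorm_of_ae_le_mul (μ := μT n) (c := M)
      (f := fun x => B x z * ∑ ξ ∈ F, c ξ * eChar x ξ)
      (g := fun x => ∑ ξ ∈ F, c ξ * eChar x ξ) (Filter.Eventually.of_forall fun x => by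
        rw [norm_mul]; exact mul_le_mul_of_nonneg_right (hb x) (norm_nonneg _)) 2
    simpa using this
  | cons k s ih =>
    intro B M hM hB hdep hbd c
    obtain ⟨hks, hs'⟩ := List.nodup_cons.1 hs
    have hbox : ∀ ξ : Fin n → ℤ, (∀ i, z i ≤ ξ i ∧ ξ i < z i + L) → ∀ t : ℕ, t < L →
        ∀ i, z i ≤ (Function.update ξ k (z k + t)) i ∧ (Function.update ξ k (z k + t)) i < z i + L := by
      intro ξ hξ t ht i
      by_cases hi : i = k
      · subst hi; simp; omega
      · simpa [hi] using hξ i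
    have hdd : ∀ t : ℕ, ∀ ξ ξ' : Fin n → ℤ, (∀ i ∈ s, ξ i = ξ' i) →
        ∀ i ∈ k :: s, (Function.update ξ k (z k + t) : Fin n → ℤ) i = (Function.update ξ' k (z k + t) : Fin n → ℤ) i := by
      intro t ξ ξ' h i hi
      by_cases hik : i = k
      · subst hik; simp
      · simpa [hik] using h i ((List.mem_cons.1 hi).resolve_left hik)
    have hnot : ∀ v : List (Fin n), v.Sublist s → k ∉ v := fun v hv hk => hks (hv.subset hk)
    have e : (fun x => ∑ ξ ∈ F, c ξ * B x ξ * eChar x ξ) =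
        (fun x => ∑ ξ ∈ F, c ξ * B x (Function.update ξ k (z k + (0:ℕ))) * eChar x ξ) +
        ∑ t ∈ Finset.range L, fun x => ∑ ξ ∈ F, (c ξ * (if z k + t < ξ k then 1 else 0)) *
          dd k (B x) (Function.update ξ k (z k + t)) * eChar x ξ := by
      ext x
      rw [Pi.add_apply, Finset.sum_apply, Finset.sum_comm, ← Finset.sum_add_distrib]
      refine Finset.sum_congr rfl fun ξ hξ => ?_
      nth_rewrite 1 [sub_eq_sum_dd (B x) k z ξ (hF ξ hξ k)]
      rw [mul_add, add_mul, Finset.mul_sum, Finset.sum_mul]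
      simp only [Nat.cast_zero, add_zero]
      congr 1
      exact Finset.sum_congr rfl fun t _ => by ring
    have hmd : ∀ ξ, Measurable fun x => dd k (B x) ξ := fun ξ => (hB _).sub (hB _)
    have hm : ∀ (c : (Fin n → ℤ) → ℂ) (G : (Fin n → ℝ) → (Fin n → ℤ) → ℂ), (∀ ξ, Measurable fun x => G x ξ) →
        AEStronglyMeasurable (fun x => ∑ ξ ∈ F, c ξ * G x ξ * eChar x ξ) (μT n) := fun c G hG =>
      (Finset.measurable_fun_sum _ fun ξ _ => ((hG ξ).const_mul _).mul
        (continuous_eChar ξ).measurable).aestronglyMeasurable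
    have h0 := ih hs' (fun x ξ => B x (Function.update ξ k (z k + (0:ℕ)))) M hM (fun ξ => hB _)
      (fun x ξ ξ' h => hdep _ _ _ (hdd 0 ξ ξ' h)) (fun v hv x ξ hξ => by
        rw [ddw_comp_update _ _ _ (hnot v hv)]
        exact hbd v (hv.cons _) x _ (hbox ξ hξ 0 hL)) c
    have ht : ∀ t ∈ Finset.range L, eLpNorm (fun x => ∑ ξ ∈ F, (c ξ * (if z k + t < ξ k then 1 else 0)) *
          dd k (B x) (Function.update ξ k (z k + t)) * eChar x ξ) 2 (μT n) ≤
        ENNReal.ofReal (2 ^ s.length * (M * (1 / L))) * (∑ ξ ∈ F, ‖c ξ‖ₑ ^ (2:ℝ)) ^ ((1:ℝ)/2) := by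
      intro t ht
      refine (ih hs' (fun x ξ => dd k (B x) (Function.update ξ k (z k + t))) (M * (1 / L)) (by positivity)
        (fun ξ => hmd _)
        (fun x ξ ξ' h => ?_) (fun v hv x ξ hξ => ?_) _).trans ?_
      · rw [dd, dd]
        congr 1
        · refine hdep _ _ _ fun i hi => ?_
          rw [Pi.add_apply, Pi.add_apply, hdd t ξ ξ' h i hi]
        · exact hdep _ _ _ (hdd t ξ ξ' h)
      · rw [ddw_comp_update (dd k (B x)) _ _ (hnot v hv)]
        have := hbd (k :: v) (hv.cons_cons k) x _ (hbox ξ hξ t (Finset.mem_range.1 ht))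
        rw [ddw_perm (List.perm_append_singleton k v).symm, ddw_append, List.length_cons, pow_succ'] at this
        rw [mul_assoc]; exact this
      · gcongr
        split_ifs <;> simp
    rw [e]
    refine (eLpNorm_add_le (hm _ _ fun ξ => hB _) (Finset.aestronglyMeasurable_sum _ fun t _ => hm _ _ fun ξ => hmd _)
      one_le_two).trans ?_
    refine (add_le_add h0 ((eLpNorm_sum_le (fun t _ => hm _ _ fun ξ => hmd _) one_le_two).trans
      (Finset.sum_le_sum ht))).trans (le_of_eq ?_)
    rw [Finset.sum_const, Finset.card_range, nsmul_eq_mul, ← mul_assoc, ← add_mul]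
    congr 1
    rw [← ENNReal.ofReal_natCast, ← ENNReal.ofReal_mul (by positivity), ← ENNReal.ofReal_add (by positivity) (by positivity)]
    congr 1
    rw [List.length_cons, pow_succ]
    field_simp
    ring

/-- A square summable weight on `ℤⁿ`. -/
def latWt (ζ : Fin n → ℤ) : ℝ≥0∞ := ∏ i, ENNReal.ofReal ((1 + |(ζ i : ℝ)|)⁻¹)

theorem tsum_one_dim_ne_top : ∑' k : ℤ, ENNReal.ofReal ((1 + |(k : ℝ)|)⁻¹) ^ (2:ℝ) ≠ ⊤ := by
  have h : Summable fun k : ℤ => ((1 + |(k : ℝ)|)⁻¹) ^ (2:ℝ) := by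
    have h0 : Summable fun k : ℕ => ((1 + (k:ℝ))⁻¹) ^ (2:ℝ) := by
      have := (summable_nat_add_iff (f := fun k : ℕ => 1 / (k:ℝ) ^ 2) 1).2
        (Real.summable_one_div_nat_pow.2 one_lt_two)
      refine this.congr fun k => ?_
      push_cast
      rw [Real.rpow_two, inv_pow, one_div, add_comm]
    refine Summable.of_nat_of_neg ?_ ?_ <;> simpa using h0
  have := h.tsum_ofReal_ne_top
  refine (lt_of_le_of_lt (le_of_eq (tsum_congr fun k => ?_)) (lt_top_iff_ne_top.2 this)).ne
  rw [ENNReal.ofReal_rpow_of_nonneg (by positivity) (by norm_num)]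

theorem tsum_latWt_ne_top : ∑' ζ : Fin n → ℤ, latWt ζ ^ (2:ℝ) ≠ ⊤ := by
  refine ne_top_of_le_ne_top (b := (∑' k : ℤ, ENNReal.ofReal ((1 + |(k : ℝ)|)⁻¹) ^ (2:ℝ)) ^ n)
    (ENNReal.pow_ne_top tsum_one_dim_ne_top) ?_
  rw [ENNReal.tsum_eq_iSup_sum]
  refine iSup_le fun G => ?_
  classical
  calc ∑ ζ ∈ G, latWt ζ ^ (2:ℝ)
      ≤ ∑ ζ ∈ Fintype.piFinset fun i => G.image fun ζ : Fin n → ℤ => ζ i, latWt ζ ^ (2:ℝ) :=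
        Finset.sum_le_sum_of_subset fun ζ hζ => Fintype.mem_piFinset.2 fun i =>
          Finset.mem_image_of_mem _ hζ
    _ = ∑ ζ ∈ Fintype.piFinset fun i => G.image fun ζ : Fin n → ℤ => ζ i,
          ∏ i, ENNReal.ofReal ((1 + |(ζ i : ℝ)|)⁻¹) ^ (2:ℝ) :=
        Finset.sum_congr rfl fun ζ _ => (ENNReal.prod_rpow_of_nonneg two_pos.le).symm
    _ = ∏ i, ∑ k ∈ G.image fun ζ : Fin n → ℤ => ζ i, ENNReal.ofReal ((1 + |(k : ℝ)|)⁻¹) ^ (2:ℝ) :=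
        (Finset.prod_univ_sum (fun i => G.image fun ζ : Fin n → ℤ => ζ i)
          fun _ k => ENNReal.ofReal ((1 + |(k : ℝ)|)⁻¹) ^ (2:ℝ)).symm
    _ ≤ ∏ _i : Fin n, ∑' k : ℤ, ENNReal.ofReal ((1 + |(k : ℝ)|)⁻¹) ^ (2:ℝ) :=
        Finset.prod_le_prod' fun i _ => ENNReal.sum_le_tsum _
    _ = _ := by simp

theorem sum_mul_sq_le {ι : Type*} (s : Finset ι) (f g : ι → ℝ≥0∞) :
    (∑ i ∈ s, f i * g i) ^ (2:ℝ) ≤ (∑ i ∈ s, f i ^ (2:ℝ)) * ∑ i ∈ s, g i ^ (2:ℝ) := by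
  refine (ENNReal.rpow_le_rpow (ENNReal.inner_le_Lp_mul_Lq s f g Real.HolderConjugate.two_two)
    (by norm_num)).trans (le_of_eq ?_)
  rw [ENNReal.mul_rpow_of_nonneg _ _ (by norm_num), ← ENNReal.rpow_mul, ← ENNReal.rpow_mul]
  norm_num

theorem ennreal_add_sq_le (a b : ℝ≥0∞) : (a + b) ^ (2:ℝ) ≤ 2 * a ^ (2:ℝ) + 2 * b ^ (2:ℝ) := by
  have := ENNReal.rpow_add_le_mul_rpow_add_rpow a b (p := 2) (by norm_num)
  refine this.trans (le_of_eq ?_)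
  rw [mul_add]; norm_num

/-- Schur's test for matrices bounded by a summable convolution kernel. -/
theorem tsum_sq_schur_le (F : Finset (Fin n → ℤ)) (c : (Fin n → ℤ) → ℂ) (C : ℝ≥0∞)
    (h : (Fin n → ℤ) → ℝ≥0∞) (hh : ∀ η, h η ≤ ∑ ξ ∈ F, ‖c ξ‖ₑ * (C * latWt (η - ξ) ^ (2:ℝ))) :
    ∑' η, h η ^ (2:ℝ) ≤ (C * ∑' ζ : Fin n → ℤ, latWt ζ ^ (2:ℝ)) ^ (2:ℝ) * ∑ ξ ∈ F, ‖c ξ‖ₑ ^ (2:ℝ) := by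
  set S := ∑' ζ : Fin n → ℤ, latWt ζ ^ (2:ℝ) with hS
  have hev : ∀ η : Fin n → ℤ, ∑ ξ ∈ F, latWt (η - ξ) ^ (2:ℝ) ≤ S := fun η => by
    refine (ENNReal.sum_le_tsum F).trans (le_of_eq ?_)
    exact (Equiv.subLeft η).tsum_eq fun ζ => latWt ζ ^ (2:ℝ)
  have h1 : ∀ η, h η ^ (2:ℝ) ≤ C ^ (2:ℝ) * S * ∑ ξ ∈ F, ‖c ξ‖ₑ ^ (2:ℝ) * latWt (η - ξ) ^ (2:ℝ) := by
    intro η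
    have e : ∑ ξ ∈ F, ‖c ξ‖ₑ * (C * latWt (η - ξ) ^ (2:ℝ)) =
        ∑ ξ ∈ F, (‖c ξ‖ₑ * latWt (η - ξ)) * (C * latWt (η - ξ)) := by
      refine Finset.sum_congr rfl fun ξ _ => ?_
      rw [ENNReal.rpow_two, sq]; ring
    refine (ENNReal.rpow_le_rpow (hh η) (by norm_num)).trans ?_
    rw [e]
    refine (sum_mul_sq_le _ _ _).trans ?_
    simp only [ENNReal.mul_rpow_of_nonneg _ _ (by norm_num : (0:ℝ) ≤ 2)]
    rw [← Finset.mul_sum, mul_comm]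
    gcongr
    exact hev η
  refine (ENNReal.tsum_le_tsum h1).trans ?_
  rw [ENNReal.tsum_mul_left, Summable.tsum_finsetSum fun _ _ => ENNReal.summable]
  simp only [ENNReal.tsum_mul_left]
  have e : ∀ ξ : Fin n → ℤ, ∑' η : Fin n → ℤ, latWt (η - ξ) ^ (2:ℝ) = S := fun ξ =>
    (Equiv.subRight ξ).tsum_eq fun ζ => latWt ζ ^ (2:ℝ)
  simp only [e]
  rw [← Finset.sum_mul, ENNReal.mul_rpow_of_nonneg _ _ (by norm_num : (0:ℝ) ≤ 2), ENNReal.rpow_two, ENNReal.rpow_two]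
  apply le_of_eq; ring

/-- Almost orthogonality over a partition of frequency space into cells. -/
theorem lintegral_sq_le_of_cells {κ : Type*} [DecidableEq κ] {b : (Fin n → ℝ) → (Fin n → ℤ) → ℂ}
    (hb : ∀ ξ, BddMeas fun x => b x ξ) (q : (Fin n → ℤ) → κ) (F : Finset (Fin n → ℤ))
    (N₀ : ℕ) (K C : ℝ≥0∞) (c : (Fin n → ℤ) → ℂ)
    (hcell : ∀ Q, ∫⁻ x, ‖∑ ξ ∈ F with q ξ = Q, c ξ * b x ξ * eChar x ξ‖ₑ ^ (2:ℝ) ∂μT n ≤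
      K * ∑ ξ ∈ F with q ξ = Q, ‖c ξ‖ₑ ^ (2:ℝ))
    (hfar : ∀ η, ∃ A : Finset κ, A.card ≤ N₀ ∧ ∀ ξ ∈ F, q ξ ∉ A →
      ‖fc (fun x => b x ξ) (η - ξ)‖ₑ ≤ C * latWt (η - ξ) ^ (2:ℝ)) :
    ∫⁻ x, ‖∑ ξ ∈ F, c ξ * b x ξ * eChar x ξ‖ₑ ^ (2:ℝ) ∂μT n ≤
      (2 * (N₀ * K) + 2 * (C * ∑' ζ : Fin n → ℤ, latWt ζ ^ (2:ℝ)) ^ (2:ℝ)) *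
        ∑ ξ ∈ F, ‖c ξ‖ₑ ^ (2:ℝ) := by
  have hbt : ∀ ξ, BddMeas fun x => c ξ * b x ξ * eChar x ξ := fun ξ =>
    ((hb ξ).const_mul _).mul (bddMeas_eChar ξ)
  have hfc : ∀ (G : Finset (Fin n → ℤ)) (η : Fin n → ℤ),
      fc (fun x => ∑ ξ ∈ G, c ξ * b x ξ * eChar x ξ) η =
        ∑ ξ ∈ G, c ξ * fc (fun x => b x ξ) (η - ξ) := by
    intro G η
    rw [fc_sum _ fun ξ _ => hbt ξ]
    refine Finset.sum_congr rfl fun ξ _ => ?_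
    rw [← fc_eChar_mul, ← fc_const_mul]
    congr 1; ext x; ring
  set g : κ → (Fin n → ℝ) → ℂ := fun Q x => ∑ ξ ∈ F with q ξ = Q, c ξ * b x ξ * eChar x ξ with hg
  rw [← tsum_fc_sq (bddMeas_sum F hbt)]
  choose A hA1 hA2 using hfar
  have hsplit : ∀ η, ‖fc (fun x => ∑ ξ ∈ F, c ξ * b x ξ * eChar x ξ) η‖ₑ ≤
      (∑ Q ∈ A η, ‖fc (g Q) η‖ₑ) +
        ∑ ξ ∈ F with q ξ ∉ A η, ‖c ξ‖ₑ * ‖fc (fun x => b x ξ) (η - ξ)‖ₑ := by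
    intro η
    rw [hfc, ← Finset.sum_filter_add_sum_filter_not F fun ξ => q ξ ∈ A η]
    refine (enorm_add_le _ _).trans (add_le_add ?_ ?_)
    · rw [← Finset.sum_fiberwise_of_maps_to (g := q) (t := A η) fun ξ hξ => (Finset.mem_filter.1 hξ).2]
      refine (enorm_sum_le _ _).trans (le_of_eq (Finset.sum_congr rfl fun Q hQ => ?_))
      rw [hg]
      simp only
      rw [hfc, Finset.filter_filter]
      congr 2
      ext ξ
      simp only [Finset.mem_filter]
      constructor
      · rintro ⟨h1, h2, h3⟩; exact ⟨h1, h3⟩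
      · rintro ⟨h1, h3⟩; exact ⟨h1, h3 ▸ hQ, h3⟩
    · refine (enorm_sum_le _ _).trans (le_of_eq (Finset.sum_congr rfl fun ξ _ => enorm_mul _ _))
  have hnr : ∀ η, (∑ Q ∈ A η, ‖fc (g Q) η‖ₑ) ^ (2:ℝ) ≤ N₀ * ∑ Q ∈ F.image q, ‖fc (g Q) η‖ₑ ^ (2:ℝ) := by
    intro η
    refine (ENNReal.rpow_sum_le_const_mul_sum_rpow _ _ one_le_two).trans ?_
    have e : (2:ℝ) - 1 = 1 := by norm_num
    rw [e, ENNReal.rpow_one]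
    refine mul_le_mul' (by exact_mod_cast hA1 η) (Finset.sum_le_sum_of_ne_zero fun Q _ hQ => ?_)
    by_contra hn
    apply hQ
    have : (F.filter fun ξ => q ξ = Q) = ∅ := Finset.filter_eq_empty_iff.2 fun ξ hξ h =>
      hn (Finset.mem_image.2 ⟨ξ, hξ, h⟩)
    rw [hg]
    simp only
    rw [hfc, this]
    simp
  have hN : ∑' η, (∑ Q ∈ A η, ‖fc (g Q) η‖ₑ) ^ (2:ℝ) ≤ N₀ * K * ∑ ξ ∈ F, ‖c ξ‖ₑ ^ (2:ℝ) := by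
    refine (ENNReal.tsum_le_tsum hnr).trans ?_
    rw [ENNReal.tsum_mul_left, Summable.tsum_finsetSum fun _ _ => ENNReal.summable, mul_assoc]
    gcongr
    rw [← Finset.sum_fiberwise_of_maps_to (g := q) (t := F.image q) fun ξ hξ => Finset.mem_image_of_mem _ hξ,
      Finset.mul_sum]
    refine Finset.sum_le_sum fun Q _ => ?_
    rw [tsum_fc_sq (bddMeas_sum _ hbt)]
    exact hcell Q
  have hFar := tsum_sq_schur_le F c C
    (fun η => ∑ ξ ∈ F with q ξ ∉ A η, ‖c ξ‖ₑ * ‖fc (fun x => b x ξ) (η - ξ)‖ₑ) fun η => by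
      refine (Finset.sum_le_sum fun ξ hξ => ?_).trans
        (Finset.sum_le_sum_of_subset (Finset.filter_subset (fun ξ => q ξ ∉ A η) F))
      rw [Finset.mem_filter] at hξ
      gcongr
      exact hA2 η ξ hξ.1 hξ.2
  refine (ENNReal.tsum_le_tsum fun η => (ENNReal.rpow_le_rpow (hsplit η) two_pos.le).trans
    (ennreal_add_sq_le _ _)).trans ?_
  rw [ENNReal.tsum_add, ENNReal.tsum_mul_left, ENNReal.tsum_mul_left, add_mul, mul_assoc 2, mul_assoc 2]
  gcongr

/-- Integer valued frequency size. -/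
def natSize (ξ : Fin n → ℤ) : ℕ := 1 + ∑ i, (ξ i).natAbs

/-- Dyadic level of a frequency. -/
def freqLev (ξ : Fin n → ℤ) : ℕ := Nat.log 2 (natSize ξ)

/-- Side length of the frequency cells at level `j`. -/
def cellSide (n : ℕ) (ρ : ℝ) (j : ℕ) : ℕ := ⌈(2:ℝ) ^ ((j:ℝ) * ρ) / (8 * n)⌉₊

/-- Cell containing a frequency. -/
def freqCell (ρ : ℝ) (ξ : Fin n → ℤ) : ℕ × (Fin n → ℤ) :=
  (freqLev ξ, fun i => ξ i / (cellSide n ρ (freqLev ξ) : ℤ))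

theorem natSize_cast (ξ : Fin n → ℤ) : (natSize ξ : ℝ) = 1 + ∑ i, |(ξ i : ℝ)| := by
  simp [natSize, Nat.cast_natAbs]

theorem two_pow_freqLev_le (ξ : Fin n → ℤ) : (2:ℝ) ^ freqLev ξ ≤ natSize ξ := by
  exact_mod_cast Nat.pow_log_le_self 2 (by simp [natSize])

theorem natSize_lt (ξ : Fin n → ℤ) : (natSize ξ : ℝ) < 2 * 2 ^ freqLev ξ := by
  have := Nat.lt_pow_succ_log_self one_lt_two (natSize ξ)
  rw [pow_succ'] at this
  exact_mod_cast this

theorem abs_natSize_sub_le (ξ η : Fin n → ℤ) {T : ℝ} (h : ∀ i, |(η i : ℝ) - ξ i| ≤ T) :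
    |(natSize η : ℝ) - natSize ξ| ≤ n * T := by
  rw [natSize_cast, natSize_cast, add_sub_add_left_eq_sub, ← Finset.sum_sub_distrib]
  refine (Finset.abs_sum_le_sum_abs _ _).trans ((Finset.sum_le_sum fun i _ =>
    (abs_abs_sub_abs_le _ _).trans (h i)).trans (le_of_eq ?_))
  simp

section
variable {ρ : ℝ}

theorem scale_le (hρ : ρ ≤ 1) (j : ℕ) : (2:ℝ) ^ ((j:ℝ) * ρ) ≤ 2 ^ j := by
  rw [← Real.rpow_natCast]
  exact Real.rpow_le_rpow_of_exponent_le one_le_two (mul_le_of_le_one_right (by positivity) hρ)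

theorem one_le_scale (hρ : 0 ≤ ρ) (j : ℕ) : 1 ≤ (2:ℝ) ^ ((j:ℝ) * ρ) :=
  Real.one_le_rpow one_le_two (by positivity)

theorem cellSide_pos (hn : 1 ≤ n) (j : ℕ) : 0 < cellSide n ρ j :=
  Nat.ceil_pos.2 (by positivity)

theorem scale_le_cellSide (j : ℕ) : (2:ℝ) ^ ((j:ℝ) * ρ) / (8 * n) ≤ cellSide n ρ j := Nat.le_ceil _

theorem cellSide_lt (j : ℕ) : (cellSide n ρ j : ℝ) < (2:ℝ) ^ ((j:ℝ) * ρ) / (8 * n) + 1 :=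
  Nat.ceil_lt_add_one (by positivity)

theorem cellSide_le (hρ : 0 ≤ ρ) (hn : 1 ≤ n) (j : ℕ) : (cellSide n ρ j : ℝ) ≤ 2 * (2:ℝ) ^ ((j:ℝ) * ρ) := by
  have h1 := one_le_scale hρ j
  have hn' : (1:ℝ) ≤ n := by exact_mod_cast hn
  have : (2:ℝ) ^ ((j:ℝ) * ρ) / (8 * n) ≤ (2:ℝ) ^ ((j:ℝ) * ρ) := div_le_self (by positivity) (by linarith)
  linarith [cellSide_lt (n := n) (ρ := ρ) j]

/-- Frequencies in a common cell box have comparable size. -/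
theorem jb_lower_of_box (hn : 1 ≤ n) (hρ : ρ ≤ 1) {ξ₀ ξ z : Fin n → ℤ}
    (h0 : ∀ i, z i ≤ ξ₀ i ∧ ξ₀ i < z i + cellSide n ρ (freqLev ξ₀))
    (h : ∀ i, z i ≤ ξ i ∧ ξ i < z i + cellSide n ρ (freqLev ξ₀)) :
    (2:ℝ) ^ freqLev ξ₀ ≤ 2 * (n + 1) * jb ξ := by
  set j := freqLev ξ₀ with hj
  have hn' : (0:ℝ) < n := by exact_mod_cast hn
  have hd : ∀ i, |(ξ i : ℝ) - ξ₀ i| ≤ (2:ℝ) ^ ((j:ℝ) * ρ) / (8 * n) := by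
    intro i
    have h1 : |ξ i - ξ₀ i| ≤ (cellSide n ρ j : ℤ) - 1 := by
      have := h0 i; have := h i; rw [abs_le]; omega
    have h2 : (|(ξ i : ℝ) - ξ₀ i|) ≤ (cellSide n ρ j : ℝ) - 1 := by exact_mod_cast h1
    linarith [cellSide_lt (n := n) (ρ := ρ) j]
  have h3 := abs_natSize_sub_le ξ₀ ξ hd
  rw [show (n:ℝ) * ((2:ℝ) ^ ((j:ℝ) * ρ) / (8 * n)) = (2:ℝ) ^ ((j:ℝ) * ρ) / 8 by field_simp] at h3
  have h4 := (abs_le.1 h3).1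
  have h5 := scale_le hρ j
  have h6 := two_pow_freqLev_le ξ₀
  have h7 := one_add_sum_le_jb ξ
  rw [← natSize_cast] at h7
  have : (0:ℝ) < 2 ^ j := by positivity
  nlinarith

/-- All frequencies close to `η` lie in boundedly many cells. -/
theorem exists_near_cells (hn : 1 ≤ n) (hρ : ρ ≤ 1) (η : Fin n → ℤ) :
    ∃ A : Finset (ℕ × (Fin n → ℤ)), A.card ≤ 3 * 3 ^ n ∧ ∀ ξ : Fin n → ℤ, freqCell ρ ξ ∉ A →
      ∃ i, (2:ℝ) ^ ((freqLev ξ : ℝ) * ρ) < 8 * n * |(η i : ℝ) - ξ i| := by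
  classical
  have hn' : (0:ℝ) < n := by exact_mod_cast hn
  refine ⟨((Finset.Icc (freqLev η - 1) (freqLev η + 1)) ×ˢ
    (Fintype.piFinset fun _ : Fin n => Finset.Icc (-1:ℤ) 1)).image
      fun t => (t.1, fun i => η i / (cellSide n ρ t.1 : ℤ) + t.2 i), ?_, ?_⟩
  · refine Finset.card_image_le.trans ?_
    rw [Finset.card_product, Fintype.card_piFinset]
    refine Nat.mul_le_mul ?_ ?_
    · rw [Nat.card_Icc]; omega
    · simp
  · intro ξ hξ
    by_contra! hcon
    apply hξ
    set j := freqLev ξ with hj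
    have hd : ∀ i, |(η i : ℝ) - ξ i| ≤ (2:ℝ) ^ ((j:ℝ) * ρ) / (8 * n) := fun i => by
      rw [le_div_iff₀ (by positivity), mul_comm]; exact hcon i
    have h3 := abs_natSize_sub_le ξ η hd
    rw [show (n:ℝ) * ((2:ℝ) ^ ((j:ℝ) * ρ) / (8 * n)) = (2:ℝ) ^ ((j:ℝ) * ρ) / 8 by field_simp] at h3
    obtain ⟨h4, h4'⟩ := abs_le.1 h3
    have h5 := scale_le hρ j
    have h6 := two_pow_freqLev_le ξ
    have h7 := natSize_lt ξ
    have hp : (0:ℝ) < 2 ^ j := by positivity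
    have hlo : 2 ^ j ≤ natSize η * 2 := by
      have : (2:ℝ) ^ j ≤ natSize η * 2 := by linarith
      exact_mod_cast this
    have hhi : natSize η < 2 ^ (j + 2) := by
      have : (natSize η : ℝ) < 2 ^ (j + 2) := by rw [pow_add]; linarith
      exact_mod_cast this
    have hne : natSize η ≠ 0 := by simp [natSize]
    have h8 : freqLev η < j + 2 := Nat.log_lt_of_lt_pow hne hhi
    have h9 : j ≤ freqLev η + 1 := by
      rw [freqLev, ← Nat.log_mul_base one_lt_two hne]
      exact Nat.le_log_of_pow_le one_lt_two hlo
    rw [Finset.mem_image]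
    refine ⟨(j, fun i => ξ i / (cellSide n ρ j : ℤ) - η i / (cellSide n ρ j : ℤ)), ?_, ?_⟩
    · rw [Finset.mem_product, Finset.mem_Icc, Fintype.mem_piFinset]
      refine ⟨⟨by simp only; omega, by simp only; omega⟩, fun i => ?_⟩
      have hL : (0:ℤ) < cellSide n ρ j := by exact_mod_cast cellSide_pos hn j
      have hdi : |η i - ξ i| ≤ (cellSide n ρ j : ℤ) := by
        have := (hd i).trans (scale_le_cellSide j)
        exact_mod_cast this
      obtain ⟨ha, hb⟩ := abs_le.1 hdi
      rw [Finset.mem_Icc]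
      have e1 := Int.ediv_le_ediv hL (show η i ≤ ξ i + 1 * (cellSide n ρ j : ℤ) by linarith)
      have e2 := Int.ediv_le_ediv hL (show ξ i ≤ η i + 1 * (cellSide n ρ j : ℤ) by linarith)
      rw [Int.add_mul_ediv_right _ _ hL.ne'] at e1 e2
      constructor <;> simp only <;> linarith
    · simp only [freqCell, ← hj]
      congr 1
      ext i
      ring

end

section
variable {ι : Type*} {ρ δ : ℝ} {b : ι → (Fin n → ℝ) → (Fin n → ℤ) → ℂ}

theorem ofReal_le_latWt_sq {ζ : Fin n → ℤ} {T : ℝ} (hT : 1 ≤ T) (h : ∀ i, |(ζ i : ℝ)| ≤ T) :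
    ENNReal.ofReal ((T⁻¹) ^ (2 * n)) ≤ ENNReal.ofReal (4 ^ n) * latWt ζ ^ (2:ℝ) := by
  have hT0 : (0:ℝ) < T := by linarith
  rw [latWt, ← ENNReal.ofReal_prod_of_nonneg (fun i _ => by positivity),
    ENNReal.ofReal_rpow_of_nonneg (Finset.prod_nonneg fun i _ => by positivity) two_pos.le,
    ← ENNReal.ofReal_mul (by positivity), Real.rpow_two]
  refine ENNReal.ofReal_le_ofReal ?_
  have h1 : ((2 * T)⁻¹) ^ n ≤ ∏ i, (1 + |(ζ i : ℝ)|)⁻¹ := by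
    have := Finset.prod_le_prod (s := Finset.univ) (f := fun _ : Fin n => (2 * T)⁻¹)
      (g := fun i => (1 + |(ζ i : ℝ)|)⁻¹) (fun i _ => by positivity)
      (fun i _ => inv_anti₀ (by positivity) (by linarith [h i]))
    simpa using this
  calc (T⁻¹) ^ (2 * n) = 4 ^ n * (((2 * T)⁻¹) ^ n) ^ 2 := by
        rw [← pow_mul, mul_comm n 2, pow_mul, pow_mul, ← mul_pow]
        congr 1
        rw [mul_inv]; ring
    _ ≤ _ := by gcongr

theorem fc_far_le (hn : 1 ≤ n) (hδ0 : 0 ≤ δ) (hδρ : δ < ρ) (hρ1 : ρ ≤ 1) (hb : USym ρ δ 0 b) :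
    ∃ C : ℝ≥0∞, C ≠ ⊤ ∧ ∀ i ξ (ζ : Fin n → ℤ),
      (∃ k, (2:ℝ) ^ ((freqLev ξ : ℝ) * ρ) < 8 * n * |(ζ k : ℝ)|) →
      ‖fc (fun x => b i x ξ) ζ‖ₑ ≤ C * latWt ζ ^ (2:ℝ) := by
  have hρ0 : 0 < ρ := hδ0.trans_lt hδρ
  have hn' : (1:ℝ) ≤ n := by exact_mod_cast hn
  obtain ⟨N, hN⟩ := exists_nat_ge (2 * n / (1 - δ / ρ))
  have hr : 0 < 1 - δ / ρ := by rw [sub_pos, div_lt_one hρ0]; exact hδρ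
  rw [div_le_iff₀ hr] at hN
  have hCk : ∀ k : Fin n, ∃ C : ℝ, 0 ≤ C ∧ ∀ i x ξ, ‖pdw (List.replicate N k) (fun x => b i x ξ) x‖ ≤
      C * jb ξ ^ (δ * N) := by
    intro k
    obtain ⟨C, h0, hC⟩ := hb.exists_bound (List.replicate N k) []
    refine ⟨C, h0, fun i x ξ => ?_⟩
    have := hC i x ξ
    simpa [ddw_nil] using this
  choose C hC0 hC using hCk
  set D := (∑ k, C k) * (16 * n) ^ (δ / ρ * N) with hD
  refine ⟨ENNReal.ofReal D * ENNReal.ofReal (4 ^ n), ENNReal.mul_ne_top ofReal_ne_top ofReal_ne_top, ?_⟩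
  rintro i ξ ζ ⟨k₀, hk₀⟩
  obtain ⟨k, -, hk⟩ := Finset.exists_max_image (Finset.univ : Finset (Fin n)) (fun k => |(ζ k : ℝ)|) ⟨k₀, Finset.mem_univ _⟩
  set T := |(ζ k : ℝ)| with hT
  have hkT : (2:ℝ) ^ ((freqLev ξ : ℝ) * ρ) < 8 * n * T :=
    hk₀.trans_le (mul_le_mul_of_nonneg_left (hk k₀ (Finset.mem_univ _)) (by positivity))
  have hT0 : 0 < T := by
    have : 0 < (2:ℝ) ^ ((freqLev ξ : ℝ) * ρ) := by positivity
    have h := this.trans hkT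
    exact pos_of_mul_pos_right h (by positivity)
  have hζ : ζ k ≠ 0 := by
    intro h; rw [hT, h] at hT0; simp at hT0
  have hT1 : 1 ≤ T := by rw [hT]; exact_mod_cast Int.one_le_abs hζ
  have hjb : jb ξ ^ (δ * N) ≤ (16 * n) ^ (δ / ρ * N) * T ^ (δ / ρ * N) := by
    have h1 : jb ξ ≤ 2 * 2 ^ freqLev ξ := by
      refine (jb_le_one_add_sum ξ).trans ?_
      rw [← natSize_cast]; exact (natSize_lt ξ).le
    have h2 : jb ξ ^ ρ ≤ 16 * n * T := by
      refine (Real.rpow_le_rpow (jb_pos ξ).le h1 hρ0.le).trans ?_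
      rw [Real.mul_rpow two_pos.le (by positivity), ← Real.rpow_natCast, ← Real.rpow_mul two_pos.le]
      have : (2:ℝ) ^ ρ ≤ 2 := by simpa using Real.rpow_le_rpow_of_exponent_le one_le_two hρ1
      nlinarith [show 0 < (2:ℝ) ^ ((freqLev ξ : ℝ) * ρ) by positivity]
    rw [← Real.mul_rpow (by positivity) hT0.le]
    have e : δ * N = ρ * (δ / ρ * N) := by field_simp
    rw [e, Real.rpow_mul (jb_pos ξ).le]
    exact Real.rpow_le_rpow (Real.rpow_nonneg (jb_pos ξ).le _) h2 (by positivity)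
  have hmain : ‖fc (fun x => b i x ξ) ζ‖ ≤ D * (T⁻¹) ^ (2 * n) := by
    refine (norm_fc_decay hζ N (hb.smooth i ξ) fun x => hC k i x ξ).trans ?_
    have h1 : (1 / (4 * T)) ^ N ≤ (T⁻¹) ^ N := by
      refine pow_le_pow_left₀ (by positivity) ?_ N
      rw [one_div]; exact inv_anti₀ hT0 (by linarith)
    have h2 : T ^ (δ / ρ * N) * (T⁻¹) ^ N ≤ (T⁻¹) ^ (2 * n) := by
      rw [inv_pow, inv_pow, ← Real.rpow_natCast, ← Real.rpow_natCast, ← Real.rpow_neg hT0.le, ← Real.rpow_neg hT0.le,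
        ← Real.rpow_add hT0]
      refine Real.rpow_le_rpow_of_exponent_le hT1 ?_
      push_cast
      nlinarith
    calc C k * jb ξ ^ (δ * N) * (1 / (4 * T)) ^ N
        ≤ (∑ k, C k) * ((16 * n) ^ (δ / ρ * N) * T ^ (δ / ρ * N)) * (T⁻¹) ^ N := by
          have := Finset.single_le_sum (fun k _ => hC0 k) (Finset.mem_univ k)
          have h3 : 0 ≤ jb ξ ^ (δ * N) := Real.rpow_nonneg (jb_pos ξ).le _
          have h4 : 0 ≤ ∑ k, C k := Finset.sum_nonneg fun k _ => hC0 k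
          gcongr
      _ = D * (T ^ (δ / ρ * N) * (T⁻¹) ^ N) := by rw [hD]; ring
      _ ≤ _ := by
          refine mul_le_mul_of_nonneg_left h2 ?_
          exact mul_nonneg (Finset.sum_nonneg fun k _ => hC0 k) (by positivity)
  rw [← ofReal_norm, mul_assoc]
  refine (ENNReal.ofReal_le_ofReal hmain).trans ?_
  rw [ENNReal.ofReal_mul (mul_nonneg (Finset.sum_nonneg fun k _ => hC0 k) (by positivity))]
  gcongr
  exact ofReal_le_latWt_sq hT1 fun i => hk i (Finset.mem_univ _)

theorem lintegral_cell_le (hn : 1 ≤ n) (hρ0 : 0 ≤ ρ) (hρ1 : ρ ≤ 1) (hb : USym ρ δ 0 b) :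
    ∃ K : ℝ≥0∞, K ≠ ⊤ ∧ ∀ i (F : Finset (Fin n → ℤ)) (c : (Fin n → ℤ) → ℂ) (Q : ℕ × (Fin n → ℤ)),
      ∫⁻ x, ‖∑ ξ ∈ F with freqCell ρ ξ = Q, c ξ * b i x ξ * eChar x ξ‖ₑ ^ (2:ℝ) ∂μT n ≤
        K * ∑ ξ ∈ F with freqCell ρ ξ = Q, ‖c ξ‖ₑ ^ (2:ℝ) := by
  choose C hC0 hC using fun v : List (Fin n) => hb.exists_bound [] v
  set S := (List.finRange n).sublists.toFinset
  set M := ∑ v ∈ S, C v * (4 * (n + 1)) ^ v.length with hM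
  have hM0 : 0 ≤ M := Finset.sum_nonneg fun v _ => mul_nonneg (hC0 v) (by positivity)
  refine ⟨ENNReal.ofReal (2 ^ n * M) ^ (2:ℝ), ENNReal.rpow_ne_top_of_nonneg two_pos.le ofReal_ne_top, ?_⟩
  intro i F c Q
  rcases (F.filter fun ξ => freqCell ρ ξ = Q).eq_empty_or_nonempty with he | ⟨ξ₀, hξ₀⟩
  · rw [he]; simp
  set L := cellSide n ρ Q.1 with hL
  have hL0 : 0 < L := cellSide_pos hn _
  have hLz : (0:ℤ) < L := by exact_mod_cast hL0
  have hbox : ∀ ξ ∈ F.filter fun ξ => freqCell ρ ξ = Q, ∀ i, Q.2 i * L ≤ ξ i ∧ ξ i < Q.2 i * L + L := by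
    intro ξ hξ i
    have h := (Finset.mem_filter.1 hξ).2
    have h1 : freqLev ξ = Q.1 := congrArg Prod.fst h
    have h2 : ξ i / (L : ℤ) = Q.2 i := by
      rw [hL, ← h1]; exact congrFun (congrArg Prod.snd h) i
    rw [← h2]
    have h3 := Int.emod_add_mul_ediv (ξ i) L
    have h4 := Int.emod_nonneg (ξ i) hLz.ne'
    have h5 := Int.emod_lt_of_pos (ξ i) hLz
    rw [mul_comm]
    constructor <;> linarith
  have hlev : freqLev ξ₀ = Q.1 := congrArg Prod.fst (Finset.mem_filter.1 hξ₀).2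
  have hsym : ∀ v : List (Fin n), v.Sublist (List.finRange n) → ∀ x ξ,
      (∀ i, Q.2 i * L ≤ ξ i ∧ ξ i < Q.2 i * L + L) → ‖ddw v (b i x) ξ‖ ≤ M * (1 / L) ^ v.length := by
    intro v hv x ξ hξ
    have h1 := hC v i x ξ
    rw [pdw_nil] at h1
    have h2 : (2:ℝ) ^ Q.1 ≤ 2 * (n + 1) * jb ξ := by
      rw [← hlev]
      refine jb_lower_of_box (z := fun i => Q.2 i * L) hn hρ1 ?_ ?_
      · rw [hlev]; exact hbox ξ₀ hξ₀
      · rw [hlev]; exact hξ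
    have h3 : (L:ℝ) ≤ 4 * (n + 1) * jb ξ ^ ρ := by
      refine (cellSide_le hρ0 hn Q.1).trans ?_
      have h4 := Real.rpow_le_rpow (by positivity) h2 hρ0
      rw [Real.mul_rpow (by positivity) (jb_pos ξ).le, ← Real.rpow_natCast, ← Real.rpow_mul two_pos.le] at h4
      have h5 : (2 * ((n:ℝ) + 1)) ^ ρ ≤ 2 * (n + 1) := by
        have hn0 : (0:ℝ) ≤ n := by positivity
        simpa using Real.rpow_le_rpow_of_exponent_le (show 1 ≤ 2 * ((n:ℝ) + 1) by linarith) hρ1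
      have h6 := mul_le_mul_of_nonneg_right h5 (Real.rpow_nonneg (jb_pos ξ).le ρ)
      linarith
    have hLr : (0:ℝ) < L := by exact_mod_cast hL0
    have hjρ : 0 < jb ξ ^ ρ := Real.rpow_pos_of_pos (jb_pos ξ) _
    refine h1.trans ?_
    have e : jb ξ ^ (0 - ρ * v.length + δ * ([] : List (Fin n)).length) = (1 / jb ξ ^ ρ) ^ v.length := by
      rw [one_div, inv_pow, ← Real.rpow_natCast (jb ξ ^ ρ), ← Real.rpow_mul (jb_pos ξ).le, ← Real.rpow_neg (jb_pos ξ).le]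
      congr 1
      simp
    rw [e]
    have h7 : 1 / jb ξ ^ ρ ≤ 4 * (n + 1) * (1 / L) := by
      rw [mul_one_div, div_le_div_iff₀ hjρ hLr]; linarith
    calc C v * (1 / jb ξ ^ ρ) ^ v.length ≤ C v * (4 * (n + 1) * (1 / L)) ^ v.length := by
          refine mul_le_mul_of_nonneg_left (pow_le_pow_left₀ (by positivity) h7 _) (hC0 v)
      _ = C v * (4 * (n + 1)) ^ v.length * (1 / L) ^ v.length := by rw [mul_pow]; ring
      _ ≤ _ := by
          refine mul_le_mul_of_nonneg_right ?_ (by positivity)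
          exact Finset.single_le_sum (f := fun v : List (Fin n) => C v * (4 * ((n:ℝ) + 1)) ^ v.length)
            (fun v _ => mul_nonneg (hC0 v) (by positivity)) (by simpa [S] using hv)
  have h := eLpNorm_box_le hL0 (fun i => Q.2 i * L) _ hbox (List.finRange n) (List.nodup_finRange n) (b i) M hM0
    (fun ξ => (hb.smooth i ξ).bddMeas.1) (fun x ξ ξ' h => by
      rw [funext fun i => h i (List.mem_finRange i)]) hsym c
  rw [eLpNorm_two_eq, List.length_finRange] at h
  have h' := ENNReal.rpow_le_rpow h (two_pos (α := ℝ)).le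
  rw [ENNReal.mul_rpow_of_nonneg _ _ two_pos.le, ← ENNReal.rpow_mul, ← ENNReal.rpow_mul] at h'
  norm_num at h' ⊢
  exact h'

/-- **`L²` boundedness** for symbols of order zero, uniformly in a family. -/
theorem usym_l2 (hn : 1 ≤ n) (hδ0 : 0 ≤ δ) (hδρ : δ < ρ) (hρ1 : ρ ≤ 1) (hb : USym ρ δ 0 b) :
    ∃ D : ℝ, 0 ≤ D ∧ ∀ i (F : Finset (Fin n → ℤ)) (c : (Fin n → ℤ) → ℂ),
      ∫⁻ x, ‖∑ ξ ∈ F, c ξ * b i x ξ * eChar x ξ‖ₑ ^ (2:ℝ) ∂μT n ≤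
        ENNReal.ofReal D * ∑ ξ ∈ F, ‖c ξ‖ₑ ^ (2:ℝ) := by
  classical
  obtain ⟨K, hK, hcell⟩ := lintegral_cell_le hn (hδ0.trans hδρ.le) hρ1 hb
  obtain ⟨C, hC, hfar⟩ := fc_far_le hn hδ0 hδρ hρ1 hb
  set E : ℝ≥0∞ := 2 * ((3 * 3 ^ n : ℕ) * K) + 2 * (C * ∑' ζ : Fin n → ℤ, latWt ζ ^ (2:ℝ)) ^ (2:ℝ) with hE
  have hEt : E ≠ ⊤ := by
    refine ENNReal.add_ne_top.2 ⟨ENNReal.mul_ne_top (by simp) (ENNReal.mul_ne_top (ENNReal.natCast_ne_top _) hK),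
      ENNReal.mul_ne_top (by simp) (ENNReal.rpow_ne_top_of_nonneg two_pos.le
        (ENNReal.mul_ne_top hC tsum_latWt_ne_top))⟩
  refine ⟨E.toReal, ENNReal.toReal_nonneg, fun i F c => ?_⟩
  rw [ENNReal.ofReal_toReal hEt]
  refine lintegral_sq_le_of_cells (fun ξ => (hb.smooth i ξ).bddMeas) (freqCell ρ) F (3 * 3 ^ n) K C c
    (fun Q => ?_) fun η => ?_
  · convert hcell i F c Q
  · obtain ⟨A, hA, h⟩ := exists_near_cells hn hρ1 η
    refine ⟨A, hA, fun ξ _ hξ => hfar i ξ _ ?_⟩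
    obtain ⟨k, hk⟩ := h ξ hξ
    exact ⟨k, by simpa using hk⟩

end

/-- Integral kernel of the operator with a symbol of finite support in `ξ`. -/
def symK (B : (Fin n → ℝ) → (Fin n → ℤ) → ℂ) (x y : Fin n → ℝ) : ℂ := ∑' ξ, B x ξ * eChar (x - y) ξ

section
variable {B : (Fin n → ℝ) → (Fin n → ℤ) → ℂ} {F : Finset (Fin n → ℤ)}

theorem eChar_sub_left (x y : Fin n → ℝ) (ξ : Fin n → ℤ) :
    eChar (x - y) ξ = eChar x ξ * eChar y (-ξ) := by
  rw [sub_eq_add_neg, eChar_add_left, eChar_neg_left]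

theorem symK_eq_sum (hF : ∀ x, ∀ ξ ∉ F, B x ξ = 0) (x y : Fin n → ℝ) :
    symK B x y = ∑ ξ ∈ F, B x ξ * eChar (x - y) ξ :=
  tsum_eq_sum fun ξ hξ => by rw [hF x ξ hξ, zero_mul]

theorem symK_const_mul (c : ℂ) (x y : Fin n → ℝ) : symK (fun x ξ => c * B x ξ) x y = c * symK B x y := by
  rw [symK, symK, ← tsum_mul_left]
  simp only [mul_assoc]

theorem norm_symK_dd (hF : ∀ x, ∀ ξ ∉ F, B x ξ = 0) (k : Fin n) (x y : Fin n → ℝ) :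
    ‖symK (fun x => dd k (B x)) x y‖ = chD (x k - y k) * ‖symK B x y‖ := by
  have hs : Summable fun ξ => B x ξ * eChar (x - y) ξ :=
    summable_of_ne_finset_zero (s := F) fun ξ hξ => by rw [hF x ξ hξ, zero_mul]
  have e1 : ∀ ξ, B x (ξ + Pi.single k 1) * eChar (x - y) ξ =
      eChar (x - y) (-Pi.single k 1) * (B x (ξ + Pi.single k 1) * eChar (x - y) (ξ + Pi.single k 1)) := by
    intro ξ
    rw [mul_left_comm, ← eChar_add]
    congr 2; abel
  have hs' : Summable fun ξ => B x (ξ + Pi.single k 1) * eChar (x - y) ξ := by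
    simp only [e1]
    exact ((Equiv.addRight (Pi.single k 1)).summable_iff.2 hs).mul_left _
  have e2 : symK (fun x => dd k (B x)) x y = (eChar (x - y) (-Pi.single k 1) - 1) * symK B x y := by
    rw [symK, symK, sub_mul, one_mul]
    simp only [dd, sub_mul]
    rw [hs'.tsum_sub hs]
    congr 1
    simp only [e1]
    rw [tsum_mul_left]
    congr 1
    exact (Equiv.addRight (Pi.single k 1)).tsum_eq fun ξ => B x ξ * eChar (x - y) ξ
  rw [e2, norm_mul]
  congr 1
  rw [← chD_neg, chD, eChar]
  congr 3
  have : ∀ j, ((x - y) j : ℂ) * (((-Pi.single k 1 : Fin n → ℤ) j : ℤ) : ℂ) =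
      if j = k then -((x k : ℂ) - y k) else 0 := by
    intro j
    by_cases h : j = k
    · subst h; simp
    · simp [h]
  simp only [this]
  simp

theorem exists_ddw_support (hF : ∀ x, ∀ ξ ∉ F, B x ξ = 0) (v : List (Fin n)) :
    ∃ G : Finset (Fin n → ℤ), ∀ x, ∀ ξ ∉ G, ddw v (B x) ξ = 0 := by
  classical
  induction v with
  | nil => exact ⟨F, hF⟩
  | cons k v ih =>
    obtain ⟨G, hG⟩ := ih
    refine ⟨G ∪ G.image fun ξ => ξ - Pi.single k 1, fun x ξ hξ => ?_⟩
    rw [Finset.mem_union, not_or, Finset.mem_image] at hξ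
    rw [ddw_cons, dd, hG x ξ hξ.1, hG x _ fun h => hξ.2 ⟨_, h, by simp⟩, sub_zero]

theorem norm_symK_ddw (hF : ∀ x, ∀ ξ ∉ F, B x ξ = 0) (k : Fin n) (N : ℕ) (x y : Fin n → ℝ) :
    ‖symK (fun x => ddw (List.replicate N k) (B x)) x y‖ = chD (x k - y k) ^ N * ‖symK B x y‖ := by
  induction N with
  | zero => simp [ddw_nil]
  | succ N ih =>
    obtain ⟨G, hG⟩ := exists_ddw_support hF (List.replicate N k)
    rw [pow_succ', mul_assoc, ← ih, ← norm_symK_dd hG]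
    simp only [List.replicate_succ, ddw_cons]

theorem bddKer_sum {ι : Type*} (s : Finset ι) {K : ι → (Fin n → ℝ) → (Fin n → ℝ) → ℂ} (hK : ∀ i, BddKer (K i)) :
    BddKer fun x y => ∑ i ∈ s, K i x y := bddMeas_sum s hK

theorem bddKer_symK (hB : ∀ ξ, BddMeas fun x => B x ξ) (hF : ∀ x, ∀ ξ ∉ F, B x ξ = 0) : BddKer (symK B) := by
  have e : symK B = fun x y => ∑ ξ ∈ F, B x ξ * eChar (x - y) ξ := by
    ext x y; exact symK_eq_sum hF x y
  rw [e]
  refine bddKer_sum F fun ξ => ?_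
  obtain ⟨hm, M, hM⟩ := hB ξ
  refine ⟨(hm.comp measurable_fst).mul ((continuous_eChar ξ).measurable.comp
    (measurable_fst.sub measurable_snd)), M, fun p => ?_⟩
  rw [Function.uncurry, norm_mul, norm_eChar, mul_one]
  exact hM _

theorem kerOp_symK (hF : ∀ x, ∀ ξ ∉ F, B x ξ = 0) {f : (Fin n → ℝ) → ℂ} (hf : BddMeas f) (x : Fin n → ℝ) :
    kerOp (symK B) f x = ∑ ξ ∈ F, fc f ξ * B x ξ * eChar x ξ := by
  rw [kerOp]
  simp only [symK_eq_sum hF, Finset.sum_mul]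
  rw [integral_finsetSum _ fun ξ _ => ?_]
  · refine Finset.sum_congr rfl fun ξ _ => ?_
    rw [fc_eq]
    simp only [eChar_sub_left, mul_assoc]
    rw [integral_const_mul, integral_const_mul]
    ring
  · refine BddMeas.integrable ?_
    simp only [eChar_sub_left, mul_assoc]
    exact (((bddMeas_eChar (-ξ)).mul hf).const_mul _).const_mul _

theorem kerOp_adj_symK (hB : ∀ ξ, BddMeas fun x => B x ξ) (hF : ∀ x, ∀ ξ ∉ F, B x ξ = 0)
    {f : (Fin n → ℝ) → ℂ} (hf : BddMeas f) (x : Fin n → ℝ) :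
    kerOp (adjK (symK B)) f x = ∑ ξ ∈ F, fc (fun y => conj (B y ξ) * f y) ξ * eChar x ξ := by
  rw [kerOp]
  have e : ∀ y, adjK (symK B) x y * f y =
      ∑ ξ ∈ F, eChar x ξ * (eChar y (-ξ) * (conj (B y ξ) * f y)) := by
    intro y
    rw [adjK, symK_eq_sum hF, map_sum, Finset.sum_mul]
    refine Finset.sum_congr rfl fun ξ _ => ?_
    rw [map_mul, eChar_sub_left, map_mul, conj_eChar, conj_eChar, neg_neg]
    ring
  simp only [e]
  have hc : ∀ ξ, BddMeas fun y => conj (B y ξ) := fun ξ =>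
    ⟨Complex.continuous_conj.measurable.comp (hB ξ).1, (hB ξ).2.imp fun M h x => by simpa using h x⟩
  rw [integral_finsetSum _ fun ξ _ => ?_]
  · refine Finset.sum_congr rfl fun ξ _ => ?_
    rw [fc_eq, integral_const_mul, mul_comm]
  · exact (((bddMeas_eChar (-ξ)).mul ((hc ξ).mul hf)).const_mul _).integrable

theorem integral_sq_le_of_lintegral {f : (Fin n → ℝ) → ℂ} (hf : BddMeas f) {A : ℝ} (hA : 0 ≤ A)
    (h : ∫⁻ x, ‖f x‖ₑ ^ (2:ℝ) ∂μT n ≤ ENNReal.ofReal A) : ∫ x, ‖f x‖ ^ 2 ∂μT n ≤ A := by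
  rw [integral_eq_lintegral_of_nonneg_ae (Filter.Eventually.of_forall fun x => by positivity)
    (hf.1.norm.pow_const 2).aestronglyMeasurable]
  refine ENNReal.toReal_le_of_le_ofReal hA (le_trans (le_of_eq ?_) h)
  refine lintegral_congr fun x => ?_
  rw [← ofReal_norm, ENNReal.ofReal_rpow_of_nonneg (norm_nonneg _) two_pos.le, Real.rpow_two]

/-- Parseval's identity for the kernel in the second variable. -/
theorem lintegral_symK_right (hF : ∀ x, ∀ ξ ∉ F, B x ξ = 0) (x : Fin n → ℝ) :
    ∫⁻ y, ‖symK B x y‖ₑ ^ (2:ℝ) ∂μT n = ∑ ξ ∈ F, ‖B x ξ‖ₑ ^ (2:ℝ) := by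
  have h := lintegral_sum_eChar_sq F fun ξ => conj (B x ξ * eChar x ξ)
  have e : ∀ ξ, ‖conj (B x ξ * eChar x ξ)‖ₑ = ‖B x ξ‖ₑ := fun ξ => by
    rw [RCLike.enorm_conj, enorm_mul, ← ofReal_norm (eChar x ξ), norm_eChar, ofReal_one, mul_one]
  simp only [e] at h
  rw [← h]
  refine lintegral_congr fun y => ?_
  rw [symK_eq_sum hF, ← RCLike.enorm_conj, map_sum]
  congr 2
  refine Finset.sum_congr rfl fun ξ _ => ?_
  rw [eChar_sub_left, map_mul, map_mul, map_mul, conj_eChar y, neg_neg, mul_assoc]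

theorem lintegral_symK_left (hF : ∀ x, ∀ ξ ∉ F, B x ξ = 0) {D : ℝ≥0∞}
    (hD : ∀ c : (Fin n → ℤ) → ℂ, ∫⁻ x, ‖∑ ξ ∈ F, c ξ * B x ξ * eChar x ξ‖ₑ ^ (2:ℝ) ∂μT n ≤
      D * ∑ ξ ∈ F, ‖c ξ‖ₑ ^ (2:ℝ)) (y : Fin n → ℝ) :
    ∫⁻ x, ‖symK B x y‖ₑ ^ (2:ℝ) ∂μT n ≤ D * F.card := by
  have h := hD fun ξ => eChar y (-ξ)
  have e : ∀ ξ, ‖eChar y (-ξ)‖ₑ ^ (2:ℝ) = 1 := fun ξ => by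
    rw [← ofReal_norm, norm_eChar, ofReal_one, ENNReal.one_rpow]
  simp only [e, Finset.sum_const, nsmul_eq_mul, mul_one] at h
  refine le_trans (le_of_eq (lintegral_congr fun x => ?_)) h
  rw [symK_eq_sum hF]
  congr 2
  refine Finset.sum_congr rfl fun ξ _ => ?_
  rw [eChar_sub_left]; ring

theorem pd_mul_eChar {g : (Fin n → ℝ) → ℂ} (hg : ContDiff ℝ (⊤ : ℕ∞) g) (k : Fin n) (ξ : Fin n → ℤ) (x : Fin n → ℝ) :
    pd k (fun x => g x * eChar x ξ) x =
      (pd k g x + 2 * π * Complex.I * (ξ k : ℂ) * g x) * eChar x ξ := by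
  have he : pd k (fun x => eChar x ξ) x = 2 * π * Complex.I * (ξ k : ℂ) * eChar x ξ := by
    have h1 := ((differentiable_of_smooth (contDiff_eChar ξ)) x).hasFDerivAt.hasLineDerivAt
      (Pi.single k 1)
    have h2 : HasDerivAt (fun t : ℝ => eChar (x + t • Pi.single k 1) ξ)
        (2 * π * Complex.I * (ξ k : ℂ) * eChar x ξ) 0 := by
      have e : (fun t : ℝ => eChar (x + t • Pi.single k 1) ξ) = fun t : ℝ =>
          eChar x ξ * Complex.exp (2 * π * Complex.I * (ξ k : ℂ) * t) := by
        ext t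
        rw [eChar_add_left, eChar.eq_1 (t • _)]
        congr 2
        rw [Finset.sum_eq_single k (fun j _ hj => by simp [hj]) (by simp)]
        simp; ring
      rw [e]
      have h3 : HasDerivAt (fun t : ℝ => 2 * π * Complex.I * (ξ k : ℂ) * (t : ℂ))
          (2 * π * Complex.I * (ξ k : ℂ) * 1) 0 := (HasDerivAt.ofReal_comp (hasDerivAt_id (0:ℝ))).const_mul _
      refine (h3.cexp.const_mul (eChar x ξ)).congr_deriv ?_
      simp; ring
    exact HasDerivAt.unique h1 h2
  have h := congrFun (pd_mul hg (contDiff_eChar ξ) k) x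
  rw [h, he]; ring

end

theorem kerOp_sum {s : Finset ℕ} (c : ℕ → ℂ) {K : ℕ → (Fin n → ℝ) → (Fin n → ℝ) → ℂ}
    (hK : ∀ j, BddKer (K j)) {f : (Fin n → ℝ) → ℂ} (hf : BddMeas f) (x : Fin n → ℝ) :
    kerOp (fun x y => ∑ j ∈ s, c j * K j x y) f x = ∑ j ∈ s, c j * kerOp (K j) f x := by
  simp only [kerOp, Finset.sum_mul]
  rw [integral_finsetSum _ fun j _ => ?_]
  · refine Finset.sum_congr rfl fun j _ => ?_
    rw [← integral_const_mul]
    simp only [mul_assoc]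
  · exact ((((hK j).bddMeas x).const_mul (c j)).mul hf).integrable

theorem norm_kerOp_le {k : (Fin n → ℝ) → (Fin n → ℝ) → ℂ} {x : Fin n → ℝ}
    (hk : BddMeas (k x)) {f : (Fin n → ℝ) → ℂ} {M : ℝ} (hf : ∀ x, ‖f x‖ ≤ M) {L : ℝ} (hL : 0 ≤ L) :
    ‖kerOp k f x‖ ≤ M * ∫ y, ‖k x y‖ * (1 + L * ∑ i, chD (x i - y i)) ∂μT n := by
  rw [kerOp, ← integral_const_mul]
  have hc : BddMeas fun y : Fin n → ℝ => ((1 + L * ∑ i, chD (x i - y i) : ℝ) : ℂ) := by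
    refine ⟨?_, 1 + L * ∑ i : Fin n, 2, fun y => ?_⟩
    · refine Complex.measurable_ofReal.comp (measurable_const.add (measurable_const.mul ?_))
      exact Finset.measurable_sum _ fun i _ => continuous_chD.measurable.comp
        (measurable_const.sub (measurable_pi_apply i))
    · rw [Complex.norm_real, Real.norm_of_nonneg]
      · gcongr; exact chD_le_two _
      · have := Finset.sum_nonneg fun i (_ : i ∈ Finset.univ) => chD_nonneg (x i - y i)
        positivity
  refine norm_integral_le_of_norm_le ?_ (Filter.Eventually.of_forall fun y => ?_)
  · have h := (hk.mul hc).integrable (μ := μT n) |>.norm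
    refine (h.congr (Filter.Eventually.of_forall fun y => ?_)).const_mul M
    have := Finset.sum_nonneg fun i (_ : i ∈ Finset.univ) => chD_nonneg (x i - y i)
    simp only [norm_mul, Complex.norm_real]
    rw [Real.norm_of_nonneg (by positivity)]
  · have := Finset.sum_nonneg fun i (_ : i ∈ Finset.univ) => chD_nonneg (x i - y i)
    rw [norm_mul, mul_comm]
    refine mul_le_mul (hf y) ?_ (norm_nonneg _) ((norm_nonneg _).trans (hf y))
    exact le_mul_of_one_le_right (norm_nonneg _) (by nlinarith)

theorem norm_sub_le_of_pd {f : (Fin n → ℝ) → ℂ} (hf : Differentiable ℝ f) {G : ℝ}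
    (h : ∀ l x, ‖pd l f x‖ ≤ G) (x x' : Fin n → ℝ) : ‖f x - f x'‖ ≤ n * G * ‖x - x'‖ := by
  refine Convex.norm_image_sub_le_of_norm_fderiv_le (s := Set.univ) (𝕜 := ℝ)
    (fun z _ => hf z) (fun z _ => ?_) convex_univ trivial trivial
  rcases isEmpty_or_nonempty (Fin n) with he | ⟨⟨l⟩⟩
  · have : fderiv ℝ f z = 0 := by
      ext v; rw [Subsingleton.elim v 0]; simp
    have h0 : n = 0 := by by_contra h0; exact he.elim ⟨0, Nat.pos_of_ne_zero h0⟩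
    rw [this, norm_zero, h0]; simp
  have hG : 0 ≤ G := (norm_nonneg _).trans (h l z)
  refine ContinuousLinearMap.opNorm_le_bound _ (by positivity) fun v => ?_
  have hv : v = ∑ l, v l • (Pi.single l (1:ℝ) : Fin n → ℝ) := by
    ext i; simp [Finset.sum_apply, Pi.single_apply]
  conv_lhs => rw [hv]
  rw [map_sum]
  refine (norm_sum_le_of_le _ (n := fun _ => G * ‖v‖) fun l _ => ?_).trans (by simp [mul_assoc])
  rw [map_smul, norm_smul, mul_comm]
  exact mul_le_mul (h l z) (norm_le_pi_norm v l) (norm_nonneg _) hG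

section
variable {ρ δ : ℝ} {b : ℕ → (Fin n → ℝ) → (Fin n → ℤ) → ℂ}

theorem LocSym.exists_support {μ : ℝ} (hb : LocSym ρ δ μ b) : ∃ A : ℝ, 0 < A ∧ ∀ j : ℕ,
    ∃ F : Finset (Fin n → ℤ), (F.card : ℝ) ≤ A * (2:ℝ) ^ ((j:ℝ) * n) ∧
      ∀ x, ∀ ξ ∉ F, b j x ξ = 0 := by
  obtain ⟨S, hS, hsupp⟩ := hb.supp
  refine ⟨(3 * S) ^ n, by positivity, fun j => ?_⟩
  set X := S * (2:ℝ) ^ (j:ℝ)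
  have hX : 1 ≤ X := one_le_mul_of_one_le_of_one_le hS
    (Real.one_le_rpow (by norm_num) (by positivity))
  have hR : 0 ≤ ⌊X⌋ := Int.floor_nonneg.2 (by linarith)
  refine ⟨Fintype.piFinset fun _ => Finset.Icc (-⌊X⌋) ⌊X⌋, ?_, fun x ξ hξ => ?_⟩
  · rw [Fintype.card_piFinset, Finset.prod_const, Finset.card_univ, Fintype.card_fin, Int.card_Icc]
    push_cast
    rw [Real.rpow_mul (by norm_num), Real.rpow_natCast (_ ^ _), ← mul_pow]
    refine pow_le_pow_left₀ (by positivity) ?_ n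
    have e : (((⌊X⌋ + 1 - -⌊X⌋).toNat : ℕ) : ℝ) = 2 * (⌊X⌋ : ℝ) + 1 := by
      have : ((⌊X⌋ + 1 - -⌊X⌋).toNat : ℤ) = 2 * ⌊X⌋ + 1 := by omega
      exact_mod_cast congrArg (Int.cast (R := ℝ)) this
    rw [e, mul_assoc]
    linarith [Int.floor_le X]
  · refine hsupp j x ξ fun h => hξ (Fintype.mem_piFinset.2 fun k => Finset.mem_Icc.2 ?_)
    have h1 := (abs_le_jb ξ k).trans h.2
    rw [← Int.cast_abs] at h1
    exact abs_le.1 (Int.le_floor.2 h1)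

theorem LocSym.bddKer {μ : ℝ} (hb : LocSym ρ δ μ b) (j : ℕ) : BddKer (symK (b j)) := by
  obtain ⟨A, -, h⟩ := hb.exists_support
  obtain ⟨F, -, hF⟩ := h j
  exact bddKer_symK (fun ξ => (hb.smooth j ξ).bddMeas) hF

theorem LocSym.exists_kernel_bound (hn : 1 ≤ n) (hδ0 : 0 ≤ δ) (hδρ : δ < ρ) (hρ1 : ρ ≤ 1)
    (hb : LocSym ρ δ 0 b) : ∃ A : ℝ, 0 < A ∧ ∀ j x,
      ∫ y, ‖symK (b j) x y‖ ^ 2 ∂μT n ≤ (A * (2:ℝ) ^ ((j:ℝ) * (n / 2))) ^ 2 ∧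
      ∫ y, ‖symK (b j) y x‖ ^ 2 ∂μT n ≤ (A * (2:ℝ) ^ ((j:ℝ) * (n / 2))) ^ 2 := by
  obtain ⟨A, hA, hF⟩ := hb.exists_support
  obtain ⟨D, hD, hl2⟩ := usym_l2 hn hδ0 hδρ hρ1 hb.usym
  obtain ⟨C, hC, hCb⟩ := hb.exists_bound [] []
  refine ⟨√((C ^ 2 + D + 1) * A), by positivity, fun j x => ?_⟩
  obtain ⟨F, hcard, hF⟩ := hF j
  have hK := hb.bddKer j
  have e : (√((C ^ 2 + D + 1) * A) * (2:ℝ) ^ ((j:ℝ) * (n / 2))) ^ 2 =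
      (C ^ 2 + D + 1) * (A * (2:ℝ) ^ ((j:ℝ) * n)) := by
    rw [mul_pow, Real.sq_sqrt (by positivity), ← Real.rpow_natCast (_ ^ _), ← Real.rpow_mul (by norm_num),
      mul_assoc]
    congr 3; push_cast; ring
  rw [e]
  have hCb' : ∀ ξ, ‖b j x ξ‖ ≤ C := fun ξ => by
    have := hCb j x ξ
    rw [pdw_nil] at this
    simpa [ddw_nil] using this
  constructor
  · refine integral_sq_le_of_lintegral (hK.bddMeas x) (by positivity) ?_
    rw [lintegral_symK_right hF]
    refine (Finset.sum_le_card_nsmul _ _ (ENNReal.ofReal (C ^ 2)) fun ξ _ => ?_).trans ?_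
    · rw [← ofReal_norm, ENNReal.ofReal_rpow_of_nonneg (norm_nonneg _) two_pos.le, Real.rpow_two]
      exact ENNReal.ofReal_le_ofReal (pow_le_pow_left₀ (norm_nonneg _) (hCb' ξ) 2)
    · rw [nsmul_eq_mul, ← ENNReal.ofReal_natCast, ← ENNReal.ofReal_mul (by positivity), mul_comm]
      exact ENNReal.ofReal_le_ofReal (mul_le_mul (by linarith) hcard (by positivity) (by positivity))
  · refine integral_sq_le_of_lintegral ?_ (by positivity) ?_
    · obtain ⟨hm, M, hM⟩ := hK
      exact ⟨hm.comp measurable_prodMk_right, M, fun y => hM (y, x)⟩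
    · refine (lintegral_symK_left hF (hl2 j F) x).trans ?_
      rw [← ENNReal.ofReal_natCast, ← ENNReal.ofReal_mul (by positivity)]
      exact ENNReal.ofReal_le_ofReal (mul_le_mul (by nlinarith) hcard (by positivity) (by positivity))

theorem LocSym.exists_size (hn : 1 ≤ n) (hδ0 : 0 ≤ δ) (hδρ : δ < ρ) (hρ1 : ρ ≤ 1)
    (hb : LocSym ρ δ 0 b) : ∃ C : ℝ, 0 ≤ C ∧ ∀ j x,
      ∫ y, ‖symK (b j) x y‖ * (1 + (2:ℝ) ^ ((j:ℝ) * ρ) * ∑ i, chD (x i - y i)) ∂μT n ≤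
        C * (2:ℝ) ^ ((j:ℝ) * (n * (1 - ρ) / 2)) ∧
      ∫ y, ‖adjK (symK (b j)) x y‖ * (1 + (2:ℝ) ^ ((j:ℝ) * ρ) * ∑ i, chD (x i - y i)) ∂μT n ≤
        C * (2:ℝ) ^ ((j:ℝ) * (n * (1 - ρ) / 2)) := by
  obtain ⟨A, hA, hAb⟩ := hb.exists_kernel_bound hn hδ0 hδρ hρ1
  have hk : ∀ k : Fin n, ∃ B : ℝ, 0 < B ∧ ∀ j x,
      ∫ y, ‖symK (b j) x y‖ ^ 2 * chD (x k - y k) ^ (2 * (n + 1)) ∂μT n ≤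
        (B * (2:ℝ) ^ ((j:ℝ) * (n / 2))) ^ 2 * (1 / (2:ℝ) ^ ((j:ℝ) * ρ)) ^ (2 * (n + 1)) ∧
      ∫ y, ‖symK (b j) y x‖ ^ 2 * chD (x k - y k) ^ (2 * (n + 1)) ∂μT n ≤
        (B * (2:ℝ) ^ ((j:ℝ) * (n / 2))) ^ 2 * (1 / (2:ℝ) ^ ((j:ℝ) * ρ)) ^ (2 * (n + 1)) := by
    intro k
    have h := ((hb.ddw (List.replicate (n + 1) k)).scale (ρ * (n + 1))).congr_eq (μ' := 0)
      (by rw [List.length_replicate]; push_cast; ring)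
    obtain ⟨B, hB, hBb⟩ := h.exists_kernel_bound hn hδ0 hδρ hρ1
    refine ⟨B, hB, fun j x => ?_⟩
    obtain ⟨_, -, hF⟩ := hb.exists_support
    obtain ⟨F, -, hF⟩ := hF j
    have hL : (0:ℝ) < (2:ℝ) ^ ((j:ℝ) * ρ) := by positivity
    have h2 : ((2:ℝ) ^ ((j:ℝ) * (ρ * (n + 1)))) ^ 2 = ((2:ℝ) ^ ((j:ℝ) * ρ)) ^ (2 * (n + 1)) := by
      rw [← Real.rpow_natCast (_ ^ _), ← Real.rpow_natCast ((2:ℝ) ^ ((j:ℝ) * ρ)),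
        ← Real.rpow_mul (by norm_num), ← Real.rpow_mul (by norm_num)]
      congr 1; push_cast; ring
    have e : ∀ x y, ‖symK (fun x ξ => (((2:ℝ) ^ ((j:ℝ) * (ρ * (n + 1))) : ℝ) : ℂ) *
        _root_.ddw (List.replicate (n + 1) k) (b j x) ξ) x y‖ ^ 2 =
        ((2:ℝ) ^ ((j:ℝ) * ρ)) ^ (2 * (n + 1)) * (‖symK (b j) x y‖ ^ 2 * chD (x k - y k) ^ (2 * (n + 1))) := by
      intro x y
      rw [symK_const_mul, norm_mul, norm_symK_ddw hF, Complex.norm_real,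
        Real.norm_of_nonneg (by positivity), mul_pow, mul_pow, ← pow_mul, mul_comm (chD _ ^ _),
        mul_comm (n + 1) 2, h2]
    have := hBb j x
    simp only [e, integral_const_mul] at this
    rw [← le_div_iff₀' (by positivity), ← le_div_iff₀' (by positivity)] at this
    rw [one_div, inv_pow, ← div_eq_mul_inv]
    refine ⟨this.1, ?_⟩
    simp only [← chD_neg (x k - _), neg_sub]
    exact this.2
  choose B hB hBb using hk
  have hBs : ∀ k, 0 ≤ B k := fun k => (hB k).le
  set E := A + ∑ k, B k
  have hE0 : 0 < E := add_pos_of_pos_of_nonneg hA (Finset.sum_nonneg fun k _ => hBs k)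
  have hAE : A ≤ E := le_add_of_nonneg_right (Finset.sum_nonneg fun k _ => hBs k)
  have hBE : ∀ k, B k ≤ E := fun k => by
    have := Finset.single_le_sum (f := B) (fun k _ => hBs k) (Finset.mem_univ k)
    linarith
  refine ⟨((1 + n) ^ 3 * 2 ^ n + 1) * E, by positivity, fun j x => ?_⟩
  have hL : (0:ℝ) < (2:ℝ) ^ ((j:ℝ) * ρ) := by positivity
  have hE : 0 < E * (2:ℝ) ^ ((j:ℝ) * (n / 2)) := by positivity
  have e : ((1 + (n:ℝ)) ^ 3 * 2 ^ n + 1) * (E * (2:ℝ) ^ ((j:ℝ) * (n / 2)) *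
      (1 / (2:ℝ) ^ ((j:ℝ) * ρ)) ^ ((n:ℝ) / 2)) =
      ((1 + n) ^ 3 * 2 ^ n + 1) * E * (2:ℝ) ^ ((j:ℝ) * (n * (1 - ρ) / 2)) := by
    rw [one_div, ← Real.rpow_neg (by norm_num), ← Real.rpow_mul (by norm_num), mul_assoc E,
      ← Real.rpow_add (by norm_num), mul_assoc]
    congr 3; ring
  have hmono : ∀ {B : ℝ}, 0 ≤ B → B ≤ E → (B * (2:ℝ) ^ ((j:ℝ) * (n / 2))) ^ 2 ≤
      (E * (2:ℝ) ^ ((j:ℝ) * (n / 2))) ^ 2 := fun h0 h => by gcongr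
  rw [← e]
  constructor
  · exact integral_weighted_le hL hE x ((hb.bddKer j).bddMeas x)
      ((hAb j x).1.trans (hmono hA.le hAE)) fun i => (hBb i j x).1.trans
        (mul_le_mul_of_nonneg_right (hmono (hBs i) (hBE i)) (by positivity))
  · refine integral_weighted_le hL hE x ((hb.bddKer j).adj.bddMeas x) ?_ fun i => ?_
    · simp only [adjK, RCLike.norm_conj]
      exact (hAb j x).2.trans (hmono hA.le hAE)
    · simp only [adjK, RCLike.norm_conj]
      exact (hBb i j x).2.trans (mul_le_mul_of_nonneg_right (hmono (hBs i) (hBE i)) (by positivity))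

end

section
variable {ρ δ : ℝ} {b : ℕ → (Fin n → ℝ) → (Fin n → ℤ) → ℂ}

theorem pd_sum_mul_eChar {F : Finset (Fin n → ℤ)} {g : (Fin n → ℤ) → (Fin n → ℝ) → ℂ}
    (hg : ∀ ξ, ContDiff ℝ (⊤ : ℕ∞) (g ξ)) (k : Fin n) (x : Fin n → ℝ) :
    pd k (fun x => ∑ ξ ∈ F, g ξ x * eChar x ξ) x =
      ∑ ξ ∈ F, (pd k (g ξ) x + 2 * π * Complex.I * (ξ k : ℂ) * g ξ x) * eChar x ξ := by
  have h := congrFun (pdw_sum F (f := fun ξ x => g ξ x * eChar x ξ)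
    (fun ξ => (hg ξ).mul (contDiff_eChar ξ)) [k]) x
  simp only [pdw_cons, pdw_nil] at h
  rw [h]
  exact Finset.sum_congr rfl fun ξ _ => pd_mul_eChar (hg ξ) k ξ x

theorem LocSym.exists_lip (hn : 1 ≤ n) (hδ0 : 0 ≤ δ) (hδρ : δ < ρ) (hρ1 : ρ ≤ 1)
    (hb : LocSym ρ δ 0 b) : ∃ C : ℝ, 0 ≤ C ∧ ∀ (j : ℕ) f (M : ℝ), Measurable f → (∀ x, ‖f x‖ ≤ M) →
      ∀ x x', ‖kerOp (symK (b j)) f x - kerOp (symK (b j)) f x'‖ ≤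
        C * (2:ℝ) ^ (j:ℝ) * (2:ℝ) ^ ((j:ℝ) * (n * (1 - ρ) / 2)) * M * ‖x - x'‖ := by
  have h1 : ∀ l : Fin n, LocSym ρ δ 0 fun j x ξ => (((2:ℝ) ^ ((j:ℝ) * (-1)) : ℝ) : ℂ) *
      (_root_.pd l (fun x => b j x ξ) x + 2 * π * Complex.I * (((ξ l : ℤ) : ℂ) * b j x ξ)) := fun l =>
    ((((hb.pd l).mono (μ' := 0 + 1) (by linarith)).add
      ((hb.coord_mul hρ1 l).const_mul (2 * π * Complex.I))).scale (-1)).congr_eq (by ring)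
  choose C hC hCb using fun l => (h1 l).exists_size hn hδ0 hδρ hρ1
  have hsum : ∀ l, C l ≤ ∑ l, C l := fun l =>
    Finset.single_le_sum (f := C) (fun l _ => hC l) (Finset.mem_univ l)
  have hsum0 : 0 ≤ ∑ l, C l := Finset.sum_nonneg fun l _ => hC l
  refine ⟨n * ∑ l, C l, by positivity, fun j f M hf hM x x' => ?_⟩
  have hfb : BddMeas f := ⟨hf, M, hM⟩
  have hM0 : 0 ≤ M := (norm_nonneg _).trans (hM x)
  obtain ⟨_, -, hF⟩ := hb.exists_support
  obtain ⟨F, -, hF⟩ := hF j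
  have e : kerOp (symK (b j)) f = fun x => ∑ ξ ∈ F, (fc f ξ * b j x ξ) * eChar x ξ :=
    funext fun x => kerOp_symK hF hfb x
  have hsm : ∀ ξ, ContDiff ℝ (⊤ : ℕ∞) fun x => fc f ξ * b j x ξ := fun ξ =>
    contDiff_const.mul (hb.smooth j ξ).1
  have hd : ∀ l x, ‖_root_.pd l (kerOp (symK (b j)) f) x‖ ≤
      (∑ l, C l) * (2:ℝ) ^ (j:ℝ) * (2:ℝ) ^ ((j:ℝ) * (n * (1 - ρ) / 2)) * M := by
    intro l x
    have hF' : ∀ x, ∀ ξ ∉ F, (((2:ℝ) ^ ((j:ℝ) * (-1)) : ℝ) : ℂ) *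
        (_root_.pd l (fun x => b j x ξ) x + 2 * π * Complex.I * (((ξ l : ℤ) : ℂ) * b j x ξ)) = 0 := by
      intro x ξ hξ
      have h0 : (fun x => b j x ξ) = fun _ => 0 := funext fun x => hF x ξ hξ
      rw [hF x ξ hξ, h0]
      simp [_root_.pd]
    have e2 : _root_.pd l (kerOp (symK (b j)) f) x = (((2:ℝ) ^ (j:ℝ) : ℝ) : ℂ) * kerOp (symK fun x ξ =>
        (((2:ℝ) ^ ((j:ℝ) * (-1)) : ℝ) : ℂ) *
          (_root_.pd l (fun x => b j x ξ) x + 2 * π * Complex.I * (((ξ l : ℤ) : ℂ) * b j x ξ))) f x := by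
      rw [kerOp_symK hF' hfb, e, pd_sum_mul_eChar hsm, Finset.mul_sum]
      refine Finset.sum_congr rfl fun ξ _ => ?_
      rw [pd_const_mul (hb.smooth j ξ).1]
      have : (((2:ℝ) ^ (j:ℝ) : ℝ) : ℂ) * (((2:ℝ) ^ ((j:ℝ) * (-1)) : ℝ) : ℂ) = 1 := by
        rw [← Complex.ofReal_mul, ← Real.rpow_add (by norm_num)]; simp
      linear_combination (-(fc f ξ * (_root_.pd l (fun x => b j x ξ) x + 2 * π * Complex.I *
        (((ξ l : ℤ) : ℂ) * b j x ξ)) * eChar x ξ)) * this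
    rw [e2, norm_mul, Complex.norm_real, Real.norm_of_nonneg (by positivity)]
    have h := (norm_kerOp_le (((h1 l).bddKer j).bddMeas x) hM
      (show (0:ℝ) ≤ (2:ℝ) ^ ((j:ℝ) * ρ) by positivity)).trans
        (mul_le_mul_of_nonneg_left (hCb l j x).1 hM0)
    refine (mul_le_mul_of_nonneg_left h (by positivity)).trans ?_
    rw [show (2:ℝ) ^ (j:ℝ) * (M * (C l * (2:ℝ) ^ ((j:ℝ) * (n * (1 - ρ) / 2)))) =
      C l * (2:ℝ) ^ (j:ℝ) * (2:ℝ) ^ ((j:ℝ) * (n * (1 - ρ) / 2)) * M by ring]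
    gcongr
    exact hsum l
  have hdiff : Differentiable ℝ (kerOp (symK (b j)) f) := by
    rw [e]
    exact differentiable_of_smooth (ContDiff.sum fun ξ _ => (hsm ξ).mul (contDiff_eChar ξ))
  refine (norm_sub_le_of_pd hdiff hd x x').trans (le_of_eq ?_)
  ring

theorem LocSym.exists_lip_adj (hn : 1 ≤ n) (hδ0 : 0 ≤ δ) (hδρ : δ < ρ) (hρ1 : ρ ≤ 1)
    (hb : LocSym ρ δ 0 b) : ∃ C : ℝ, 0 ≤ C ∧ ∀ (j : ℕ) f (M : ℝ), Measurable f → (∀ x, ‖f x‖ ≤ M) →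
      ∀ x x', ‖kerOp (adjK (symK (b j))) f x - kerOp (adjK (symK (b j))) f x'‖ ≤
        C * (2:ℝ) ^ (j:ℝ) * (2:ℝ) ^ ((j:ℝ) * (n * (1 - ρ) / 2)) * M * ‖x - x'‖ := by
  have h1 : ∀ l : Fin n, LocSym ρ δ 0 fun j x ξ => (((2:ℝ) ^ ((j:ℝ) * (-1)) : ℝ) : ℂ) *
      (-(2 * π * Complex.I) * (((ξ l : ℤ) : ℂ) * b j x ξ)) := fun l =>
    (((hb.coord_mul hρ1 l).const_mul (-(2 * π * Complex.I))).scale (-1)).congr_eq (by ring)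
  choose C hC hCb using fun l => (h1 l).exists_size hn hδ0 hδρ hρ1
  have hsum : ∀ l, C l ≤ ∑ l, C l := fun l =>
    Finset.single_le_sum (f := C) (fun l _ => hC l) (Finset.mem_univ l)
  have hsum0 : 0 ≤ ∑ l, C l := Finset.sum_nonneg fun l _ => hC l
  refine ⟨n * ∑ l, C l, by positivity, fun j f M hf hM x x' => ?_⟩
  have hfb : BddMeas f := ⟨hf, M, hM⟩
  have hM0 : 0 ≤ M := (norm_nonneg _).trans (hM x)
  obtain ⟨_, -, hF⟩ := hb.exists_support
  obtain ⟨F, -, hF⟩ := hF j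
  have hbm : ∀ ξ, BddMeas fun x => b j x ξ := fun ξ => (hb.smooth j ξ).bddMeas
  have e : kerOp (adjK (symK (b j))) f =
      fun x => ∑ ξ ∈ F, fc (fun y => conj (b j y ξ) * f y) ξ * eChar x ξ :=
    funext fun x => kerOp_adj_symK hbm hF hfb x
  have hd : ∀ l x, ‖_root_.pd l (kerOp (adjK (symK (b j))) f) x‖ ≤
      (∑ l, C l) * (2:ℝ) ^ (j:ℝ) * (2:ℝ) ^ ((j:ℝ) * (n * (1 - ρ) / 2)) * M := by
    intro l x
    have hF' : ∀ x, ∀ ξ ∉ F, (((2:ℝ) ^ ((j:ℝ) * (-1)) : ℝ) : ℂ) *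
        (-(2 * π * Complex.I) * (((ξ l : ℤ) : ℂ) * b j x ξ)) = 0 := by
      intro x ξ hξ
      rw [hF x ξ hξ]; simp
    have e2 : _root_.pd l (kerOp (adjK (symK (b j))) f) x = (((2:ℝ) ^ (j:ℝ) : ℝ) : ℂ) *
        kerOp (adjK (symK fun x ξ => (((2:ℝ) ^ ((j:ℝ) * (-1)) : ℝ) : ℂ) *
          (-(2 * π * Complex.I) * (((ξ l : ℤ) : ℂ) * b j x ξ)))) f x := by
      rw [kerOp_adj_symK (fun ξ => (((hbm ξ).const_mul _).const_mul _).const_mul _) hF' hfb, e,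
        pd_sum_mul_eChar (g := fun ξ _ => fc (fun y => conj (b j y ξ) * f y) ξ)
          (fun ξ => contDiff_const), Finset.mul_sum]
      refine Finset.sum_congr rfl fun ξ _ => ?_
      have h3 : ∀ y, conj ((((2:ℝ) ^ ((j:ℝ) * (-1)) : ℝ) : ℂ) *
          (-(2 * π * Complex.I) * (((ξ l : ℤ) : ℂ) * b j y ξ))) * f y =
          ((((2:ℝ) ^ ((j:ℝ) * (-1)) : ℝ) : ℂ) * (2 * π * Complex.I * ((ξ l : ℤ) : ℂ))) *
            (conj (b j y ξ) * f y) := by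
        intro y
        simp only [map_mul, map_neg, Complex.conj_ofReal, Complex.conj_I, map_ofNat, map_intCast]
        ring
      simp only [h3]
      rw [fc_const_mul]
      have : (((2:ℝ) ^ (j:ℝ) : ℝ) : ℂ) * (((2:ℝ) ^ ((j:ℝ) * (-1)) : ℝ) : ℂ) = 1 := by
        rw [← Complex.ofReal_mul, ← Real.rpow_add (by norm_num)]; simp
      have h0 : _root_.pd l (fun _ => fc (fun y => conj (b j y ξ) * f y) ξ) x = 0 := by simp [_root_.pd]
      rw [h0]
      linear_combination (-(fc (fun y => conj (b j y ξ) * f y) ξ * (2 * π * Complex.I *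
        ((ξ l : ℤ) : ℂ)) * eChar x ξ)) * this
    rw [e2, norm_mul, Complex.norm_real, Real.norm_of_nonneg (by positivity)]
    have h := (norm_kerOp_le (((h1 l).bddKer j).adj.bddMeas x) hM
      (show (0:ℝ) ≤ (2:ℝ) ^ ((j:ℝ) * ρ) by positivity)).trans
        (mul_le_mul_of_nonneg_left (hCb l j x).2 hM0)
    refine (mul_le_mul_of_nonneg_left h (by positivity)).trans ?_
    rw [show (2:ℝ) ^ (j:ℝ) * (M * (C l * (2:ℝ) ^ ((j:ℝ) * (n * (1 - ρ) / 2)))) =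
      C l * (2:ℝ) ^ (j:ℝ) * (2:ℝ) ^ ((j:ℝ) * (n * (1 - ρ) / 2)) * M by ring]
    gcongr
    exact hsum l
  have hdiff : Differentiable ℝ (kerOp (adjK (symK (b j))) f) := by
    rw [e]
    exact differentiable_of_smooth (ContDiff.sum fun ξ _ => contDiff_const.mul (contDiff_eChar ξ))
  refine (norm_sub_le_of_pd hdiff hd x x').trans (le_of_eq ?_)
  ring

theorem LocSym.exists_l2 (hn : 1 ≤ n) (hδ0 : 0 ≤ δ) (hδρ : δ < ρ) (hρ1 : ρ ≤ 1)
    (hb : LocSym ρ δ 0 b) : ∃ D : ℝ, 0 ≤ D ∧ ∀ (J : ℕ) (ε : ℕ → ℝ), (∀ j, |ε j| ≤ 1) → ∀ f, BddMeas f →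
      ∫⁻ x, ‖∑ j ∈ Finset.range J, (ε j : ℂ) * kerOp (symK (b j)) f x‖ₑ ^ (2:ℝ) ∂μT n ≤
        ENNReal.ofReal D * ∫⁻ x, ‖f x‖ₑ ^ (2:ℝ) ∂μT n := by
  classical
  obtain ⟨D, hD, hl2⟩ := usym_l2 hn hδ0 hδρ hρ1 hb.usym_sum
  refine ⟨D, hD, fun J ε hε f hf => ?_⟩
  obtain ⟨_, -, hF⟩ := hb.exists_support
  choose F _ hF using hF
  set G := (Finset.range J).biUnion F
  have hG : ∀ j ∈ Finset.range J, ∀ x, ∀ ξ ∉ G, b j x ξ = 0 := fun j hj x ξ hξ =>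
    hF j x ξ fun h => hξ (Finset.mem_biUnion.2 ⟨j, hj, h⟩)
  have h := hl2 (J, ⟨fun j => (ε j : ℂ), fun j => by simpa using hε j⟩) G (fc f)
  refine le_trans (le_of_eq (lintegral_congr fun x => ?_)) (h.trans (mul_le_mul_right ?_ _))
  · congr 2
    rw [Finset.sum_congr rfl fun j hj => by rw [kerOp_symK (hG j hj) hf]]
    simp only [Finset.mul_sum, Finset.sum_mul]
    rw [Finset.sum_comm]
    exact Finset.sum_congr rfl fun ξ _ => Finset.sum_congr rfl fun j _ => by ring
  · rw [← tsum_fc_sq hf]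
    exact ENNReal.sum_le_tsum G

theorem LocSym.exists_l2_adj (hn : 1 ≤ n) (hδ0 : 0 ≤ δ) (hδρ : δ < ρ) (hρ1 : ρ ≤ 1)
    (hb : LocSym ρ δ 0 b) : ∃ D : ℝ, 0 ≤ D ∧ ∀ (J : ℕ) (ε : ℕ → ℝ), (∀ j, |ε j| ≤ 1) → ∀ f, BddMeas f →
      ∫⁻ x, ‖∑ j ∈ Finset.range J, (ε j : ℂ) * kerOp (adjK (symK (b j))) f x‖ₑ ^ (2:ℝ) ∂μT n ≤
        ENNReal.ofReal D * ∫⁻ x, ‖f x‖ₑ ^ (2:ℝ) ∂μT n := by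
  obtain ⟨D, hD, h⟩ := hb.exists_l2 hn hδ0 hδρ hρ1
  refine ⟨D, hD, fun J ε hε f hf => ?_⟩
  have hK : BddKer fun x y => ∑ j ∈ Finset.range J, (ε j : ℂ) * symK (b j) x y :=
    bddKer_sum _ fun j => BddMeas.const_mul (hb.bddKer j) _
  have h2 := lintegral_kerOp_adj_le hK Real.HolderConjugate.two_two (D := ENNReal.ofReal D)
    (fun f hf => by simp only [kerOp_sum _ hb.bddKer hf]; exact h J ε hε f hf) hf
  rw [div_self two_ne_zero, ENNReal.rpow_one] at h2
  refine le_trans (le_of_eq (lintegral_congr fun x => ?_)) h2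
  rw [← kerOp_sum _ (fun j => (hb.bddKer j).adj) hf]
  congr 3
  ext x y
  simp [adjK, map_sum]

theorem kerFam_of_bounds {d C₁ C₂ C₃ : ℝ} {k : ℕ → (Fin n → ℝ) → (Fin n → ℝ) → ℂ}
    (h1 : 0 ≤ C₁) (h2 : 0 ≤ C₂) (h3 : 0 ≤ C₃) (hk : ∀ j, BddKer (k j))
    (hs : ∀ (j : ℕ) x, ∫ y, ‖k j x y‖ * (1 + (2:ℝ) ^ ((j:ℝ) * ρ) * ∑ i, chD (x i - y i)) ∂μT n ≤
      C₁ * (2:ℝ) ^ ((j:ℝ) * d))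
    (hl : ∀ (J : ℕ) (ε : ℕ → ℝ), (∀ j, |ε j| ≤ 1) → ∀ f, BddMeas f →
      ∫⁻ x, ‖∑ j ∈ Finset.range J, (ε j : ℂ) * kerOp (k j) f x‖ₑ ^ (2:ℝ) ∂μT n ≤
        ENNReal.ofReal C₂ * ∫⁻ x, ‖f x‖ₑ ^ (2:ℝ) ∂μT n)
    (hlip : ∀ (j : ℕ) f (M : ℝ), Measurable f → (∀ x, ‖f x‖ ≤ M) → ∀ x x',
      ‖kerOp (k j) f x - kerOp (k j) f x'‖ ≤ C₃ * (2:ℝ) ^ (j:ℝ) * (2:ℝ) ^ ((j:ℝ) * d) * M * ‖x - x'‖) :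
    KerFam n ρ d (C₁ + (C₂ + 1) + C₃) k := by
  refine ⟨fun j x => (hk j).bddMeas x, fun j x => (hs j x).trans ?_, fun J ε hε f hf =>
    (hl J ε hε f hf).trans (mul_le_mul_left (ENNReal.ofReal_le_ofReal ?_) _), fun j f M hf hM x x' =>
    (hlip j f M hf hM x x').trans ?_⟩
  · gcongr; linarith
  · nlinarith
  · have hM0 : 0 ≤ M := (norm_nonneg _).trans (hM x)
    gcongr; linarith

theorem LocSym.exists_kerFam (hn : 1 ≤ n) (hδ0 : 0 ≤ δ) (hδρ : δ < ρ) (hρ1 : ρ ≤ 1)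
    (hb : LocSym ρ δ 0 b) : ∃ C, KerFam n ρ (n * (1 - ρ) / 2) C (fun j => symK (b j)) ∧
      KerFam n ρ (n * (1 - ρ) / 2) C (fun j => adjK (symK (b j))) := by
  obtain ⟨C₁, h1, hs⟩ := hb.exists_size hn hδ0 hδρ hρ1
  obtain ⟨C₂, h2, hl⟩ := hb.exists_l2 hn hδ0 hδρ hρ1
  obtain ⟨C₂', h2', hl'⟩ := hb.exists_l2_adj hn hδ0 hδρ hρ1
  obtain ⟨C₃, h3, hlip⟩ := hb.exists_lip hn hδ0 hδρ hρ1
  obtain ⟨C₃', h3', hlip'⟩ := hb.exists_lip_adj hn hδ0 hδρ hρ1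
  refine ⟨C₁ + (max C₂ C₂' + 1) + max C₃ C₃', kerFam_of_bounds h1 (le_max_of_le_left h2)
    (le_max_of_le_left h3) hb.bddKer (fun j x => (hs j x).1) (fun J ε hε f hf => (hl J ε hε f hf).trans
      (mul_le_mul_left (ENNReal.ofReal_le_ofReal (le_max_left _ _)) _)) (fun j f M hf hM x x' =>
      (hlip j f M hf hM x x').trans ?_), kerFam_of_bounds h1 (le_max_of_le_left h2)
    (le_max_of_le_left h3) (fun j => (hb.bddKer j).adj) (fun j x => (hs j x).2)
    (fun J ε hε f hf => (hl' J ε hε f hf).trans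
      (mul_le_mul_left (ENNReal.ofReal_le_ofReal (le_max_right _ _)) _)) (fun j f M hf hM x x' =>
      (hlip' j f M hf hM x x').trans ?_)⟩
  · have hM0 : 0 ≤ M := (norm_nonneg _).trans (hM x)
    gcongr; exact le_max_left _ _
  · have hM0 : 0 ≤ M := (norm_nonneg _).trans (hM x)
    gcongr; exact le_max_right _ _

end

section
variable {ρ δ p : ℝ} {b : ℕ → (Fin n → ℝ) → (Fin n → ℤ) → ℂ}

theorem LocSym.bddMeas_kerSum {μ : ℝ} (hb : LocSym ρ δ μ b) (m : ℝ) (J : ℕ) {f : (Fin n → ℝ) → ℂ}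
    (hf : BddMeas f) : BddMeas (kerSum (fun j => symK (b j)) m J f) :=
  bddMeas_sum _ fun j => ((hb.bddKer j).bddMeas_op hf).const_mul _

theorem LocSym.exists_Lp (hn : 1 ≤ n) (hδ0 : 0 ≤ δ) (hδρ : δ < ρ) (hρ1 : ρ ≤ 1) (hp : 1 < p)
    (hb : LocSym ρ δ 0 b) : ∃ D : ℝ≥0∞, D ≠ ⊤ ∧ ∀ (J : ℕ) f, BddMeas f →
      ∫⁻ x, ‖kerSum (fun j => symK (b j)) (n * (1 - ρ) * |1 / p - 1 / 2|) J f x‖ₑ ^ p ∂μT n ≤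
        D * ∫⁻ x, ‖f x‖ₑ ^ p ∂μT n := by
  obtain ⟨C, hC, hC'⟩ := hb.exists_kerFam hn hδ0 hδρ hρ1
  have hρ0 : 0 < ρ := by linarith
  have hp0 : 0 < p := by linarith
  rcases le_total 2 p with h2 | h2
  · obtain ⟨D, hD, h⟩ := kernel_Lp hρ0 hρ1 hn rfl h2 C
    refine ⟨D, hD, fun J f hf => ?_⟩
    have e : (n:ℝ) * (1 - ρ) * |1 / p - 1 / 2| = n * (1 - ρ) / 2 * (p - 2) / p := by
      rw [abs_of_nonpos (sub_nonpos.2 (one_div_le_one_div_of_le two_pos h2))]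
      field_simp; ring
    rw [e]
    exact h _ hC J f hf
  · have hpq : p.HolderConjugate (p / (p - 1)) := Real.HolderConjugate.conjExponent hp
    set q := p / (p - 1) with hq
    have hp1 : 0 < p - 1 := by linarith
    have hq2 : 2 ≤ q := by rw [hq, le_div_iff₀ hp1]; linarith
    obtain ⟨D, hD, h⟩ := kernel_Lp hρ0 hρ1 hn rfl hq2 C
    refine ⟨D ^ (p / q), ENNReal.rpow_ne_top_of_nonneg (by positivity) hD, fun J f hf => ?_⟩
    have e : (n:ℝ) * (1 - ρ) * |1 / p - 1 / 2| = n * (1 - ρ) / 2 * (q - 2) / q := by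
      rw [abs_of_nonneg (sub_nonneg.2 (one_div_le_one_div_of_le hp0 h2)), hq]
      field_simp; ring
    rw [e]
    set c : ℕ → ℂ := fun j => (((2:ℝ) ^ (-((j:ℝ) * (n * (1 - ρ) / 2 * (q - 2) / q))) : ℝ) : ℂ) with hc
    have hK : BddKer fun x y => ∑ j ∈ Finset.range J, c j * adjK (symK (b j)) x y :=
      bddKer_sum _ fun j => BddMeas.const_mul (hb.bddKer j).adj _
    have h3 := lintegral_kerOp_adj_le hK hpq (D := D) (fun f hf => by
      simp only [kerOp_sum c (fun j => (hb.bddKer j).adj) hf]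
      exact h _ hC' J f hf) hf
    refine le_trans (le_of_eq (lintegral_congr fun x => ?_)) h3
    have e2 : adjK (fun x y => ∑ j ∈ Finset.range J, c j * adjK (symK (b j)) x y) =
        fun x y => ∑ j ∈ Finset.range J, c j * symK (b j) x y := by
      ext x y
      simp [adjK, map_sum, hc]
    rw [e2, kerOp_sum c hb.bddKer hf, kerSum]

theorem kerSum_symK_eq_tsum {m μ : ℝ} {a : (Fin n → ℝ) → (Fin n → ℤ) → ℂ}
    (hb : LocSym ρ δ μ fun j x ξ => (((2:ℝ) ^ ((j:ℝ) * m) : ℝ) : ℂ) * (cutDy j ξ * a x ξ))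
    (J : ℕ) {f : (Fin n → ℝ) → ℂ} (hf : BddMeas f) (x : Fin n → ℝ) :
    kerSum (fun j => symK fun x ξ => (((2:ℝ) ^ ((j:ℝ) * m) : ℝ) : ℂ) * (cutDy j ξ * a x ξ)) m (J + 1) f x =
      ∑' ξ, cutLow J ξ * (eChar x ξ * a x ξ * fc f ξ) := by
  obtain ⟨_, -, hF⟩ := hb.exists_support
  have h0 : ∀ j : ℕ, (((2:ℝ) ^ (-((j:ℝ) * m)) : ℝ) : ℂ) * (((2:ℝ) ^ ((j:ℝ) * m) : ℝ) : ℂ) = 1 := fun j => by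
    rw [← Complex.ofReal_mul, ← Real.rpow_add (by norm_num)]; simp
  have h1 : ∀ j, HasSum (fun ξ => cutDy j ξ * (eChar x ξ * a x ξ * fc f ξ))
      ((((2:ℝ) ^ (-((j:ℝ) * m)) : ℝ) : ℂ) *
        kerOp (symK fun x ξ => (((2:ℝ) ^ ((j:ℝ) * m) : ℝ) : ℂ) * (cutDy j ξ * a x ξ)) f x) := fun j => by
    obtain ⟨F, -, hF⟩ := hF j
    rw [kerOp_symK hF hf, Finset.mul_sum]
    have e : ∀ ξ, (((2:ℝ) ^ (-((j:ℝ) * m)) : ℝ) : ℂ) * (fc f ξ * ((((2:ℝ) ^ ((j:ℝ) * m) : ℝ) : ℂ) *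
        (cutDy j ξ * a x ξ)) * eChar x ξ) = cutDy j ξ * (eChar x ξ * a x ξ * fc f ξ) := fun ξ => by
      linear_combination (fc f ξ * (cutDy j ξ * a x ξ) * eChar x ξ) * h0 j
    simp only [e]
    refine hasSum_sum_of_ne_finset_zero fun ξ hξ => ?_
    rw [← e, hF x ξ hξ]; simp
  have h2 := (hasSum_sum (s := Finset.range (J + 1)) fun j _ => h1 j).tsum_eq
  simp only [← Finset.sum_mul, sum_cutDy] at h2
  exact h2.symm

theorem tendsto_cutLow (ξ : Fin n → ℤ) : Filter.Tendsto (fun J => cutLow J ξ) Filter.atTop (nhds 1) := by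
  refine tendsto_const_nhds.congr' ?_
  filter_upwards [(tendsto_pow_atTop_atTop_of_one_lt (one_lt_two : (1:ℝ) < 2)).eventually_ge_atTop
    ‖castZ ξ‖] with J hJ
  exact (cutLow_eq_one hJ).symm

theorem enorm_Op_le_liminf {a : (Fin n → ℝ) → (Fin n → ℤ) → ℂ} {f : (Fin n → ℝ) → ℂ} (hp : 0 < p)
    (x : Fin n → ℝ) : ‖Op a f x‖ₑ ^ p ≤ Filter.liminf (fun J : ℕ =>
      ‖∑' ξ, cutLow J ξ * (eChar x ξ * a x ξ * fc f ξ)‖ₑ ^ p) Filter.atTop := by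
  by_cases hs : Summable fun ξ => eChar x ξ * a x ξ * fc f ξ
  · have h : Filter.Tendsto (fun J : ℕ => ∑' ξ, cutLow J ξ * (eChar x ξ * a x ξ * fc f ξ)) Filter.atTop
        (nhds (Op a f x)) := by
      refine tendsto_tsum_of_dominated_convergence hs.norm (fun ξ => ?_)
        (Filter.Eventually.of_forall fun J ξ => ?_)
      · simpa using (tendsto_cutLow ξ).mul_const (eChar x ξ * a x ξ * fc f ξ)
      · rw [norm_mul]
        exact mul_le_of_le_one_left (norm_nonneg _) (norm_bumpC_le _)
    have h2 := (ENNReal.continuous_rpow_const (y := p)).continuousAt.tendsto.comp h.enorm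
    exact h2.liminf_eq.ge
  · rw [Op, tsum_eq_zero_of_not_summable hs, enorm_zero, ENNReal.zero_rpow_of_pos hp]
    exact zero_le

theorem lpT_le_of_lintegral_le {g f : (Fin n → ℝ) → ℂ} (hf : BddMeas f) {D : ℝ≥0∞} (hD : D ≠ ⊤)
    (hp : 0 < p) (h : ∫⁻ x, ‖g x‖ₑ ^ p ∂μT n ≤ D * ∫⁻ x, ‖f x‖ₑ ^ p ∂μT n) :
    lpT n p g ≤ D.toReal ^ (1 / p) * lpT n p f := by
  have he : ∀ (φ : (Fin n → ℝ) → ℂ) x, ENNReal.ofReal (‖φ x‖ ^ p) = ‖φ x‖ₑ ^ p := fun φ x => by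
    rw [← ofReal_norm, ENNReal.ofReal_rpow_of_nonneg (norm_nonneg _) hp.le]
  have hnn : ∀ φ : (Fin n → ℝ) → ℂ, 0 ≤ᵐ[μT n] fun x => ‖φ x‖ ^ p := fun φ =>
    Filter.Eventually.of_forall fun x => by positivity
  have hfin : ∫⁻ x, ‖f x‖ₑ ^ p ∂μT n ≠ ⊤ := by
    obtain ⟨-, M, hM⟩ := hf
    refine ((lintegral_mono (g := fun _ => ENNReal.ofReal (M ^ p)) fun x => ?_).trans_lt ?_).ne
    · rw [← he]
      exact ENNReal.ofReal_le_ofReal (Real.rpow_le_rpow (norm_nonneg _) (hM x) hp.le)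
    · simp
  have e1 : ∫ x, ‖f x‖ ^ p ∂μT n = (∫⁻ x, ‖f x‖ₑ ^ p ∂μT n).toReal := by
    rw [integral_eq_lintegral_of_nonneg_ae (hnn f) (hf.1.norm.pow_const p).aestronglyMeasurable]
    simp only [he]
  have e2 : ∫ x, ‖g x‖ ^ p ∂μT n ≤ (∫⁻ x, ‖g x‖ₑ ^ p ∂μT n).toReal := by
    by_cases hg : AEStronglyMeasurable (fun x => ‖g x‖ ^ p) (μT n)
    · rw [integral_eq_lintegral_of_nonneg_ae (hnn g) hg]
      simp only [he]; rfl
    · rw [integral_non_aestronglyMeasurable hg]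
      exact ENNReal.toReal_nonneg
  have e3 := e2.trans (ENNReal.toReal_mono (ENNReal.mul_ne_top hD hfin) h)
  rw [ENNReal.toReal_mul, ← e1] at e3
  rw [lpT, lpT, ← Real.mul_rpow ENNReal.toReal_nonneg (integral_nonneg fun x => by positivity)]
  exact Real.rpow_le_rpow (integral_nonneg fun x => by positivity) e3 (by positivity)

theorem usym_of_symbDxD {μ : ℝ} {a : (Fin n → ℝ) → (Fin n → ℤ) → ℂ} (ha : ∀ ξ, SmoothPer fun x => a x ξ)
    (h : ∀ α β : Fin n → ℕ, ∃ C : ℝ, 0 < C ∧ ∀ (x : Fin n → ℝ) (ξ : Fin n → ℤ),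
      ‖symbDxD β α a x ξ‖ ≤ C * jb ξ ^ (μ - ρ * (∑ j, (α j : ℝ)) + δ * ∑ j, (β j : ℝ))) :
    USym ρ δ μ fun (_ : Unit) => a := by
  refine ⟨fun _ => ha, fun u v => ?_⟩
  obtain ⟨C, -, hC⟩ := h (fun j => v.count j) fun j => u.count j
  refine ⟨C, fun _ x ξ => ?_⟩
  rw [length_eq_sum_count, length_eq_sum_count, pdw_perm (mIdxList_count_perm u) (SmoothPer.ddw ha v ξ).1]
  simp only [ddw_perm (mIdxList_count_perm v)]
  exact hC x ξ

end

end

/-- **Fefferman condition, periodic version.** Let `0 ≤ δ < ρ ≤ 1`, `δ < 1`, `1 < p < ∞`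
and `m_p = n(1-ρ)|1/p - 1/2|`.  If `a : 𝕋ⁿ × ℤⁿ → ℂ` satisfies
`|∂_x^β Δ_ξ^α a(x,ξ)| ≤ C_{α,β} ⟨ξ⟩^{-m_p - ρ|α| + δ|β|}` for all multi-indices `α, β`,
then `a(x,D)` is bounded on `L^p(𝕋ⁿ)`. -/
theorem periodic_pseudodiff_fefferman_condition_Lp_bounded
    (n : ℕ) (hn : 1 ≤ n) (δ ρ p : ℝ)
    (hδ0 : 0 ≤ δ) (hδρ : δ < ρ) (hρ1 : ρ ≤ 1) (hδ1 : δ < 1) (hp1 : 1 < p)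
    (a : (Fin n → ℝ) → (Fin n → ℤ) → ℂ)
    (ha_smooth : ∀ ξ, ContDiff ℝ (⊤ : ℕ∞) fun x => a x ξ)
    (ha_per : ∀ ξ, Per fun x => a x ξ)
    (ha : ∀ α β : Fin n → ℕ, ∃ C : ℝ, 0 < C ∧
      ∀ (x : Fin n → ℝ) (ξ : Fin n → ℤ),
        ‖symbDxD β α a x ξ‖ ≤
          C * jb ξ ^ (-((n : ℝ) * (1 - ρ) * |1 / p - 1 / 2|) - ρ * (∑ j, (α j : ℝ)) +
            δ * ∑ j, (β j : ℝ))) :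
    ∃ C : ℝ, 0 < C ∧ ∀ f : (Fin n → ℝ) → ℂ, ContDiff ℝ (⊤ : ℕ∞) f → Per f →
      lpT n p (Op a f) ≤ C * lpT n p f := by
  have hp0 : 0 < p := by linarith
  have hloc := loc_cutDy_mul hρ1 (usym_of_symbDxD (fun ξ => ⟨ha_smooth ξ, ha_per ξ⟩) ha)
  rw [neg_neg] at hloc
  obtain ⟨D, hD, h⟩ := hloc.exists_Lp hn hδ0 hδρ hρ1 hp1
  refine ⟨D.toReal ^ (1 / p) + 1, by positivity, fun f hf hfp => ?_⟩
  have hfb : BddMeas f := SmoothPer.bddMeas ⟨hf, hfp⟩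
  have hle : ∫⁻ x, ‖Op a f x‖ₑ ^ p ∂μT n ≤ D * ∫⁻ x, ‖f x‖ₑ ^ p ∂μT n := by
    refine (lintegral_mono fun x => enorm_Op_le_liminf hp0 x).trans ?_
    simp only [← kerSum_symK_eq_tsum hloc _ hfb]
    refine (lintegral_liminf_le fun J => ?_).trans ?_
    · exact (hloc.bddMeas_kerSum _ (J + 1) hfb).1.enorm.pow_const p
    · exact Filter.liminf_le_of_frequently_le' (Filter.Frequently.of_forall fun J => h (J + 1) f hfb)
  refine (lpT_le_of_lintegral_le hfb hD hp0 hle).trans ?_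
  have : 0 ≤ lpT n p f := Real.rpow_nonneg (integral_nonneg fun x => by positivity) _
  linarith
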